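/- Let W = W₁ × W₂ be a direct product of finite Coxeter groups, with length and excess functions satisfying ℓ(w₁,w₂) = ℓ(w₁) + ℓ(w₂). Then the excess satisfies e(w₁,w₂) = e(w₁) + e(w₂) for all (w₁,w₂) ∈ W. -/

import Mathlib

/-- The excess of an element `w` of a group with length function `ℓ`:
the least `d` such that `w = στ` with `σ², τ² = 1` and `ℓσ + ℓτ = ℓw + d`. -/
noncomputable def excess {W : Type*} [Group W] (ℓ : W → ℕ) (w : W) : ℕ :=
  sInf {d : ℕ | ∃ σ τ : W, σ * σ = 1 ∧ τ * τ = 1 ∧ w = σ * τ ∧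
    ℓ σ + ℓ τ = ℓ w + d}

namespace CoxeterMatrix

variable {B : Type*} (M : CoxeterMatrix B)

/-- Twice the Gram matrix of the simple roots. -/
noncomputable def gram (i j : B) : ℝ := -2 * Real.cos (Real.pi / M i j)

theorem gram_self (i : B) : M.gram i i = 2 := by simp [gram]

theorem gram_comm (i j : B) : M.gram i j = M.gram j i := by simp [gram, M.symmetric i j]

theorem cos_pi_div_natCast_nonneg {m : ℕ} (hm : m ≠ 1) : 0 ≤ Real.cos (Real.pi / m) := by
  rcases Nat.eq_zero_or_pos m with rfl | h
  · simp
  · apply Real.cos_nonneg_of_neg_pi_div_two_le_of_le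
    · have : 0 ≤ Real.pi / m := by positivity
      linarith [Real.pi_pos]
    · gcongr
      exact_mod_cast (by omega : 2 ≤ m)

theorem gram_nonpos {i j : B} (h : i ≠ j) : M.gram i j ≤ 0 := by
  have := cos_pi_div_natCast_nonneg (M.off_diagonal i j h)
  unfold gram; linarith

/-- The action of a simple reflection on coordinates dual to the simple roots. -/
noncomputable def refl (i : B) : Module.End ℝ (B → ℝ) where
  toFun c j := c j - M.gram i j * c i
  map_add' c d := by ext j; simp; ring
  map_smul' a c := by ext j; simp; ring

theorem refl_apply (i : B) (c : B → ℝ) (j : B) : M.refl i c j = c j - M.gram i j * c i := rfl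

theorem refl_apply_self (i : B) (c : B → ℝ) : M.refl i c i = - c i := by
  rw [refl_apply, gram_self]; ring

theorem refl_mul_self (i : B) : M.refl i * M.refl i = 1 := by
  refine LinearMap.ext fun c => funext fun j => ?_
  simp only [Module.End.mul_apply, Module.End.one_apply, refl_apply, gram_self]
  ring

/-- Shifted Chebyshev values: `cheb κ k` is `sin ((k - 1) θ) / sin θ` when `κ = 2 cos θ`. -/
noncomputable def cheb (κ : ℝ) : ℕ → ℝ
  | 0 => -1
  | 1 => 0
  | (k + 2) => κ * cheb κ (k + 1) - cheb κ k

theorem sin_mul_cheb (θ : ℝ) (k : ℕ) :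
    Real.sin θ * cheb (2 * Real.cos θ) k = Real.sin ((k - 1) * θ) := by
  induction k using Nat.twoStepInduction with
  | zero => simp [cheb]
  | one => simp [cheb]
  | more k h0 h1 =>
    rw [cheb, mul_sub, h0]
    have : Real.sin θ * (2 * Real.cos θ * cheb (2 * Real.cos θ) (k + 1))
      = 2 * Real.cos θ * (Real.sin θ * cheb (2 * Real.cos θ) (k + 1)) := by ring
    rw [this, h1]
    push_cast
    have e1 : ((k : ℝ) + 2 - 1) * θ = k * θ + θ := by ring
    have e2 : ((k : ℝ) - 1) * θ = k * θ - θ := by ring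
    have e3 : ((k : ℝ) + 1 - 1) * θ = k * θ := by ring
    rw [e1, e2, e3, Real.sin_add, Real.sin_sub]; ring

theorem cheb_two (k : ℕ) : cheb 2 k = k - 1 := by
  induction k using Nat.twoStepInduction with
  | zero => simp [cheb]
  | one => simp [cheb]
  | more k h0 h1 => rw [cheb, h0, h1]; push_cast; ring

theorem sin_pi_div_pos {m : ℕ} (hm : 2 ≤ m) : 0 < Real.sin (Real.pi / m) := by
  have hm' : (2 : ℝ) ≤ m := by exact_mod_cast hm
  apply Real.sin_pos_of_pos_of_lt_pi
  · have := Real.pi_pos; positivity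
  · exact div_lt_self Real.pi_pos (by linarith)

theorem cheb_nonneg {m : ℕ} (hm : m ≠ 1) {k : ℕ} (hk : m ≠ 0 → k ≤ m) :
    0 ≤ cheb (2 * Real.cos (Real.pi / m)) (k + 1) := by
  rcases Nat.eq_zero_or_pos m with rfl | h
  · simp [cheb_two]
  · have hm2 : 2 ≤ m := by omega
    have hs := sin_pi_div_pos hm2
    refine nonneg_of_mul_nonneg_right (a := Real.sin (Real.pi / m)) ?_ hs
    rw [sin_mul_cheb]
    have hm' : (0 : ℝ) < m := by exact_mod_cast h
    apply Real.sin_nonneg_of_nonneg_of_le_pi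
    · push_cast; rw [add_sub_cancel_right]; have := Real.pi_pos; positivity
    · push_cast; rw [add_sub_cancel_right, mul_div_assoc', div_le_iff₀ hm', mul_comm]
      have : (k : ℝ) ≤ m := by exact_mod_cast hk (by omega)
      exact mul_le_mul_of_nonneg_left this Real.pi_pos.le

theorem cheb_pos {m : ℕ} (hm : m ≠ 1) {k : ℕ} (h0 : k ≠ 0) (hk : m ≠ 0 → k < m) :
    0 < cheb (2 * Real.cos (Real.pi / m)) (k + 1) := by
  rcases Nat.eq_zero_or_pos m with rfl | h
  · simp [cheb_two]; omega
  · have hm2 : 2 ≤ m := by omega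
    have hs := sin_pi_div_pos hm2
    refine pos_of_mul_pos_right (a := Real.sin (Real.pi / m)) ?_ hs.le
    rw [sin_mul_cheb]
    have hm' : (0 : ℝ) < m := by exact_mod_cast h
    have hk' : (0 : ℝ) < k := by exact_mod_cast Nat.pos_of_ne_zero h0
    apply Real.sin_pos_of_pos_of_lt_pi
    · push_cast; rw [add_sub_cancel_right]; have := Real.pi_pos; positivity
    · push_cast; rw [add_sub_cancel_right, mul_div_assoc', div_lt_iff₀ hm', mul_comm]
      have : (k : ℝ) < m := by exact_mod_cast hk (by omega)
      exact mul_lt_mul_of_pos_left this Real.pi_pos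

theorem cheb_double {m : ℕ} (hm : 2 ≤ m) :
    cheb (2 * Real.cos (Real.pi / m)) (2 * m) = -1 ∧
    cheb (2 * Real.cos (Real.pi / m)) (2 * m + 1) = 0 := by
  have hs := (sin_pi_div_pos hm).ne'
  have hm' : (m : ℝ) ≠ 0 := by positivity
  constructor <;> apply mul_left_cancel₀ hs <;> rw [sin_mul_cheb]
  · push_cast
    have : (2 * (m : ℝ) - 1) * (Real.pi / m) = -(Real.pi / m) + 2 * Real.pi := by
      field_simp; ring
    rw [this, Real.sin_add_two_pi, Real.sin_neg]; ring
  · push_cast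
    have : (2 * (m : ℝ) + 1 - 1) * (Real.pi / m) = 2 * Real.pi := by
      field_simp; ring
    rw [this, Real.sin_two_pi]; ring

/-- The operator of the alternating word of length `k` in `i, j` ending in `j`. -/
noncomputable def altRefl (i j : B) : ℕ → Module.End ℝ (B → ℝ)
  | 0 => 1
  | (k + 1) => (if Even k then M.refl j else M.refl i) * altRefl i j k

theorem altRefl_apply (i j : B) (c : B → ℝ) (k : ℕ) :
    (Even k → M.altRefl i j k c i =
        -(cheb (-M.gram i j) (k + 1) * c j + cheb (-M.gram i j) k * c i) ∧
      M.altRefl i j k c j =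
        cheb (-M.gram i j) (k + 2) * c j + cheb (-M.gram i j) (k + 1) * c i) ∧
    (¬ Even k → M.altRefl i j k c j =
        -(cheb (-M.gram i j) (k + 1) * c j + cheb (-M.gram i j) k * c i) ∧
      M.altRefl i j k c i =
        cheb (-M.gram i j) (k + 2) * c j + cheb (-M.gram i j) (k + 1) * c i) := by
  induction k with
  | zero => simp [altRefl, cheb]
  | succ k ih =>
    by_cases h : Even k
    · have h' : ¬ Even (k + 1) := by simpa [Nat.even_add_one] using h
      obtain ⟨h1, h2⟩ := ih.1 h
      simp only [h', altRefl, h, if_true, false_imp_iff, true_and, not_false_eq_true, true_imp_iff,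
        Module.End.mul_apply, refl_apply_self, refl_apply, h1, h2, M.gram_comm j i, add_assoc,
        Nat.reduceAdd]
      · rw [cheb.eq_3 _ (k + 1), cheb.eq_3 _ k]; ring
    · have h' : Even (k + 1) := by simpa [Nat.even_add_one] using h
      obtain ⟨h1, h2⟩ := ih.2 h
      simp only [h', altRefl, h, if_false, not_true, false_imp_iff, and_true,
        true_imp_iff, Module.End.mul_apply, refl_apply_self, refl_apply, h1, h2, add_assoc,
        Nat.reduceAdd]
      · rw [cheb.eq_3 _ (k + 1), cheb.eq_3 _ k]; ring_nf; exact ⟨trivial, trivial⟩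

theorem altRefl_two_mul (i j : B) (n : ℕ) : M.altRefl i j (2 * n) = (M.refl i * M.refl j) ^ n := by
  induction n with
  | zero => rfl
  | succ n ih =>
    have h1 : ¬ Even (2 * n + 1) := by simp
    rw [mul_add, mul_one, pow_succ', ← ih, altRefl, altRefl]
    simp only [h1, even_two_mul, if_true, if_false, mul_assoc]

theorem altRefl_apply_eq (i j : B) (c : B → ℝ) (k : ℕ) :
    ∃ x y : ℝ, ∀ b, M.altRefl i j k c b = c b + x * M.gram i b + y * M.gram j b := by
  induction k with
  | zero => exact ⟨0, 0, by simp [altRefl]⟩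
  | succ k ih =>
    obtain ⟨x, y, h⟩ := ih
    by_cases hk : Even k
    · refine ⟨x, y - M.altRefl i j k c j, fun b => ?_⟩
      simp only [altRefl, hk, if_true, Module.End.mul_apply, refl_apply, h]; ring
    · refine ⟨x - M.altRefl i j k c i, y, fun b => ?_⟩
      simp only [altRefl, hk, if_false, Module.End.mul_apply, refl_apply, h]; ring

theorem isLiftable_refl : M.IsLiftable M.refl := by
  intro i j
  by_cases hij : i = j
  · subst hij; simp [refl_mul_self]
  rcases Nat.eq_zero_or_pos (M i j) with h0 | h0
  · simp [h0]
  have h1 := M.off_diagonal i j hij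
  have h2 : 2 ≤ M i j := by omega
  have hg : -M.gram i j = 2 * Real.cos (Real.pi / M i j) := by simp [gram]
  obtain ⟨e1, e2⟩ := cheb_double h2
  rw [← hg] at e1 e2
  rw [← altRefl_two_mul]
  apply LinearMap.ext
  intro c
  obtain ⟨hi, hj⟩ := (M.altRefl_apply i j c (2 * M i j)).1 (by simp)
  obtain ⟨x, y, h⟩ := M.altRefl_apply_eq i j c (2 * M i j)
  rw [cheb, e1, e2, h] at hj
  rw [e1, e2, h] at hi
  simp only [gram_self, M.gram_comm j i] at hi hj
  have hlt : 0 < 4 - M.gram i j ^ 2 := by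
    have := sin_pi_div_pos h2
    have h3 := Real.sin_sq_add_cos_sq (Real.pi / M i j)
    have : M.gram i j ^ 2 = 4 * Real.cos (Real.pi / M i j) ^ 2 := by rw [gram]; ring
    nlinarith
  have hx : x = 0 := by
    have : (4 - M.gram i j ^ 2) * x = 0 := by
      linear_combination 2 * hi - M.gram i j * hj
    exact (mul_eq_zero.mp this).resolve_left hlt.ne'
  have hy : y = 0 := by
    subst hx; linarith
  ext b
  simp [h, hx, hy]

theorem altRefl_pos {i j : B} {k : ℕ} (hM : M i j ≠ 1) (h0 : k ≠ 0)
    (hk : M i j ≠ 0 → k < M i j) {c : B → ℝ} (hi : 0 < c i) (hj : 0 < c j) :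
    (Even k → 0 < M.altRefl i j k c j) ∧ (¬ Even k → 0 < M.altRefl i j k c i) := by
  have hg : -M.gram i j = 2 * Real.cos (Real.pi / M i j) := by simp [gram]
  have p1 := cheb_nonneg hM (k := k + 1) (fun h => hk h)
  have p2 := cheb_pos hM (k := k) h0 hk
  rw [← hg] at p1 p2
  refine ⟨fun h => ?_, fun h => ?_⟩
  · rw [((M.altRefl_apply i j c k).1 h).2]; positivity
  · rw [((M.altRefl_apply i j c k).2 h).2]; positivity

end CoxeterMatrix

namespace CoxeterSystem

variable {B W : Type*} [Group W] {M : CoxeterMatrix B} (cs : CoxeterSystem M W)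

/-- The (dual) geometric representation. -/
noncomputable def dualRep : W →* Module.End ℝ (B → ℝ) := cs.lift ⟨M.refl, M.isLiftable_refl⟩

theorem dualRep_simple (i : B) : cs.dualRep (cs.simple i) = M.refl i :=
  cs.lift_apply_simple M.isLiftable_refl i

theorem dualRep_alternatingWord (i j : B) (k : ℕ) :
    cs.dualRep (cs.wordProd (alternatingWord i j k)) = M.altRefl i j k := by
  induction k with
  | zero => simp [alternatingWord, CoxeterMatrix.altRefl]
  | succ k ih =>
    rw [alternatingWord_succ', wordProd_cons, map_mul, ih, dualRep_simple, CoxeterMatrix.altRefl]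
    split_ifs <;> rfl


/-- The alternating word of length `k` in `i, j` starting with `j`. -/
def altFrom (i j : B) (k : ℕ) : List B :=
  if Even k then alternatingWord j i k else alternatingWord i j k

theorem altFrom_succ (i j : B) (k : ℕ) :
    altFrom i j (k + 1) = (altFrom i j k).concat (if Even k then j else i) := by
  by_cases h : Even k
  · have h' : ¬ Even (k + 1) := by simpa [Nat.even_add_one] using h
    simp [altFrom, h, h', alternatingWord_succ]
  · have h' : Even (k + 1) := by simpa [Nat.even_add_one] using h
    simp [altFrom, h, h', alternatingWord_succ]

theorem altFrom_succ_eq_cons (i j : B) (k : ℕ) :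
    altFrom i j (k + 1) = j :: altFrom j i k := by
  by_cases h : Even k
  · have h' : ¬ Even (k + 1) := by simpa [Nat.even_add_one] using h
    simp [altFrom, h, h', alternatingWord_succ']
  · have h' : Even (k + 1) := by simpa [Nat.even_add_one] using h
    simp [altFrom, h, h', alternatingWord_succ']

theorem length_altFrom (i j : B) (k : ℕ) : (altFrom i j k).length = k := by
  unfold altFrom; split_ifs <;> simp

theorem wordProd_altFrom_comm (i j : B) :
    cs.wordProd (altFrom i j (M i j)) = cs.wordProd (altFrom j i (M i j)) := by
  have h := cs.wordProd_braidWord_eq i j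
  simp only [braidWord, M.symmetric j i] at h
  unfold altFrom
  split_ifs
  · exact h.symm
  · exact h

theorem dualRep_pos (w : W) (i : B) (hw : ¬ cs.IsLeftDescent w i) {c : B → ℝ}
    (hc : ∀ b, 0 < c b) : 0 < cs.dualRep w c i := by
  induction hn : cs.length w using Nat.strong_induction_on generalizing w i with
  | _ n ih =>
  by_cases hw1 : w = 1
  · subst hw1; simpa using hc i
  obtain ⟨j, hj⟩ := cs.exists_leftDescent_of_ne_one hw1
  have hij : i ≠ j := by rintro rfl; exact hw hj
  let P : ℕ → W → Prop := fun k v =>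
    w = cs.wordProd (altFrom i j k) * v ∧ cs.length w = k + cs.length v
  have hle : ∀ k v, P k v → k ≤ cs.length w := fun k v h => by have := h.2; omega
  have hdown : ∀ k v, P (k + 1) v →
      P k (cs.simple (if Even k then j else i) * v) := by
    rintro k v ⟨h1, h2⟩
    rw [altFrom_succ, wordProd_concat, mul_assoc] at h1
    refine ⟨h1, ?_⟩
    have a1 := cs.length_mul_le (cs.wordProd (altFrom i j k))
      (cs.simple (if Even k then j else i) * v)
    have a2 := cs.length_wordProd_le (altFrom i j k)
    rw [← h1] at a1
    rw [length_altFrom] at a2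
    rcases cs.length_simple_mul v (if Even k then j else i) with a3 | a3 <;> omega
  have hup : ∀ k v, P k v → cs.IsLeftDescent v (if Even k then j else i) →
      ∃ v', P (k + 1) v' := by
    rintro k v ⟨h1, h2⟩ h3
    refine ⟨cs.simple (if Even k then j else i) * v, ?_, ?_⟩
    · rw [altFrom_succ, wordProd_concat, mul_assoc, simple_mul_simple_cancel_left]; exact h1
    · have := cs.isLeftDescent_iff.1 h3; omega
  have hdown' : ∀ k l, (∃ v, P (k + l) v) → ∃ v, P k v := by
    intro k l
    induction l with
    | zero => exact id
    | succ l ihl => rintro ⟨v, hv⟩; exact ihl ⟨_, hdown _ _ hv⟩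
  have h1 : ∃ v, P 1 v := by
    refine hup 0 w ⟨by simp [altFrom, alternatingWord], by simp⟩ (by simpa using hj)
  classical
  let k := Nat.findGreatest (fun k => ∃ v, P k v) (cs.length w)
  obtain ⟨v1, hv1⟩ := h1
  have hk1 : 1 ≤ k := Nat.le_findGreatest (hle _ _ hv1) ⟨v1, hv1⟩
  obtain ⟨v, hv⟩ : ∃ v, P k v :=
    Nat.findGreatest_spec (P := fun k => ∃ v, P k v) (hle _ _ hv1) ⟨v1, hv1⟩
  have hkm : M i j ≠ 0 → k < M i j := by
    intro h0
    by_contra! hlt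
    obtain ⟨u, hu1, hu2⟩ := hdown' (M i j) (k - M i j) ⟨v, by rwa [Nat.add_sub_cancel' hlt]⟩
    apply hw
    obtain ⟨m, hm⟩ := Nat.exists_eq_succ_of_ne_zero h0
    rw [wordProd_altFrom_comm] at hu1
    rw [hm] at hu1 hu2
    rw [altFrom_succ_eq_cons, wordProd_cons, mul_assoc] at hu1
    have : cs.simple i * w = cs.wordProd (altFrom i j m) * u := by
      rw [hu1, simple_mul_simple_cancel_left]
    rw [IsLeftDescent, this]
    have a1 := cs.length_mul_le (cs.wordProd (altFrom i j m)) u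
    have a2 := cs.length_wordProd_le (altFrom i j m)
    rw [length_altFrom] at a2
    omega
  have hn1 : ¬ cs.IsLeftDescent v (if Even k then j else i) := by
    intro h
    obtain ⟨v', hv'⟩ := hup k v hv h
    have : k + 1 ≤ k := Nat.le_findGreatest (hle _ _ hv') ⟨v', hv'⟩
    omega
  have hn2 : ¬ cs.IsLeftDescent v (if Even k then i else j) := by
    obtain ⟨l, hl⟩ : ∃ l, k = l + 1 := ⟨k - 1, by omega⟩
    rw [hl] at hv ⊢
    have h2 := (hdown l v hv).2
    have h3 := hv.2
    have e : (if Even (l + 1) then i else j) = if Even l then j else i := by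
      by_cases h : Even l <;> simp [h, Nat.even_add_one]
    rw [e, IsLeftDescent]
    omega
  have hvlt : cs.length v < n := by have := hv.2; omega
  have hvi : 0 < cs.dualRep v c i ∧ 0 < cs.dualRep v c j := by
    by_cases h : Even k <;> simp only [h, if_true, if_false] at hn1 hn2
    · exact ⟨ih _ hvlt v i hn2 rfl, ih _ hvlt v j hn1 rfl⟩
    · exact ⟨ih _ hvlt v i hn1 rfl, ih _ hvlt v j hn2 rfl⟩
  have hM := M.off_diagonal i j hij
  rw [hv.1, map_mul, Module.End.mul_apply, altFrom]
  by_cases h : Even k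
  · simp only [h, if_true, dualRep_alternatingWord]
    rw [M.symmetric] at hM hkm
    exact (M.altRefl_pos hM (by omega) hkm hvi.2 hvi.1).1 h
  · simp only [h, if_false, dualRep_alternatingWord]
    exact (M.altRefl_pos hM (by omega) hkm hvi.1 hvi.2).2 h

theorem eq_one_of_dualRep_eq_self {w : W} {c : B → ℝ} (hc : ∀ b, 0 < c b)
    (h : cs.dualRep w c = c) : w = 1 := by
  by_contra hw
  obtain ⟨j, hj⟩ := cs.exists_leftDescent_of_ne_one hw
  have := cs.dualRep_pos (cs.simple j * w) j
    ((cs.isLeftDescent_iff_not_isLeftDescent_mul).1 hj) hc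
  rw [map_mul, Module.End.mul_apply, h, dualRep_simple, M.refl_apply_self] at this
  linarith [hc j]

theorem eq_of_dualRep_eq {w w' : W} {c : B → ℝ} (hc : ∀ b, 0 < c b)
    (h : cs.dualRep w c = cs.dualRep w' c) : w = w' := by
  have : w'⁻¹ * w = 1 := by
    apply cs.eq_one_of_dualRep_eq_self hc
    rw [map_mul, Module.End.mul_apply, h, ← Module.End.mul_apply, ← map_mul]
    simp
  exact (inv_mul_eq_one.1 this).symm

theorem simple_injective : Function.Injective cs.simple := by
  intro i j h
  by_contra hij
  have h1 : cs.dualRep (cs.simple i) 1 i = cs.dualRep (cs.simple j) 1 i := by rw [h]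
  rw [dualRep_simple, dualRep_simple, M.refl_apply_self, M.refl_apply] at h1
  have := M.gram_nonpos (Ne.symm hij)
  simp at h1
  linarith

end CoxeterSystem

namespace CoxeterSystem

variable {B W : Type*} [Group W] {M : CoxeterMatrix B} (cs : CoxeterSystem M W)

theorem finite_index (cs : CoxeterSystem M W) [Finite W] : Finite B := Finite.of_injective _ cs.simple_injective

/-- The average of the standard inner product over the group. -/
noncomputable def avgForm [Fintype B] [Fintype W] : LinearMap.BilinForm ℝ (B → ℝ) :=
  LinearMap.mk₂ ℝ (fun c d => ∑ w : W, cs.dualRep w c ⬝ᵥ cs.dualRep w d)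
    (by intros; simp [add_dotProduct, Finset.sum_add_distrib])
    (by intros; simp [smul_dotProduct, Finset.mul_sum])
    (by intros; simp [dotProduct_add, Finset.sum_add_distrib])
    (by intros; simp [dotProduct_smul, Finset.mul_sum])

theorem avgForm_apply [Fintype B] [Fintype W] (c d : B → ℝ) :
    cs.avgForm c d = ∑ w : W, cs.dualRep w c ⬝ᵥ cs.dualRep w d := rfl

theorem avgForm_self_pos [Fintype B] [Fintype W] {c : B → ℝ} (hc : c ≠ 0) :
    0 < cs.avgForm c c := by
  have h : ∀ d : B → ℝ, 0 ≤ d ⬝ᵥ d := fun d => Finset.sum_nonneg fun b _ => mul_self_nonneg _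
  rw [avgForm_apply]
  refine Finset.sum_pos' (fun w _ => h _) ⟨1, Finset.mem_univ _, ?_⟩
  simp only [map_one, Module.End.one_apply]
  exact lt_of_le_of_ne (h c) fun h0 => hc (dotProduct_self_eq_zero.1 h0.symm)

theorem avgForm_refl [Fintype B] [Fintype W] (i : B) (c d : B → ℝ) :
    cs.avgForm (M.refl i c) (M.refl i d) = cs.avgForm c d := by
  rw [avgForm_apply, avgForm_apply]
  refine Fintype.sum_equiv (Equiv.mulRight (cs.simple i)) _ _ fun w => ?_
  simp [map_mul, dualRep_simple]

theorem refl_eq_sub (i : B) (c : B → ℝ) : M.refl i c = c - c i • M.gram i := by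
  ext j; simp [M.refl_apply, mul_comm]

theorem two_mul_avgForm_gram [Fintype B] [Fintype W] (i : B) (c : B → ℝ) :
    2 * cs.avgForm c (M.gram i) = c i * cs.avgForm (M.gram i) (M.gram i) := by
  have h := cs.avgForm_refl i c (M.gram i)
  rw [refl_eq_sub, refl_eq_sub, M.gram_self] at h
  simp only [map_sub, map_smul, LinearMap.sub_apply, LinearMap.smul_apply, smul_eq_mul] at h
  linarith

theorem gram_posDef (cs : CoxeterSystem M W) [Fintype B] [Fintype W] {x : B → ℝ} (hx : x ≠ 0) :
    0 < ∑ i, ∑ j, x i * x j * M.gram i j := by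
  set n : B → ℝ := fun i => cs.avgForm (M.gram i) (M.gram i) with hn
  have hg0 : ∀ i, M.gram i ≠ 0 := fun i h => by
    have := congrFun h i; rw [M.gram_self] at this; simp at this
  have hnpos : ∀ i, 0 < n i := fun i => cs.avgForm_self_pos (hg0 i)
  have hij : ∀ i j, 2 * cs.avgForm (M.gram i) (M.gram j) = M.gram i j * n j :=
    fun i j => cs.two_mul_avgForm_gram j (M.gram i)
  have hsymm : ∀ c d, cs.avgForm c d = cs.avgForm d c := fun c d => by
    simp [avgForm_apply, dotProduct_comm]
  have hnn : ∀ i j, M.gram i j ≠ 0 → n i = n j := fun i j h => by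
    have h1 := hij i j
    rw [hsymm, hij j i, M.gram_comm j i] at h1
    exact mul_left_cancel₀ h h1
  set y : B → ℝ := ∑ i, (x i / √(n i)) • M.gram i with hy
  have hyy : cs.avgForm y y = (∑ i, ∑ j, x i * x j * M.gram i j) / 2 := by
    rw [hy]
    simp only [map_sum, LinearMap.sum_apply, map_smul, LinearMap.smul_apply, smul_eq_mul,
      Finset.sum_div, Finset.mul_sum]
    rw [Finset.sum_comm]
    refine Finset.sum_congr rfl fun i _ => Finset.sum_congr rfl fun j _ => ?_
    have h1 : cs.avgForm (M.gram i) (M.gram j) = M.gram i j * n j / 2 := by linarith [hij i j]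
    rw [h1]
    by_cases h : M.gram i j = 0
    · simp [h]
    · rw [hnn i j h]
      have h2 := Real.mul_self_sqrt (hnpos j).le
      have h3 := (Real.sqrt_pos.2 (hnpos j)).ne'
      rw [← sq] at h2
      field_simp
      rw [h2]; ring
  have hy0 : y ≠ 0 := by
    intro h0
    apply hx
    have key : ∀ c : B → ℝ, ∑ i, x i / √(n i) * (c i * n i) = 0 := fun c => by
      have h1 : cs.avgForm c y = 0 := by rw [h0]; simp
      rw [hy] at h1
      simp only [map_sum, map_smul, smul_eq_mul] at h1
      have h2 : ∑ i, x i / √(n i) * (c i * n i) =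
          2 * ∑ i, x i / √(n i) * cs.avgForm c (M.gram i) := by
        rw [Finset.mul_sum]
        refine Finset.sum_congr rfl fun i _ => ?_
        rw [← cs.two_mul_avgForm_gram i c]; ring
      rw [h2, h1, mul_zero]
    classical
    ext i
    have h1 := key (Pi.single i 1)
    rw [Finset.sum_eq_single i (fun j _ hj => by simp [hj]) (by simp)] at h1
    have h3 := (Real.sqrt_pos.2 (hnpos i)).ne'
    have h4 := (hnpos i).ne'
    simpa [h3, h4] using h1
  have := cs.avgForm_self_pos hy0
  rw [hyy] at this
  linarith

theorem not_subharmonic (cs : CoxeterSystem M W) [Finite W] (S : Finset B) (hS : S.Nonempty)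
    {x : B → ℝ} (hx : ∀ b ∈ S, 0 < x b)
    (h : ∀ b ∈ S, ∃ N ⊆ S, b ∉ N ∧ 2 * x b ≤ ∑ c ∈ N, -M.gram b c * x c) : False := by
  classical
  have := cs.finite_index
  have := Fintype.ofFinite B
  have := Fintype.ofFinite W
  set z : B → ℝ := fun b => if b ∈ S then x b else 0 with hz
  have hzne : z ≠ 0 := fun h0 => by
    obtain ⟨b, hb⟩ := hS
    have h1 := congrFun h0 b
    simp only [hz, hb, if_true] at h1
    exact (hx b hb).ne' h1
  have hpos := cs.gram_posDef hzne
  have hsum : ∀ F : B → ℝ, (∀ b, b ∉ S → F b = 0) → ∑ b, F b = ∑ b ∈ S, F b := fun F hF =>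
    (Finset.sum_subset (Finset.subset_univ _) fun b _ hb => hF b hb).symm
  rw [hsum _ (fun b hb => by simp [hz, hb])] at hpos
  refine absurd hpos (not_lt.2 (Finset.sum_nonpos fun b hb => ?_))
  rw [hsum _ (fun b hb => by simp [hz, hb])]
  obtain ⟨N, hNS, hbN, h1⟩ := h b hb
  have h2 : ∑ c ∈ N, -M.gram b c * x c ≤ ∑ c ∈ S.erase b, -M.gram b c * x c := by
    refine Finset.sum_le_sum_of_subset_of_nonneg (fun c hc => ?_) fun c hc _ => ?_
    · exact Finset.mem_erase.2 ⟨fun h => hbN (h ▸ hc), hNS hc⟩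
    · have hc := Finset.mem_erase.1 hc
      exact mul_nonneg (by linarith [M.gram_nonpos hc.1.symm]) (hx c hc.2).le
  have h3 := Finset.add_sum_erase S (fun c => M.gram b c * x c) hb
  rw [M.gram_self] at h3
  have h4 : ∑ c ∈ S, z b * z c * M.gram b c = x b * ∑ c ∈ S, M.gram b c * x c := by
    rw [Finset.mul_sum]
    exact Finset.sum_congr rfl fun c hc => by simp only [hz, hb, hc, if_true]; ring
  rw [h4, ← h3]
  simp only [neg_mul, Finset.sum_neg_distrib] at h1 h2
  exact mul_nonpos_of_nonneg_of_nonpos (hx b hb).le (by linarith)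

/-- A version of `not_subharmonic` for an explicitly enumerated set of vertices. -/
theorem not_subharmonic_enum (cs : CoxeterSystem M W) [Finite W] {m : ℕ} (hm : 0 < m) {f : ℕ → B}
    (hf : Set.InjOn f (Set.Iio m)) {x : ℕ → ℝ} (hx : ∀ i < m, 0 < x i) (N : ℕ → Finset ℕ)
    (hN : ∀ i < m, ∀ j ∈ N i, j < m ∧ j ≠ i)
    (h : ∀ i < m, 2 * x i ≤ ∑ j ∈ N i, -M.gram (f i) (f j) * x j) : False := by
  classical
  have hinv : ∀ i < m, Function.invFunOn f (Set.Iio m) (f i) = i := fun i hi =>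
    hf.leftInvOn_invFunOn hi
  refine cs.not_subharmonic ((Finset.range m).image f) ⟨f 0, ?_⟩
    (x := fun b => x (Function.invFunOn f (Set.Iio m) b)) ?_ ?_
  · exact Finset.mem_image_of_mem _ (Finset.mem_range.2 hm)
  · simp only [Finset.mem_image, Finset.mem_range]
    rintro _ ⟨i, hi, rfl⟩
    rw [hinv i hi]; exact hx i hi
  · simp only [Finset.mem_image, Finset.mem_range]
    rintro _ ⟨i, hi, rfl⟩
    refine ⟨(N i).image f, ?_, ?_, ?_⟩
    · exact Finset.image_subset_image fun j hj => Finset.mem_range.2 (hN i hi j hj).1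
    · simp only [Finset.mem_image, not_exists, not_and]
      exact fun j hj hji => (hN i hi j hj).2 (hf (hN i hi j hj).1 hi hji)
    · rw [Finset.sum_image fun a ha b hb hab => hf (hN i hi a ha).1 (hN i hi b hb).1 hab, hinv i hi]
      refine (h i hi).trans_eq (Finset.sum_congr rfl fun j hj => ?_)
      rw [hinv j (hN i hi j hj).1]

end CoxeterSystem

/-- Every element of `G` is a product of two elements of order at most two. -/
def StronglyReal (G : Type*) [Group G] : Prop :=
  ∀ w : G, ∃ σ : G, σ * σ = 1 ∧ σ * w * (σ * w) = 1

universe u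

namespace StronglyReal

variable {G H : Type*} [Group G] [Group H]

theorem exists_eq_mul (h : StronglyReal G) (w : G) :
    ∃ σ τ : G, σ * σ = 1 ∧ τ * τ = 1 ∧ w = σ * τ := by
  obtain ⟨σ, h1, h2⟩ := h w
  exact ⟨σ, σ * w, h1, h2, by rw [← mul_assoc, h1, one_mul]⟩

theorem of_surjective (h : StronglyReal G) (f : G →* H) (hf : Function.Surjective f) :
    StronglyReal H := by
  intro w
  obtain ⟨v, rfl⟩ := hf w
  obtain ⟨σ, h1, h2⟩ := h v
  exact ⟨f σ, by rw [← map_mul, h1, map_one], by simp only [← map_mul, h2, map_one]⟩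

theorem prod (hG : StronglyReal G) (hH : StronglyReal H) : StronglyReal (G × H) := by
  rintro ⟨v, w⟩
  obtain ⟨σ, h1, h2⟩ := hG v
  obtain ⟨τ, h3, h4⟩ := hH w
  exact ⟨(σ, τ), by simp [h1, h3], by simp [h2, h4]⟩

theorem of_subsingleton [Subsingleton G] : StronglyReal G :=
  fun _ => ⟨1, Subsingleton.elim _ _, Subsingleton.elim _ _⟩

end StronglyReal

namespace CoxeterMatrix

variable {B : Type*} (M : CoxeterMatrix B)

/-- The Coxeter matrix induced on a set of vertices. -/
def induce (K : Set B) : CoxeterMatrix K where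
  M := Matrix.of fun i j => M i j
  isSymm := by ext i j; simp [M.symmetric]
  diagonal := by simp
  off_diagonal i j h := M.off_diagonal i j (by simpa [Subtype.ext_iff] using h)

theorem induce_apply (K : Set B) (i j : K) : M.induce K i j = M i j := rfl

/-- The homomorphism induced by the inclusion of a set of vertices. -/
noncomputable def induceHom (K : Set B) : (M.induce K).Group →* M.Group :=
  (M.induce K).toCoxeterSystem.lift ⟨fun i => M.simple i, fun i j => by
    simpa [induce_apply] using M.toCoxeterSystem.simple_mul_simple_pow i j⟩

theorem induceHom_simple (K : Set B) (i : K) :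
    M.induceHom K ((M.induce K).simple i) = M.simple i :=
  (M.induce K).toCoxeterSystem.lift_apply_simple _ i

theorem finite_induce_group [Finite M.Group] {K : Set B} (hK : ∀ i ∈ K, ∀ j ∉ K, M i j = 2) :
    Finite (M.induce K).Group := by
  classical
  let f : B → (M.induce K).Group := fun i => if h : i ∈ K then (M.induce K).simple ⟨i, h⟩ else 1
  have hsq : ∀ i : K, (M.induce K).simple i ^ 2 = 1 := fun i => by
    have := (M.induce K).toCoxeterSystem.simple_mul_simple_self i
    rw [sq]; simpa using this
  have hf : M.IsLiftable f := by
    intro i j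
    by_cases hi : i ∈ K <;> by_cases hj : j ∈ K
    · simpa [f, hi, hj, induce_apply] using
        (M.induce K).toCoxeterSystem.simple_mul_simple_pow ⟨i, hi⟩ ⟨j, hj⟩
    · simp [f, hi, hj, hK i hi j hj, hsq]
    · simp [f, hi, hj, M.symmetric i j, hK j hj i hi, hsq]
    · simp [f, hi, hj]
  let F : M.Group →* (M.induce K).Group := M.toCoxeterSystem.lift ⟨f, hf⟩
  have hF : F.comp (M.induceHom K) = MonoidHom.id _ := by
    apply (M.induce K).toCoxeterSystem.ext_simple
    intro i
    simp only [MonoidHom.comp_apply, toCoxeterSystem_simple, induceHom_simple]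
    have : F (M.simple i) = f i := M.toCoxeterSystem.lift_apply_simple hf i
    simp [this, f]
  exact Finite.of_surjective F fun x => ⟨M.induceHom K x, DFunLike.congr_fun hF x⟩

theorem commute_induceHom {K : Set B} (hK : ∀ i ∈ K, ∀ j ∉ K, M i j = 2)
    (x : (M.induce K).Group) (y : (M.induce Kᶜ).Group) :
    Commute (M.induceHom K x) (M.induceHom Kᶜ y) := by
  induction x using (M.induce K).toCoxeterSystem.simple_induction with
  | one => simp
  | mul x x' hx hx' => rw [map_mul]; exact hx.mul_left hx'
  | simple i =>
    induction y using (M.induce Kᶜ).toCoxeterSystem.simple_induction with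
    | one => simp
    | mul y y' hy hy' => rw [map_mul]; exact hy.mul_right hy'
    | simple j =>
      simp only [toCoxeterSystem_simple, induceHom_simple]
      have h := M.toCoxeterSystem.simple_mul_simple_pow i j
      rw [hK i i.2 j j.2, sq] at h
      have h2 := M.toCoxeterSystem.inv_simple i
      have h3 := M.toCoxeterSystem.inv_simple j
      simp only [toCoxeterSystem_simple] at h h2 h3
      have := eq_inv_of_mul_eq_one_left h
      rwa [mul_inv_rev, h2, h3] at this

theorem stronglyReal_of_induce {K : Set B} (hK : ∀ i ∈ K, ∀ j ∉ K, M i j = 2)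
    (h1 : StronglyReal (M.induce K).Group) (h2 : StronglyReal (M.induce Kᶜ).Group) :
    StronglyReal M.Group := by
  refine (h1.prod h2).of_surjective
    ((M.induceHom K).noncommCoprod (M.induceHom Kᶜ) (M.commute_induceHom hK)) ?_
  rw [← MonoidHom.range_eq_top, eq_top_iff, ← M.toCoxeterSystem.subgroup_closure_range_simple,
    Subgroup.closure_le]
  rintro _ ⟨i, rfl⟩
  by_cases hi : i ∈ K
  · exact ⟨((M.induce K).simple ⟨i, hi⟩, 1), by simp [induceHom_simple]⟩
  · exact ⟨(1, (M.induce Kᶜ).simple ⟨i, hi⟩), by simp [induceHom_simple]⟩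

/-- No proper nonempty set of vertices commutes with its complement. -/
def Irred : Prop := ∀ K : Set B, K.Nonempty → Kᶜ.Nonempty → ∃ i ∈ K, ∃ j ∉ K, M i j ≠ 2

theorem stronglyReal_of_irred {B : Type u} (M : CoxeterMatrix B)
    (H : ∀ (B : Type u) [Nonempty B] (M : CoxeterMatrix B) [Finite M.Group],
      M.Irred → StronglyReal M.Group) [Finite M.Group] : StronglyReal M.Group := by
  induction hn : Nat.card B using Nat.strong_induction_on generalizing B with
  | _ n ih =>
  rcases isEmpty_or_nonempty B with hB | hB
  · have : Subsingleton M.Group := by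
      rw [← Subgroup.subsingleton_iff, ← subsingleton_iff_bot_eq_top,
        ← M.toCoxeterSystem.subgroup_closure_range_simple, Set.range_eq_empty,
        Subgroup.closure_empty]
    exact StronglyReal.of_subsingleton
  by_cases hM : M.Irred
  · exact H B M hM
  unfold Irred at hM
  push Not at hM
  obtain ⟨K, hK1, hK2, hK⟩ := hM
  have hK' : ∀ i ∈ Kᶜ, ∀ j ∉ Kᶜ, M i j = 2 := fun i hi j hj => by
    rw [M.symmetric]; exact hK j (by simpa using hj) i hi
  have := M.finite_induce_group hK
  have := M.finite_induce_group hK'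
  have hfin : Finite B := M.toCoxeterSystem.finite_index
  refine M.stronglyReal_of_induce hK (ih _ ?_ (M.induce K) rfl) (ih _ ?_ (M.induce Kᶜ) rfl)
  · rw [← hn, Nat.card_coe_set_eq, ← Set.ncard_univ]
    exact Set.ncard_lt_ncard (Set.ssubset_univ_iff.2 (Set.nonempty_compl.1 hK2)) (Set.toFinite _)
  · rw [← hn, Nat.card_coe_set_eq, ← Set.ncard_univ]
    refine Set.ncard_lt_ncard (Set.ssubset_univ_iff.2 fun h => ?_) (Set.toFinite _)
    exact hK1.ne_empty (Set.compl_univ_iff.1 h)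

theorem stronglyReal_of_reindex {B' : Type*} (e : B ≃ B')
    (h : StronglyReal (M.reindex e).Group) : StronglyReal M.Group :=
  h.of_surjective (M.reindexGroupEquiv e).toMonoidHom (M.reindexGroupEquiv e).surjective

end CoxeterMatrix

theorem exists_add_excess {G : Type*} [Group G] (hG : StronglyReal G) {ℓ : G → ℕ}
    (hℓ : ∀ a b, ℓ (a * b) ≤ ℓ a + ℓ b) (w : G) :
    ∃ σ τ : G, σ * σ = 1 ∧ τ * τ = 1 ∧ w = σ * τ ∧ ℓ σ + ℓ τ = ℓ w + excess ℓ w := by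
  obtain ⟨σ, τ, h1, h2, h3⟩ := hG.exists_eq_mul w
  refine Nat.sInf_mem (s := {d : ℕ | ∃ σ τ : G, σ * σ = 1 ∧ τ * τ = 1 ∧ w = σ * τ ∧
    ℓ σ + ℓ τ = ℓ w + d}) ⟨ℓ σ + ℓ τ - ℓ w, σ, τ, h1, h2, h3, ?_⟩
  have := hℓ σ τ
  rw [← h3] at this
  omega

theorem length_add_excess_le {G : Type*} [Group G] {ℓ : G → ℕ}
    (hℓ : ∀ a b, ℓ (a * b) ≤ ℓ a + ℓ b) {σ τ : G} (h1 : σ * σ = 1) (h2 : τ * τ = 1) :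
    ℓ (σ * τ) + excess ℓ (σ * τ) ≤ ℓ σ + ℓ τ := by
  have h := hℓ σ τ
  have : excess ℓ (σ * τ) ≤ ℓ σ + ℓ τ - ℓ (σ * τ) :=
    Nat.sInf_le ⟨σ, τ, h1, h2, rfl, by omega⟩
  omega

theorem excess_prod {G₁ G₂ : Type*} [Group G₁] [Group G₂]
    (h₁ : StronglyReal G₁) (h₂ : StronglyReal G₂) {ℓ₁ : G₁ → ℕ} {ℓ₂ : G₂ → ℕ}
    (hℓ₁ : ∀ a b, ℓ₁ (a * b) ≤ ℓ₁ a + ℓ₁ b) (hℓ₂ : ∀ a b, ℓ₂ (a * b) ≤ ℓ₂ a + ℓ₂ b)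
    (w : G₁ × G₂) :
    excess (fun p : G₁ × G₂ => ℓ₁ p.1 + ℓ₂ p.2) w = excess ℓ₁ w.1 + excess ℓ₂ w.2 := by
  have hℓ : ∀ a b : G₁ × G₂, ℓ₁ (a * b).1 + ℓ₂ (a * b).2 ≤
      ℓ₁ a.1 + ℓ₂ a.2 + (ℓ₁ b.1 + ℓ₂ b.2) := fun a b => by
    have := hℓ₁ a.1 b.1
    have := hℓ₂ a.2 b.2
    simp only [Prod.fst_mul, Prod.snd_mul]
    omega
  apply le_antisymm
  · obtain ⟨σ, τ, h1, h2, h3, h4⟩ := exists_add_excess h₁ hℓ₁ w.1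
    obtain ⟨σ', τ', h1', h2', h3', h4'⟩ := exists_add_excess h₂ hℓ₂ w.2
    have := length_add_excess_le (ℓ := fun p : G₁ × G₂ => ℓ₁ p.1 + ℓ₂ p.2) hℓ
      (σ := (σ, σ')) (τ := (τ, τ')) (by simp [h1, h1']) (by simp [h2, h2'])
    have hw : ((σ, σ') * (τ, τ') : G₁ × G₂) = w := by simp [← h3, ← h3']
    rw [hw] at this
    simp only at this
    omega
  · obtain ⟨σ, τ, h1, h2, h3, h4⟩ :=
      exists_add_excess (ℓ := fun p : G₁ × G₂ => ℓ₁ p.1 + ℓ₂ p.2) (h₁.prod h₂) hℓ w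
    rw [Prod.ext_iff] at h1 h2
    have a1 := length_add_excess_le hℓ₁ h1.1 h2.1
    have a2 := length_add_excess_le hℓ₂ h1.2 h2.2
    subst h3
    simp only [Prod.fst_mul, Prod.snd_mul] at *
    omega

namespace CoxeterMatrix

open Real

variable {B : Type*} {M : CoxeterMatrix B}

theorem le_neg_gram {i j : B} {n : ℕ} (hn : 1 ≤ n) (h : M i j = 0 ∨ n ≤ M i j) :
    2 * cos (π / n) ≤ -M.gram i j := by
  have h0 : -M.gram i j = 2 * cos (π / M i j) := by rw [gram]; ring
  rw [h0]
  have hn' : (1 : ℝ) ≤ n := by exact_mod_cast hn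
  rcases h with h | h
  · simp [h, cos_le_one]
  · have h' : (n : ℝ) ≤ M i j := by exact_mod_cast h
    have h1 : π / M i j ≤ π / n := div_le_div_of_nonneg_left pi_pos.le (by linarith) h'
    have h2 : π / n ≤ π := div_le_self pi_pos.le hn'
    have h3 : 0 ≤ π / M i j := by positivity
    linarith [cos_le_cos_of_nonneg_of_le_pi h3 h2 h1]

theorem one_le_neg_gram {i j : B} (hij : i ≠ j) (h : M i j ≠ 2) : 1 ≤ -M.gram i j := by
  have h1 := M.off_diagonal i j hij
  have := le_neg_gram (M := M) (i := i) (j := j) (n := 3) (by norm_num) (by omega)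
  have h2 : cos (π / (3 : ℕ)) = 1 / 2 := by exact_mod_cast cos_pi_div_three
  linarith

theorem sqrt_two_le_neg_gram {i j : B} (hij : i ≠ j) (h : M i j ≠ 2) (h3 : M i j ≠ 3) :
    √2 ≤ -M.gram i j := by
  have h1 := M.off_diagonal i j hij
  have := le_neg_gram (M := M) (i := i) (j := j) (n := 4) (by norm_num) (by omega)
  have h2 : cos (π / (4 : ℕ)) = √2 / 2 := by exact_mod_cast cos_pi_div_four
  linarith

theorem goldenRatio_le_neg_gram {i j : B} (hij : i ≠ j) (h : M i j ≠ 2) (h3 : M i j ≠ 3)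
    (h4 : M i j ≠ 4) : goldenRatio ≤ -M.gram i j := by
  have h1 := M.off_diagonal i j hij
  have := le_neg_gram (M := M) (i := i) (j := j) (n := 5) (by norm_num) (by omega)
  have h2 : cos (π / (5 : ℕ)) = (1 + √5) / 4 := by exact_mod_cast cos_pi_div_five
  rw [goldenRatio]
  linarith

theorem sqrt_three_le_neg_gram {i j : B} (hij : i ≠ j) (h : M i j ≠ 2) (h3 : M i j ≠ 3)
    (h4 : M i j ≠ 4) (h5 : M i j ≠ 5) : √3 ≤ -M.gram i j := by
  have h1 := M.off_diagonal i j hij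
  have := le_neg_gram (M := M) (i := i) (j := j) (n := 6) (by norm_num) (by omega)
  have h2 : cos (π / (6 : ℕ)) = √3 / 2 := by exact_mod_cast cos_pi_div_six
  linarith

/-- `v 0, …, v k` is a path in the Coxeter graph. -/
structure IsPath (M : CoxeterMatrix B) (v : ℕ → B) (k : ℕ) : Prop where
  inj : ∀ i ≤ k, ∀ j ≤ k, v i = v j → i = j
  adj : ∀ i < k, M (v i) (v (i + 1)) ≠ 2

theorem IsPath.one_le {v : ℕ → B} {k i j : ℕ} (h : M.IsPath v k) (hi : i ≤ k) (hj : j ≤ k)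
    (hij : i + 1 = j ∨ j + 1 = i) : 1 ≤ -M.gram (v i) (v j) := by
  rcases hij with rfl | rfl
  · exact one_le_neg_gram (fun e => by have := h.inj _ hi _ hj e; omega) (h.adj i (by omega))
  · rw [M.gram_comm]
    exact one_le_neg_gram (fun e => by have := h.inj _ hj _ hi e; omega) (h.adj j (by omega))

theorem IsPath.reverse {v : ℕ → B} {k : ℕ} (h : M.IsPath v k) :
    M.IsPath (fun i => v (k - i)) k where
  inj i hi j hj e := by have := h.inj _ (by omega) _ (by omega) e; omega
  adj i hi := by
    have := h.adj (k - (i + 1)) (by omega)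
    rw [M.symmetric, show k - i = k - (i + 1) + 1 by omega]
    exact this

theorem IsPath.shift {v : ℕ → B} {k : ℕ} (h : M.IsPath v k) (i : ℕ) {l : ℕ} (hl : i + l ≤ k) :
    M.IsPath (fun t => v (i + t)) l where
  inj a ha b hb e := by have := h.inj _ (by omega) _ (by omega) e; omega
  adj a ha := h.adj (i + a) (by omega)

theorem IsPath.cons {v : ℕ → B} {k : ℕ} (h : M.IsPath v k) {u : B} (hu : ∀ i ≤ k, v i ≠ u)
    (hadj : M u (v 0) ≠ 2) : M.IsPath (fun t => Nat.casesOn t u v) (k + 1) where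
  inj a ha b hb e := by
    rcases a with _ | a <;> rcases b with _ | b
    · rfl
    · exact absurd e.symm (hu b (by omega))
    · exact absurd e (hu a (by omega))
    · rw [h.inj a (by omega) b (by omega) e]
  adj a ha := by
    rcases a with _ | a
    · exact hadj
    · exact h.adj a (by omega)

/-- A path of maximal length. -/
structure IsMaxPath (M : CoxeterMatrix B) (v : ℕ → B) (k : ℕ) : Prop extends M.IsPath v k where
  max : ∀ v' k', M.IsPath v' k' → k' ≤ k

theorem IsMaxPath.reverse {v : ℕ → B} {k : ℕ} (h : M.IsMaxPath v k) :
    M.IsMaxPath (fun i => v (k - i)) k where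
  toIsPath := h.toIsPath.reverse
  max := h.max

theorem exists_isMaxPath [Finite B] [Nonempty B] (M : CoxeterMatrix B) :
    ∃ v k, M.IsMaxPath v k := by
  classical
  have := Fintype.ofFinite B
  have hb : ∀ k, (∃ v, M.IsPath v k) → k ≤ Fintype.card B := by
    rintro k ⟨v, h⟩
    have := Fintype.card_le_of_injective (fun i : Fin (k + 1) => v i)
      fun i j e => Fin.ext (h.inj _ (by omega) _ (by omega) e)
    simp at this
    omega
  have h0 : ∃ v, M.IsPath v 0 := ⟨fun _ => Classical.arbitrary B, by
    constructor
    · intro i hi j hj _; omega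
    · intro i hi; omega⟩
  obtain ⟨v, hv⟩ := Nat.findGreatest_spec (P := fun k => ∃ v, M.IsPath v k) (Nat.zero_le _) h0
  exact ⟨v, _, hv, fun v' k' h' => Nat.le_findGreatest (hb k' ⟨v', h'⟩) ⟨v', h'⟩⟩

theorem isPath_const (M : CoxeterMatrix B) (u : B) : M.IsPath (fun _ => u) 0 :=
  ⟨fun i hi j hj _ => by omega, fun i hi => by omega⟩

theorem IsMaxPath.interior {v : ℕ → B} {k : ℕ} (h : M.IsMaxPath v k) {u : B} (hu : ∀ i ≤ k, v i ≠ u) {i : ℕ}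
    (hi : i ≤ k) (ha : M (v i) u ≠ 2) : 0 < i ∧ i < k := by
  constructor
  · rcases Nat.eq_zero_or_pos i with rfl | h0
    · have := h.max _ _ (h.toIsPath.cons hu (by rwa [M.symmetric]))
      omega
    · exact h0
  · rcases hi.eq_or_lt with rfl | h0
    · have := h.max _ _ (h.toIsPath.reverse.cons (fun j _ => hu _ (by omega))
        (by simpa [M.symmetric u] using ha))
      omega
    · exact h0

section Finite

variable [Finite M.Group]

theorem IsPath.not_cycle {v : ℕ → B} {k : ℕ} (h : M.IsPath v k) (hk : 2 ≤ k)
    (hc : M (v 0) (v k) ≠ 2) : False := by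
  have h0k : v 0 ≠ v k := fun e => by have := h.inj _ (by omega) _ le_rfl e; omega
  have hc' := one_le_neg_gram h0k hc
  refine M.toCoxeterSystem.not_subharmonic_enum (m := k + 1) (by omega) (f := v)
    (fun a ha b hb e => h.inj a (Nat.lt_succ_iff.1 ha) b (Nat.lt_succ_iff.1 hb) e) (x := fun _ => 1)
    (by simp) (fun i => {if i = 0 then k else i - 1, if i = k then 0 else i + 1}) ?_ ?_
  · intro i hi j hj
    simp only [Finset.mem_insert, Finset.mem_singleton] at hj
    split_ifs at hj <;> omega
  · intro i hi
    rw [Finset.sum_pair (by split_ifs <;> omega)]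
    have h1 : 1 ≤ -M.gram (v i) (v (if i = 0 then k else i - 1)) := by
      split_ifs with h0
      · rw [h0]; exact hc'
      · exact h.one_le (by omega) (by omega) (by omega)
    have h2 : 1 ≤ -M.gram (v i) (v (if i = k then 0 else i + 1)) := by
      split_ifs with h0
      · rw [h0, M.gram_comm]; exact hc'
      · exact h.one_le (by omega) (by omega) (by omega)
    linarith

theorem IsPath.not_chord {v : ℕ → B} {k i j : ℕ} (h : M.IsPath v k) (hij : i + 2 ≤ j)
    (hj : j ≤ k) : M (v i) (v j) = 2 := by
  by_contra hc
  exact (h.shift i (l := j - i) (by omega)).not_cycle (by omega)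
    (by simpa [show i + (j - i) = j by omega] using hc)

theorem IsPath.attach_unique {v : ℕ → B} {k i j : ℕ} (h : M.IsPath v k) {u : B}
    (hu : ∀ i ≤ k, v i ≠ u) (hij : i < j) (hj : j ≤ k) (hi : M (v i) u ≠ 2) : M (v j) u = 2 := by
  by_contra hc
  refine ((h.shift i (l := j - i) (by omega)).cons (u := u) (fun t ht => hu _ (by omega))
    (by simpa [M.symmetric u] using hi)).not_cycle (by omega) ?_
  simpa [show i + (j - i) = j by omega, M.symmetric u] using hc

/-- A path carrying a collection of leaves of total weight at least two at each end cannot occur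
in a finite Coxeter group. -/
theorem IsPath.not_leaves {p : ℕ → B} {l : ℕ} (h : M.IsPath p l) (S T : Finset B) {s t : ℝ}
    (hs : 1 ≤ s) (ht : 1 ≤ t) (hST : Disjoint S T) (hS : ∀ i ≤ l, p i ∉ S) (hT : ∀ i ≤ l, p i ∉ T)
    (hs2 : 2 ≤ S.card * (s * s)) (ht2 : 2 ≤ T.card * (t * t))
    (hSs : ∀ b ∈ S, s ≤ -M.gram (p 0) b) (hTt : ∀ b ∈ T, t ≤ -M.gram (p l) b) : False := by
  classical
  set P := (Finset.range (l + 1)).image p with hP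
  have hpP : ∀ i ≤ l, p i ∈ P := fun i hi => Finset.mem_image_of_mem _ (by simp; omega)
  set x : B → ℝ := fun b => if b ∈ S then s else if b ∈ T then t else 2 with hx
  have hxS : ∀ b ∈ S, x b = s := fun b hb => by simp [hx, hb]
  have hxT : ∀ b ∈ T, x b = t := fun b hb => by
    have : b ∉ S := Finset.disjoint_right.1 hST hb
    simp [hx, hb, this]
  have hxp : ∀ i ≤ l, x (p i) = 2 := fun i hi => by simp [hx, hS i hi, hT i hi]
  refine M.toCoxeterSystem.not_subharmonic (P ∪ (S ∪ T)) ⟨p 0, by simp [hpP 0]⟩ (x := x) ?_ ?_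
  · intro b _
    simp only [hx]
    split_ifs <;> linarith
  · intro b hb
    simp only [Finset.mem_union] at hb
    rcases hb with hb | hb | hb
    · obtain ⟨i, hi, rfl⟩ := Finset.mem_image.1 hb
      have hi : i ≤ l := by simpa [Nat.lt_succ_iff] using hi
      set N₁ := if i = 0 then S else {p (i - 1)} with hN₁
      set N₂ := if i = l then T else {p (i + 1)} with hN₂
      have hN₁' : N₁ ⊆ P ∪ (S ∪ T) ∧ p i ∉ N₁ ∧ 2 ≤ ∑ c ∈ N₁, -M.gram (p i) c * x c := by
        rcases Nat.eq_zero_or_pos i with rfl | h0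
        · rw [hN₁, if_pos rfl]
          refine ⟨fun b hb => by simp [hb], hS 0 hi, hs2.trans ?_⟩
          rw [← nsmul_eq_mul, ← Finset.sum_const]
          refine Finset.sum_le_sum fun c hc => ?_
          rw [hxS c hc]
          exact mul_le_mul_of_nonneg_right (hSs c hc) (by linarith)
        · rw [hN₁, if_neg h0.ne']
          refine ⟨by simp [hpP (i - 1) (by omega)], ?_, ?_⟩
          · simpa using fun e => by have := h.inj _ hi _ (by omega) e; omega
          · rw [Finset.sum_singleton, hxp _ (by omega)]
            linarith [h.one_le hi (j := i - 1) (by omega) (by omega)]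
      have hN₂' : N₂ ⊆ P ∪ (S ∪ T) ∧ p i ∉ N₂ ∧ 2 ≤ ∑ c ∈ N₂, -M.gram (p i) c * x c := by
        rcases eq_or_ne i l with rfl | h0
        · rw [hN₂, if_pos rfl]
          refine ⟨fun b hb => by simp [hb], hT i hi, ht2.trans ?_⟩
          rw [← nsmul_eq_mul, ← Finset.sum_const]
          refine Finset.sum_le_sum fun c hc => ?_
          rw [hxT c hc]
          exact mul_le_mul_of_nonneg_right (hTt c hc) (by linarith)
        · rw [hN₂, if_neg h0]
          refine ⟨by simp [hpP (i + 1) (by omega)], ?_, ?_⟩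
          · simpa using fun e => by have := h.inj _ hi _ (by omega) e; omega
          · rw [Finset.sum_singleton, hxp _ (by omega)]
            linarith [h.one_le hi (j := i + 1) (by omega) (by omega)]
      have hdisj : Disjoint N₁ N₂ := by
        rw [hN₁, hN₂]
        split_ifs
        · exact hST
        · simpa using hS _ (by omega)
        · simpa using hT _ (by omega)
        · simpa using fun e => by have := h.inj _ (by omega) _ (by omega) e; omega
      refine ⟨N₁ ∪ N₂, Finset.union_subset hN₁'.1 hN₂'.1, by simp [hN₁'.2.1, hN₂'.2.1], ?_⟩
      rw [Finset.sum_union hdisj, hxp i hi]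
      linarith [hN₁'.2.2, hN₂'.2.2]
    · refine ⟨{p 0}, by simp [hpP 0], ?_, ?_⟩
      · exact fun e => hS 0 (by omega) (Finset.mem_singleton.1 e ▸ hb)
      · rw [Finset.sum_singleton, hxS b hb, hxp 0 (by omega), M.gram_comm]
        linarith [hSs b hb]
    · refine ⟨{p l}, by simp [hpP l], ?_, ?_⟩
      · exact fun e => hT l le_rfl (Finset.mem_singleton.1 e ▸ hb)
      · rw [Finset.sum_singleton, hxT b hb, hxp l le_rfl, M.gram_comm]
        linarith [hTt b hb]

end Finite

end CoxeterMatrix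

namespace CoxeterMatrix

open Real

variable {B : Type*} {M : CoxeterMatrix B} [Finite M.Group]

theorem IsPath.not_weighted {p : ℕ → B} {l : ℕ} (h : M.IsPath p l) (c X : ℕ → ℝ)
    (hc : ∀ t < l, c t ≤ -M.gram (p t) (p (t + 1))) (hX : ∀ t ≤ l, 0 < X t)
    (hcX : ∀ t ≤ l, 2 * X t ≤ (if t = 0 then 0 else c (t - 1) * X (t - 1)) +
      if t = l then 0 else c t * X (t + 1)) : False := by
  refine M.toCoxeterSystem.not_subharmonic_enum (m := l + 1) (by omega) (f := p)
    (fun a ha b hb e => h.inj a (Nat.lt_succ_iff.1 ha) b (Nat.lt_succ_iff.1 hb) e) (x := X)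
    (fun t ht => hX t (by omega))
    (fun t => (if t = 0 then ∅ else {t - 1}) ∪ if t = l then ∅ else {t + 1}) ?_ ?_
  · intro i hi j hj
    simp only [Finset.mem_union] at hj
    split_ifs at hj <;> simp at hj <;> omega
  · intro t ht
    rw [Finset.sum_union (by split_ifs <;> simp)]
    refine (hcX t (by omega)).trans (add_le_add ?_ ?_)
    · split_ifs with h0
      · simp
      · rw [Finset.sum_singleton, M.gram_comm]
        refine mul_le_mul_of_nonneg_right ?_ (hX _ (by omega)).le
        simpa [show t - 1 + 1 = t by omega] using hc (t - 1) (by omega)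
    · split_ifs with h0
      · simp
      · rw [Finset.sum_singleton]
        exact mul_le_mul_of_nonneg_right (hc t (by omega)) (hX _ (by omega)).le

theorem IsPath.not_fork {p w : ℕ → B} {l m q : ℕ} (h : M.IsPath p l) (hw : M.IsPath w m)
    (hpw : ∀ i ≤ l, ∀ j ≤ m, p i ≠ w j) (hq : q ≤ l) (ha : M (p q) (w 0) ≠ 2) (X Y : ℕ → ℕ)
    (hX : ∀ t ≤ l, 0 < X t) (hY : ∀ t ≤ m, 0 < Y t)
    (hXY : ∀ t ≤ l, 2 * X t ≤ (if t = 0 then 0 else X (t - 1)) + (if t = l then 0 else X (t + 1)) +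
      if t = q then Y 0 else 0)
    (hYX : ∀ t ≤ m, 2 * Y t ≤ (if t = 0 then X q else Y (t - 1)) + if t = m then 0 else Y (t + 1)) :
    False := by
  have hk : ∀ {b c : B} {n : ℕ}, 1 ≤ -M.gram b c → (n : ℝ) ≤ -M.gram b c * n := fun h1 =>
    le_mul_of_one_le_left (Nat.cast_nonneg _) h1
  have hq0 := one_le_neg_gram (hpw q hq 0 (by omega)) ha
  refine M.toCoxeterSystem.not_subharmonic_enum (m := l + 1 + (m + 1)) (by omega)
    (f := fun t => if t ≤ l then p t else w (t - (l + 1))) ?_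
    (x := fun t => ((if t ≤ l then X t else Y (t - (l + 1)) : ℕ) : ℝ)) ?_
    (fun t => if t ≤ l then ((if t = 0 then ∅ else {t - 1}) ∪ if t = l then ∅ else {t + 1}) ∪
        (if t = q then {l + 1} else ∅)
      else {if t = l + 1 then q else t - 1} ∪ if t = l + 1 + m then ∅ else {t + 1}) ?_ ?_
  · intro a hal b hbl e
    simp only [Set.mem_Iio] at hal hbl
    dsimp only at e
    split_ifs at e with h1 h2 h2
    · exact h.inj a h1 b h2 e
    · exact absurd e (hpw _ h1 _ (by omega))
    · exact absurd e.symm (hpw _ h2 _ (by omega))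
    · have := hw.inj _ (by omega) _ (by omega) e
      omega
  · intro t ht
    norm_cast
    split_ifs with h1
    · exact hX t h1
    · exact hY _ (by omega)
  · intro i hi j hj
    split_ifs at hj <;> simp at hj <;> omega
  · intro t ht
    by_cases htl : t ≤ l
    · simp only [htl, if_true]
      rw [Finset.sum_union (by split_ifs <;> simp <;> omega),
        Finset.sum_union (by split_ifs <;> simp)]
      have h1 : ((2 * X t : ℕ) : ℝ) ≤ _ := Nat.cast_le.2 (hXY t htl)
      push_cast at h1 ⊢
      refine h1.trans (add_le_add (add_le_add ?_ ?_) ?_)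
      · split_ifs with h0
        · simp
        · simp only [Finset.sum_singleton, show t - 1 ≤ l by omega, if_true]
          exact hk (h.one_le htl (by omega) (by omega))
      · split_ifs with h0
        · simp
        · simp only [Finset.sum_singleton, show t + 1 ≤ l by omega, if_true]
          exact hk (h.one_le htl (by omega) (by omega))
      · split_ifs with h0
        · simp only [Finset.sum_singleton, show ¬ l + 1 ≤ l by omega, if_false, Nat.sub_self]
          rw [h0]
          exact hk hq0
        · simp
    · simp only [htl, if_false]
      rw [Finset.sum_union (by split_ifs <;> simp <;> omega)]
      have h1 : ((2 * Y (t - (l + 1)) : ℕ) : ℝ) ≤ _ := Nat.cast_le.2 (hYX (t - (l + 1)) (by omega))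
      push_cast at h1 ⊢
      refine h1.trans (add_le_add ?_ ?_)
      · rw [Finset.sum_singleton]
        by_cases h0 : t = l + 1
        · simp only [h0, Nat.sub_self, if_true, hq]
          rw [M.gram_comm]
          exact hk hq0
        · simp only [h0, show ¬ t - 1 ≤ l by omega, show t - (l + 1) ≠ 0 by omega, if_false,
            show t - 1 - (l + 1) = t - (l + 1) - 1 by omega]
          exact hk (hw.one_le (by omega) (by omega) (by omega))
      · by_cases h0 : t = l + 1 + m
        · simp [h0, show l + 1 + m - (l + 1) = m by omega]
        · simp only [h0, show t - (l + 1) ≠ m by omega, if_false, Finset.sum_singleton,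
            show ¬ t + 1 ≤ l by omega, show t + 1 - (l + 1) = t - (l + 1) + 1 by omega]
          exact hk (hw.one_le (by omega) (by omega) (by omega))

variable {v : ℕ → B} {k : ℕ}

theorem IsMaxPath.attached_unique (h : M.IsMaxPath v k) {u u' : B} (hu : ∀ i ≤ k, v i ≠ u)
    (hu' : ∀ i ≤ k, v i ≠ u') {i j : ℕ} (hij : i ≤ j) (hj : j ≤ k) (ha : M (v i) u ≠ 2)
    (ha' : M (v j) u' ≠ 2) : u = u' := by
  classical
  by_contra hne
  obtain ⟨hi0, -⟩ := h.interior hu (by omega) ha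
  obtain ⟨-, hjk⟩ := h.interior hu' hj ha'
  have hv : ∀ {a b : ℕ}, a ≤ k → b ≤ k → a ≠ b → v a ≠ v b := fun ha hb hab e =>
    hab (h.inj _ ha _ hb e)
  refine (h.toIsPath.shift i (l := j - i) (by omega)).not_leaves {v (i - 1), u} {v (j + 1), u'}
    le_rfl le_rfl ?_ ?_ ?_ ?_ ?_ ?_ ?_
  · simp [hv (a := j + 1) (b := i - 1) (by omega) (by omega) (by omega), Ne.symm hne,
      (hu' (i - 1) (by omega)).symm, hu (j + 1) (by omega)]
  · intro t ht
    simp [hv (a := i + t) (b := i - 1) (by omega) (by omega) (by omega), hu (i + t) (by omega)]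
  · intro t ht
    simp [hv (a := i + t) (b := j + 1) (by omega) (by omega) (by omega), hu' (i + t) (by omega)]
  · rw [Finset.card_pair (hu _ (by omega))]; norm_num
  · rw [Finset.card_pair (hu' _ (by omega))]; norm_num
  · simp only [Finset.mem_insert, Finset.mem_singleton]
    rintro b (rfl | rfl)
    · exact h.one_le (by omega) (by omega) (by omega)
    · exact one_le_neg_gram (hu _ (by omega)) ha
  · simp only [Finset.mem_insert, Finset.mem_singleton, show i + (j - i) = j by omega]
    rintro b (rfl | rfl)
    · exact h.one_le (by omega) (by omega) (by omega)
    · exact one_le_neg_gram (hu' _ (by omega)) ha'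

theorem IsMaxPath.fork_edge (h : M.IsMaxPath v k) {u : B} (hu : ∀ i ≤ k, v i ≠ u) {i : ℕ}
    (hi : i ≤ k) (ha : M (v i) u ≠ 2) : M (v i) u = 3 := by
  classical
  by_contra h3
  obtain ⟨hi0, hik⟩ := h.interior hu hi ha
  have hv : ∀ {a b : ℕ}, a ≤ k → b ≤ k → a ≠ b → v a ≠ v b := fun ha hb hab e =>
    hab (h.inj _ ha _ hb e)
  refine (h.toIsPath.shift i (l := 0) (by omega)).not_leaves {v (i - 1), v (i + 1)} {u}
    le_rfl (t := √2) (one_le_sqrt.2 one_le_two) ?_ ?_ ?_ ?_ ?_ ?_ ?_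
  · simp [(hu (i - 1) (by omega)).symm, (hu (i + 1) (by omega)).symm]
  · intro t ht
    simp [hv (a := i + t) (b := i - 1) (by omega) (by omega) (by omega),
      hv (a := i + t) (b := i + 1) (by omega) (by omega) (by omega)]
  · intro t ht
    simp [hu (i + t) (by omega)]
  · rw [Finset.card_pair (hv (by omega) (by omega) (by omega))]; norm_num
  · norm_num
  · simp only [Finset.mem_insert, Finset.mem_singleton]
    rintro b (rfl | rfl)
    · exact h.one_le (by omega) (by omega) (by omega)
    · exact h.one_le (by omega) (by omega) (by omega)
  · simp only [Finset.mem_singleton]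
    rintro b rfl
    exact sqrt_two_le_neg_gram (hu _ hi) ha h3

theorem IsMaxPath.fork_path (h : M.IsMaxPath v k) {u : B} (hu : ∀ i ≤ k, v i ≠ u) {i j : ℕ}
    (hij : i ≤ j) (hj : j < k) (ha : M (v i) u ≠ 2) : M (v j) (v (j + 1)) = 3 := by
  classical
  by_contra h3
  obtain ⟨hi0, hik⟩ := h.interior hu (by omega) ha
  have hv : ∀ {a b : ℕ}, a ≤ k → b ≤ k → a ≠ b → v a ≠ v b := fun ha hb hab e =>
    hab (h.inj _ ha _ hb e)
  refine (h.toIsPath.shift i (l := j - i) (by omega)).not_leaves {v (i - 1), u} {v (j + 1)}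
    le_rfl (t := √2) (one_le_sqrt.2 one_le_two) ?_ ?_ ?_ ?_ ?_ ?_ ?_
  · simp [hv (a := j + 1) (b := i - 1) (by omega) (by omega) (by omega), hu (j + 1) (by omega)]
  · intro t ht
    simp [hv (a := i + t) (b := i - 1) (by omega) (by omega) (by omega), hu (i + t) (by omega)]
  · intro t ht
    simp [hv (a := i + t) (b := j + 1) (by omega) (by omega) (by omega)]
  · rw [Finset.card_pair (hu _ (by omega))]; norm_num
  · norm_num
  · simp only [Finset.mem_insert, Finset.mem_singleton]
    rintro b (rfl | rfl)
    · exact h.one_le (by omega) (by omega) (by omega)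
    · exact one_le_neg_gram (hu _ (by omega)) ha
  · simp only [Finset.mem_singleton, show i + (j - i) = j by omega]
    rintro b rfl
    exact sqrt_two_le_neg_gram (hv (by omega) (by omega) (by omega)) (h.adj j hj) h3

theorem IsPath.label_unique (h : M.IsPath v k) {i j : ℕ} (hij : i < j) (hj : j < k)
    (h3 : M (v i) (v (i + 1)) ≠ 3) : M (v j) (v (j + 1)) = 3 := by
  classical
  by_contra h3'
  have hv : ∀ {a b : ℕ}, a ≤ k → b ≤ k → a ≠ b → v a ≠ v b := fun ha hb hab e =>
    hab (h.inj _ ha _ hb e)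
  refine (h.shift (i + 1) (l := j - (i + 1)) (by omega)).not_leaves {v i} {v (j + 1)}
    (s := √2) (t := √2) (one_le_sqrt.2 one_le_two) (one_le_sqrt.2 one_le_two) ?_ ?_ ?_ ?_ ?_ ?_ ?_
  · simp [hv (a := i) (b := j + 1) (by omega) (by omega) (by omega)]
  · intro t ht
    simp [hv (a := i + 1 + t) (b := i) (by omega) (by omega) (by omega)]
  · intro t ht
    simp [hv (a := i + 1 + t) (b := j + 1) (by omega) (by omega) (by omega)]
  · norm_num
  · norm_num
  · simp only [Finset.mem_singleton]
    rintro b rfl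
    rw [M.gram_comm]
    exact sqrt_two_le_neg_gram (hv (by omega) (by omega) (by omega)) (h.adj i (by omega)) h3
  · simp only [Finset.mem_singleton, show i + 1 + (j - (i + 1)) = j by omega]
    rintro b rfl
    exact sqrt_two_le_neg_gram (hv (by omega) (by omega) (by omega)) (h.adj j hj) h3'

end CoxeterMatrix

/-- The labels of a Coxeter graph which is a path, with label `m` on the edge `p`. -/
def pathLabel (p m i j : ℕ) : ℕ := if j = i + 1 then if i = p then m else 3 else 2

/-- The labels of a simply laced Coxeter graph consisting of a path `0, …, n - 2` with a further
vertex `n - 1` joined to the vertex `q`. -/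
def forkLabel (n q i j : ℕ) : ℕ :=
  if j + 1 = n then if i = q then 3 else 2 else if j = i + 1 then 3 else 2

namespace CoxeterMatrix

open Real

variable {B : Type*} {M : CoxeterMatrix B}

/-- The standard enumerations of the vertices of irreducible Coxeter graphs of finite type. -/
def HasStandardLabelling (M : CoxeterMatrix B) : Prop :=
  ∃ (n : ℕ) (v : ℕ → B), (∀ i < n, ∀ j < n, v i = v j → i = j) ∧ (∀ b, ∃ i < n, v i = b) ∧
    (n ≤ 2 ∨
      (∃ p m, (∀ i j, i < j → j < n → M (v i) (v j) = pathLabel p m i j) ∧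
        (m = 3 ∨ m = 4 ∧ p = 0 ∨ m = 4 ∧ p = 1 ∧ n = 4 ∨ m = 5 ∧ p = 0 ∧ (n = 3 ∨ n = 4))) ∨
      ∃ q, (∀ i j, i < j → j < n → M (v i) (v j) = forkLabel n q i j) ∧
        (q = 1 ∧ 4 ≤ n ∨ q = 2 ∧ (n = 6 ∨ n = 7 ∨ n = 8)))

variable [Finite M.Group] {v : ℕ → B} {k : ℕ}

theorem IsMaxPath.fork_path' (h : M.IsMaxPath v k) {u : B} (hu : ∀ i ≤ k, v i ≠ u) {i j : ℕ}
    (hi : i ≤ k) (hj : j < k) (ha : M (v i) u ≠ 2) : M (v j) (v (j + 1)) = 3 := by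
  rcases le_or_gt i j with hij | hij
  · exact h.fork_path hu hij hj ha
  · have := h.reverse.fork_path (fun t _ => hu _ (by omega)) (i := k - i) (j := k - (j + 1))
      (by omega) (by omega) (by simpa [show k - (k - i) = i by omega] using ha)
    rwa [show k - (k - (j + 1)) = j + 1 by omega, show k - (k - (j + 1) + 1) = j by omega,
      M.symmetric] at this

theorem IsMaxPath.hasStandardLabelling_of_fork (h : M.IsMaxPath v k) {u : B}
    (hu : ∀ i ≤ k, v i ≠ u) {i : ℕ} (hik : 2 * i ≤ k) (ha : M (v i) u ≠ 2)
    (hcov : ∀ b, b ≠ u → ∃ t ≤ k, v t = b) : M.HasStandardLabelling := by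
  obtain ⟨hi0, -⟩ := h.interior hu (by omega) ha
  have hi3 : i < 3 := by
    by_contra hi
    exact (h.toIsPath.shift (i - 3) (l := 6) (by omega)).not_fork (M.isPath_const u) (q := 3)
      (fun t _ _ _ => hu _ (by omega)) (by omega) (by simpa [show i - 3 + 3 = i by omega] using ha)
      (fun t => [1, 2, 3, 4, 3, 2, 1].getD t 0) (fun _ => 2)
      (by decide) (by decide) (by decide) (by decide)
  have hk : i = 2 → k < 7 := by
    rintro rfl
    by_contra hk
    exact (h.toIsPath.shift 0 (l := 7) (by omega)).not_fork (M.isPath_const u) (q := 2)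
      (fun t _ _ _ => hu _ (by omega)) (by omega) (by simpa using ha)
      (fun t => [2, 4, 6, 5, 4, 3, 2, 1].getD t 0) (fun _ => 3)
      (by decide) (by decide) (by decide) (by decide)
  refine ⟨k + 2, fun t => if t ≤ k then v t else u, ?_, ?_, Or.inr (Or.inr ⟨i, ?_, by omega⟩)⟩
  · intro a hak b hbk e
    dsimp only at e
    split_ifs at e with h1 h2 h2
    · exact h.inj a h1 b h2 e
    · exact absurd e (hu _ h1)
    · exact absurd e.symm (hu _ h2)
    · omega
  · intro b
    rcases eq_or_ne b u with rfl | hb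
    · exact ⟨k + 1, by omega, by simp⟩
    · obtain ⟨t, ht, rfl⟩ := hcov b hb
      exact ⟨t, by omega, by simp [ht]⟩
  · intro a b hab hb
    beta_reduce
    rw [forkLabel, if_pos (show a ≤ k by omega)]
    rcases eq_or_ne (b + 1) (k + 2) with hbk | hbk
    · rw [if_pos hbk, if_neg (by omega)]
      split_ifs with hai
      · rw [hai]
        exact h.fork_edge hu (by omega) ha
      · rcases lt_or_gt_of_ne hai with hai | hai
        · by_contra hc
          exact ha (h.attach_unique hu hai (by omega) hc)
        · exact h.attach_unique hu hai (by omega) ha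
    · rw [if_neg hbk, if_pos (by omega)]
      split_ifs with hba
      · rw [hba]
        exact h.fork_path' hu (by omega) (by omega) ha
      · exact h.not_chord (by omega) (by omega)

theorem IsMaxPath.hasStandardLabelling_of_path (h : M.IsMaxPath v k)
    (hcov : ∀ b, ∃ t ≤ k, v t = b) {p : ℕ} (hpk : 2 * p + 1 ≤ k) (h3 : M (v p) (v (p + 1)) ≠ 3) :
    M.HasStandardLabelling := by
  refine ⟨k + 1, v, fun i hi j hj => h.inj i (by omega) j (by omega), fun b => ?_, ?_⟩
  · obtain ⟨t, ht, e⟩ := hcov b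
    exact ⟨t, by omega, e⟩
  rcases Nat.lt_or_ge k 2 with hk | hk
  · exact Or.inl (by omega)
  refine Or.inr (Or.inl ⟨p, M (v p) (v (p + 1)), fun i j hij hj => ?_, ?_⟩)
  · rw [pathLabel]
    split_ifs with h1 h2
    · rw [h1, h2]
    · rw [h1]
      rcases lt_or_gt_of_ne h2 with h2 | h2
      · by_contra hc
        exact h3 (h.label_unique h2 (by omega) hc)
      · exact h.label_unique h2 (by omega) h3
    · exact h.not_chord (by omega) (by omega)
  have hne : v p ≠ v (p + 1) := fun e => by have := h.inj _ (by omega) _ (by omega) e; omega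
  have h2 := h.adj p (by omega)
  have s2 : √2 * √2 = 2 := Real.mul_self_sqrt (by norm_num)
  have s2p : 0 < √2 := by positivity
  have s3 : √3 * √3 = 3 := Real.mul_self_sqrt (by norm_num)
  have s3p : 0 < √3 := by positivity
  have hφ := goldenRatio_sq
  have hφ1 := one_lt_goldenRatio
  have hφ2 : 3 / 2 < goldenRatio := by nlinarith
  have hφ5 := fun h4 : M (v p) (v (p + 1)) ≠ 4 => goldenRatio_le_neg_gram hne h2 h3 h4
  generalize goldenRatio = φ at hφ hφ1 hφ2 hφ5
  have h45 : M (v p) (v (p + 1)) = 4 ∨ M (v p) (v (p + 1)) = 5 := by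
    by_contra! h45
    refine (h.toIsPath.shift p (l := 2) (by omega)).not_weighted
      (fun t => [√3, 1].getD t 0) (fun t => [√3, 2, 1].getD t 0) ?_ ?_ ?_
    · intro t ht
      interval_cases t
      · simpa using sqrt_three_le_neg_gram hne h2 h3 h45.1 h45.2
      · simpa using h.one_le (i := p + 1) (j := p + 2) (by omega) (by omega) (by omega)
    · intro t ht
      interval_cases t <;> simp
    · intro t ht
      interval_cases t <;> simp <;> linarith
  have hp5 : M (v p) (v (p + 1)) = 5 → p = 0 ∧ k < 4 := by
    intro h5
    have hφ' := hφ5 (by omega)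
    have hp : p = 0 := by
      by_contra hp
      refine (h.toIsPath.shift (p - 1) (l := 3) (by omega)).not_weighted
        (fun t => [1, φ, 1].getD t 0) (fun t => [1, 2, 2, 1].getD t 0) ?_ ?_ ?_
      · intro t ht
        interval_cases t
        · simpa using h.one_le (i := p - 1) (j := p - 1 + 1) (by omega) (by omega) (by omega)
        · simpa [show p - 1 + 1 = p by omega, show p - 1 + 2 = p + 1 by omega] using hφ'
        · simpa using h.one_le (i := p - 1 + 2) (j := p - 1 + 3) (by omega) (by omega) (by omega)
      · intro t ht
        interval_cases t <;> simp
      · intro t ht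
        interval_cases t <;> simp <;> linarith
    refine ⟨hp, ?_⟩
    subst hp
    by_contra hk4
    refine (h.toIsPath.shift 0 (l := 4) (by omega)).not_weighted
      (fun t => [φ, 1, 1, 1].getD t 0)
      (fun t => [2 * φ, 4, 3, 2, 1].getD t 0) ?_ ?_ ?_
    · intro t ht
      have h1 : t < k := by omega
      interval_cases t
      · simpa using hφ'
      all_goals simpa using h.one_le h1.le (by omega) (Or.inl rfl)
    · intro t ht
      interval_cases t <;> simp
      linarith
    · intro t ht
      interval_cases t <;> simp <;> nlinarith
  have hp4 : M (v p) (v (p + 1)) = 4 → p = 0 ∨ p = 1 ∧ k = 3 := by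
    intro h4
    by_contra hc
    refine (h.toIsPath.shift (p - 1) (l := 4) (by omega)).not_weighted
      (fun t => [1, √2, 1, 1].getD t 0) (fun t => [√2, 2 * √2, 3, 2, 1].getD t 0) ?_ ?_ ?_
    · intro t ht
      interval_cases t
      · simpa using h.one_le (i := p - 1) (j := p - 1 + 1) (by omega) (by omega) (by omega)
      · simpa [show p - 1 + 1 = p by omega, show p - 1 + 2 = p + 1 by omega] using
          sqrt_two_le_neg_gram hne h2 h3
      · simpa using h.one_le (i := p - 1 + 2) (j := p - 1 + 3) (by omega) (by omega) (by omega)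
      · simpa using h.one_le (i := p - 1 + 3) (j := p - 1 + 4) (by omega) (by omega) (by omega)
    · intro t ht
      interval_cases t <;> simp
    · intro t ht
      interval_cases t <;> simp <;> nlinarith
  omega

theorem Irred.hasStandardLabelling [Nonempty B] (hM : M.Irred) : M.HasStandardLabelling := by
  have := M.toCoxeterSystem.finite_index
  obtain ⟨v, k, h⟩ := M.exists_isMaxPath
  by_cases hcov : ∀ b, ∃ t ≤ k, v t = b
  · by_cases h3 : ∃ p < k, M (v p) (v (p + 1)) ≠ 3
    · obtain ⟨p, hp, h3⟩ := h3
      rcases Nat.lt_or_ge k (2 * p + 1) with hpk | hpk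
      · refine h.reverse.hasStandardLabelling_of_path (fun b => ?_) (p := k - (p + 1)) (by omega) ?_
        · obtain ⟨t, ht, e⟩ := hcov b
          exact ⟨k - t, by omega, by rwa [show k - (k - t) = t by omega]⟩
        · rwa [M.symmetric, show k - (k - (p + 1)) = p + 1 by omega,
            show k - (k - (p + 1) + 1) = p by omega]
      · exact h.hasStandardLabelling_of_path hcov hpk h3
    · push Not at h3
      refine ⟨k + 1, v, fun i hi j hj => h.inj i (by omega) j (by omega), fun b => ?_,
        Or.inr (Or.inl ⟨0, 3, fun i j hij hj => ?_, Or.inl rfl⟩)⟩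
      · obtain ⟨t, ht, e⟩ := hcov b
        exact ⟨t, by omega, e⟩
      · rw [pathLabel, ite_self]
        split_ifs with h1
        · rw [h1]; exact h3 i (by omega)
        · exact h.not_chord (by omega) (by omega)
  · push Not at hcov
    obtain ⟨b, hb⟩ := hcov
    obtain ⟨_, ⟨i, hi, rfl⟩, u, hu, ha⟩ := hM {b | ∃ t ≤ k, v t = b} ⟨v 0, 0, by omega, rfl⟩
      ⟨b, fun ⟨t, ht, e⟩ => hb t ht e⟩
    have hu : ∀ i ≤ k, v i ≠ u := fun t ht e => hu ⟨t, ht, e⟩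
    have hcov' : ∀ b, b ≠ u → ∃ t ≤ k, v t = b := by
      intro b hb
      by_contra hbt
      obtain ⟨c, hc, u', hu', ha'⟩ := hM {b | b = u ∨ ∃ t ≤ k, v t = b} ⟨u, Or.inl rfl⟩
        ⟨b, fun hb' => hb'.elim hb hbt⟩
      simp only [Set.mem_ofPred_eq, not_or] at hc hu'
      have hu'v : ∀ i ≤ k, v i ≠ u' := fun t ht e => hu'.2 ⟨t, ht, e⟩
      rcases hc with rfl | ⟨j, hj, rfl⟩
      · have hw : M.IsPath (fun t => if t = 0 then c else u') 1 := by
          constructor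
          · intro a ha b hb e
            have := hu'.1
            split_ifs at e with h1 h2 h2
            · omega
            · exact absurd e.symm this
            · exact absurd e this
            · omega
          · intro a ha
            obtain rfl : a = 0 := by omega
            simpa using ha'
        have hlen : ∀ (v : ℕ → B) (i : ℕ), M.IsMaxPath v k → (∀ i ≤ k, v i ≠ c) →
            (∀ i ≤ k, v i ≠ u') → i ≤ k → M (v i) c ≠ 2 → 2 ≤ i := by
          intro v i h hu hu'v hi ha
          have h1 := (h.toIsPath.shift i (l := k - i) (by omega)).cons (u := c)
            (fun t ht => hu _ (by omega)) (by simpa [M.symmetric c] using ha)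
          have h2 := h1.cons (u := u') (fun t ht => by
            rcases t with _ | t
            · exact fun e => hu'.1 e.symm
            · exact hu'v _ (by omega)) (by simpa [M.symmetric u'] using ha')
          have := h.max _ _ h2
          omega
        have h1 := hlen v i h hu hu'v hi ha
        have h2 := hlen _ (k - i) h.reverse (fun t _ => hu _ (by omega))
          (fun t _ => hu'v _ (by omega)) (by omega) (by rwa [show k - (k - i) = i by omega])
        refine (h.toIsPath.shift (i - 2) (l := 4) (by omega)).not_fork hw (q := 2)
          (fun t ht s hs => ?_) (by omega) (by simpa [show i - 2 + 2 = i by omega] using ha)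
          (fun t => [1, 2, 3, 2, 1].getD t 0) (fun t => [2, 1].getD t 0)
          (by decide) (by decide) (by decide) (by decide)
        split_ifs
        · exact hu _ (by omega)
        · exact hu'v _ (by omega)
      · rcases le_total i j with hij | hij
        · exact hu'.1 (h.attached_unique hu hu'v hij hj ha ha').symm
        · exact hu'.1 (h.attached_unique hu'v hu hij hi ha' ha)
    rcases le_total (2 * i) k with hik | hik
    · exact h.hasStandardLabelling_of_fork hu hik ha hcov'
    · refine h.reverse.hasStandardLabelling_of_fork (fun t _ => hu _ (by omega)) (i := k - i)
        (by omega) (by rwa [show k - (k - i) = i by omega]) fun b hb => ?_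
      obtain ⟨t, ht, e⟩ := hcov' b hb
      exact ⟨k - t, by omega, by rwa [show k - (k - t) = t by omega]⟩

end CoxeterMatrix

section Inversion

variable {X A : Type*} [CommGroup A]

/-- An abelian group of permutations is inverted by an involution, which may be prescribed on one
representative of each orbit. -/
theorem exists_perm_inverting (φ : A →* Equiv.Perm X) (c : X → A) :
    ∃ σ : Equiv.Perm X, σ * σ = 1 ∧ (∀ a, σ * φ a = (φ a)⁻¹ * σ) ∧
      ∀ x, ∃ r a, x = φ a r ∧ σ x = φ (a⁻¹ * c r) r := by
  let s : Setoid X := ⟨fun x y => ∃ a, φ a x = y, fun x => ⟨1, by simp⟩,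
    fun ⟨a, h⟩ => ⟨a⁻¹, by rw [← h, ← Equiv.Perm.mul_apply, ← map_mul]; simp⟩,
    fun ⟨a, h⟩ ⟨b, h'⟩ => ⟨b * a, by rw [map_mul, Equiv.Perm.mul_apply, h, h']⟩⟩
  let rep : X → X := fun x => (Quotient.mk s x).out
  have hrep : ∀ x, ∃ a, φ a (rep x) = x := fun x => Quotient.mk_out (s := s) x
  choose arg harg using hrep
  have hrepa : ∀ a x, rep (φ a x) = rep x := fun a x => by
    have : Quotient.mk s (φ a x) = Quotient.mk s x := (Quotient.sound (s := s) ⟨a, rfl⟩).symm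
    simp only [rep, this]
  have hreprep : ∀ x, rep (rep x) = rep x := fun x => by
    conv_rhs => rw [← harg x, hrepa]
  have hwd : ∀ a b c x, φ a x = φ b x → φ (a⁻¹ * c) x = φ (b⁻¹ * c) x := fun a b c x h => by
    have h1 : φ (a⁻¹ * c) x = φ (a⁻¹ * c * b⁻¹) (φ b x) := by
      rw [← Equiv.Perm.mul_apply, ← map_mul]; simp
    rw [h1, ← h, ← Equiv.Perm.mul_apply, ← map_mul]
    congr 2
    rw [mul_right_comm, mul_right_comm a⁻¹, inv_mul_cancel, one_mul, mul_comm]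
  let f : X → X := fun x => φ ((arg x)⁻¹ * c (rep x)) (rep x)
  have hf : ∀ a x, f (φ a (rep x)) = φ (a⁻¹ * c (rep x)) (rep x) := fun a x => by
    have h1 : rep (φ a (rep x)) = rep x := by rw [hrepa, hreprep]
    simp only [f, h1]
    apply hwd
    have := harg (φ a (rep x))
    rwa [h1] at this
  have hff : Function.Involutive f := fun x => by
    have : f (f x) = φ (((arg x)⁻¹ * c (rep x))⁻¹ * c (rep x)) (rep x) := hf _ x
    rw [this]
    simp [harg]
  refine ⟨hff.toPerm, Equiv.ext fun x => hff x, fun a => Equiv.ext fun x => ?_, fun x =>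
    ⟨rep x, arg x, (harg x).symm, rfl⟩⟩
  have h1 := hf (a * arg x) x
  rw [map_mul, Equiv.Perm.mul_apply, harg x] at h1
  simp only [Equiv.Perm.mul_apply, Function.Involutive.coe_toPerm, h1, ← map_inv]
  simp only [f, ← Equiv.Perm.mul_apply, ← map_mul, mul_inv, mul_assoc]

theorem Equiv.Perm.exists_inverting (f : Equiv.Perm X) :
    ∃ σ : Equiv.Perm X, σ * σ = 1 ∧ σ * f * (σ * f) = 1 := by
  obtain ⟨σ, h1, h2, -⟩ := exists_perm_inverting (zpowersHom _ f) fun _ => 1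
  have h3 := h2 (Multiplicative.ofAdd 1)
  simp only [zpowersHom_apply, toAdd_ofAdd, zpow_one] at h3
  refine ⟨σ, h1, ?_⟩
  nth_rewrite 1 [h3]
  rw [mul_assoc, ← mul_assoc σ, h1]
  simp

theorem Equiv.Perm.exists_inverting_of_commute (f ν : Equiv.Perm X) (hν : ν * ν = 1)
    (hνx : ∀ x, ν x ≠ x) (hc : Commute f ν) :
    ∃ σ : Equiv.Perm X, σ * σ = 1 ∧ σ * f * (σ * f) = 1 ∧ Commute σ ν ∧ ∀ x, σ x ≠ ν x := by
  classical
  have hνν : ∀ x, ν (ν x) = x := fun x => by rw [← Equiv.Perm.mul_apply, hν]; rfl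
  have hνi : ν⁻¹ = ν := inv_eq_of_mul_eq_one_left hν
  let φ : Multiplicative ℤ × Multiplicative ℤ →* Equiv.Perm X :=
    (zpowersHom _ f).noncommCoprod (zpowersHom _ ν) fun a b => by
      simpa using (hc.zpow_zpow _ _)
  have hφ : ∀ a, φ a = f ^ a.1.toAdd * ν ^ a.2.toAdd := fun a => rfl
  have h1 : ∀ k : ℤ, φ (Multiplicative.ofAdd k, 1) = f ^ k := fun k => by simp [hφ]
  have h2 : φ (1, Multiplicative.ofAdd 1) = ν := by simp [hφ]
  obtain ⟨σ, hσ, hσφ, hσx⟩ := exists_perm_inverting φ fun r =>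
    if ∃ k : ℤ, ν r = (f ^ (2 * k)) r then (Multiplicative.ofAdd (-1), Multiplicative.ofAdd 1) else 1
  have hf := hσφ (Multiplicative.ofAdd 1, 1)
  have hn := hσφ (1, Multiplicative.ofAdd 1)
  rw [h1, zpow_one] at hf
  rw [h2, hνi] at hn
  refine ⟨σ, hσ, ?_, hn, fun x hx => ?_⟩
  · nth_rewrite 1 [hf]
    rw [mul_assoc, ← mul_assoc σ, hσ]
    simp
  · obtain ⟨r, a, rfl, h⟩ := hσx x
    rw [h, ← h2] at hx
    have h3 := congrArg (φ a) hx
    simp only [← Equiv.Perm.mul_apply, ← map_mul, mul_inv_cancel_left] at h3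
    have hν2 : ∀ k : ℤ, ν ^ (2 * k) = 1 := fun k => by
      rw [zpow_mul, zpow_two, hν, one_zpow]
    have h4 : φ (a * ((1, Multiplicative.ofAdd 1) * a)) = ν * f ^ (2 * a.1.toAdd) := by
      rw [mul_left_comm, map_mul, h2, hφ]
      simp [← two_mul, hν2]
    rw [h4] at h3
    split_ifs at h3 with hk
    · obtain ⟨k, hk⟩ := hk
      rw [h2] at hk
      rw [hφ] at h3
      simp only [toAdd_ofAdd, zpow_one, zpow_neg] at h3
      rw [← hνi, ← mul_inv_rev, hνi, hc.eq.symm, mul_inv_rev, hνi, Equiv.Perm.mul_apply,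
        Equiv.Perm.mul_apply] at h3
      have h5 : (f ^ (2 * a.1.toAdd + 1)) r = r := by
        rw [add_comm, zpow_add, zpow_one, Equiv.Perm.mul_apply, ← ν.injective h3]
        simp
      have h6 : (f ^ (2 * k * 2)) r = r := by
        rw [mul_two, zpow_add, Equiv.Perm.mul_apply, ← hk, ← Equiv.Perm.mul_apply,
          (hc.zpow_left _).eq, Equiv.Perm.mul_apply, ← hk, hνν]
      have h7 := Equiv.Perm.zpow_apply_eq_self_of_apply_eq_self h5 (2 * k)
      have h8 := Equiv.Perm.zpow_apply_eq_self_of_apply_eq_self h6 (-a.1.toAdd)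
      rw [← zpow_mul] at h7 h8
      refine hνx r ?_
      rw [hk, show 2 * k = (2 * a.1.toAdd + 1) * (2 * k) + 2 * k * 2 * -a.1.toAdd by ring, zpow_add,
        Equiv.Perm.mul_apply, h8, h7]
    · simp only [h2] at hk
      refine hk ⟨a.1.toAdd, ?_⟩
      rw [map_one, Equiv.Perm.one_apply, Equiv.Perm.mul_apply] at h3
      rw [← hνν ((f ^ _) r), ← h3]

/-- The product of the transpositions `(x y)` and `(ν x ν y)`. -/
def doubleSwap [DecidableEq X] (ν : Equiv.Perm X) (x y : X) : Equiv.Perm X :=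
  Equiv.swap x y * Equiv.swap (ν x) (ν y)

theorem mem_of_doubleSwap_mem [DecidableEq X] [Finite X] {ν : Equiv.Perm X} (hν : ∀ x, ν (ν x) = x)
    (H : Subgroup (Equiv.Perm X))
    (hH : ∀ x y, x ≠ y → ν x ≠ y → doubleSwap ν x y ∈ H) {σ : Equiv.Perm X} (hσ : ∀ x, σ (σ x) = x)
    (hσν : ∀ x, σ (ν x) = ν (σ x)) (hνx : ∀ x, ν x ≠ x) (hσx : ∀ x, σ x ≠ ν x) : σ ∈ H := by
  have := Fintype.ofFinite X
  induction hn : (Finset.univ.filter fun x => σ x ≠ x).card using Nat.strong_induction_on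
    generalizing σ with
  | _ n ih =>
  by_cases h1 : ∀ x, σ x = x
  · rw [show σ = 1 from Equiv.ext h1]
    exact H.one_mem
  push Not at h1
  obtain ⟨x, hx⟩ := h1
  have hd := hH x (σ x) hx.symm (hσx x).symm
  have hνi : ∀ a b, ν a = ν b ↔ a = b := fun a b => ν.injective.eq_iff
  have hσi : ∀ a b, σ a = b ↔ a = σ b := fun a b =>
    ⟨fun h => by rw [← h, hσ], fun h => by rw [h, hσ]⟩
  have hνj : ∀ a b, ν a = b ↔ a = ν b := fun a b =>
    ⟨fun h => by rw [← h, hν], fun h => by rw [h, hν]⟩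
  have hval : ∀ z, (doubleSwap ν x (σ x) * σ) z =
      if z = x ∨ z = σ x ∨ z = ν x ∨ z = ν (σ x) then z else σ z := by
    intro z
    have e1 := hσx x
    have e2 := hνx x
    have e3 := hνx (σ x)
    simp only [doubleSwap, Equiv.Perm.mul_apply, Equiv.swap_apply_def]
    grind
  have key := ih _ ?_ (σ := doubleSwap ν x (σ x) * σ) ?_ ?_ ?_ rfl
  · have := H.mul_mem (H.inv_mem hd) key
    rwa [inv_mul_cancel_left] at this
  · rw [← hn]
    refine Finset.card_lt_card ⟨fun z hz => ?_, fun hsub => ?_⟩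
    · simp only [Finset.mem_filter, Finset.mem_univ, true_and, hval] at hz ⊢
      split_ifs at hz with h
      · exact absurd rfl hz
      · exact hz
    · have := hsub (Finset.mem_filter.2 ⟨Finset.mem_univ x, hx⟩)
      simp [hval] at this
  · intro z
    simp only [hval]
    grind
  · intro z
    simp only [hval]
    grind
  · intro z
    simp only [hval]
    grind

end Inversion

section DihedralAndSigned

theorem StronglyReal.of_pair {G : Type*} [Group G] (a b : G) (ha : a * a = 1) (hb : b * b = 1)
    (h : Subgroup.closure {a, b} = ⊤) : StronglyReal G := by
  have ha' : a⁻¹ = a := inv_eq_of_mul_eq_one_left ha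
  have hb' : b⁻¹ = b := inv_eq_of_mul_eq_one_left hb
  have hab : b = (a * b)⁻¹ * a := by rw [mul_inv_rev, ha', hb', mul_assoc, ha, mul_one]
  have hk : ∀ k : ℤ, a * (a * b) ^ k = ((a * b)⁻¹) ^ k * a := fun k =>
    (SemiconjBy.zpow_right (a := a) (x := a * b) (y := (a * b)⁻¹) (by
      rw [SemiconjBy, ← mul_assoc, ha, one_mul]; exact hab) k)
  have hw : ∀ w : G, ∃ k : ℤ, w = (a * b) ^ k ∨ w = (a * b) ^ k * a := fun w => by
    have hmul : ∀ w s : G, s ∈ ({a, b} : Set G) →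
        (∃ k : ℤ, w = (a * b) ^ k ∨ w = (a * b) ^ k * a) →
        ∃ k : ℤ, w * s = (a * b) ^ k ∨ w * s = (a * b) ^ k * a := by
      rintro w s (rfl | rfl) ⟨k, rfl | rfl⟩
      · exact ⟨k, .inr rfl⟩
      · exact ⟨k, .inl (by rw [mul_assoc, ha, mul_one])⟩
      · refine ⟨k - 1, .inr ?_⟩
        rw [zpow_sub_one, mul_assoc _ _ a, ← hab]
      · exact ⟨k + 1, .inl (by rw [zpow_add_one, mul_assoc])⟩
    have : w ∈ Subgroup.closure {a, b} := by rw [h]; trivial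
    induction this using Subgroup.closure_induction_right with
    | one => exact ⟨0, .inl (by simp)⟩
    | mul_right x _ y hy ih => exact hmul x y hy ih
    | mul_inv_cancel x _ y hy ih =>
      refine hmul x y⁻¹ ?_ ih
      rcases hy with rfl | rfl
      · rw [ha']; exact .inl rfl
      · rw [hb']; exact .inr rfl
  intro w
  obtain ⟨k, rfl | rfl⟩ := hw w
  · refine ⟨a, ha, ?_⟩
    nth_rewrite 1 [hk]
    rw [mul_assoc, ← mul_assoc a, ha, one_mul, inv_zpow, inv_mul_cancel]
  · refine ⟨1, by simp, ?_⟩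
    rw [one_mul, mul_assoc, ← mul_assoc a, hk, mul_assoc, ha, mul_one, inv_zpow, mul_inv_cancel]

theorem CoxeterMatrix.stronglyReal_of_pair {B : Type*} (M : CoxeterMatrix B) (i j : B)
    (h : ∀ b, b = i ∨ b = j) : StronglyReal M.Group := by
  let cs := M.toCoxeterSystem
  refine .of_pair (cs.simple i) (cs.simple j) (cs.simple_mul_simple_self i)
    (cs.simple_mul_simple_self j) (top_le_iff.1 ?_)
  rw [← cs.subgroup_closure_range_simple]
  refine Subgroup.closure_mono ?_
  rintro _ ⟨b, rfl⟩
  rcases h b with rfl | rfl <;> simp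

/-- A Coxeter group whose dual geometric representation is realised by permutations `p b` of the
coordinates of functions on a set `X` is strongly real as soon as the group generated by the `p b`
is. -/
theorem CoxeterMatrix.stronglyReal_of_perm {B X : Type*} [Finite B] (M : CoxeterMatrix B)
    (O : Set (X → ℝ)) (x y : B → X) (r : B → ℝ) (hr : ∀ b, 0 < r b) (p : B → Equiv.Perm X)
    (hO : ∀ b g, g ∘ p b ∈ O ↔ g ∈ O) (k : B → X → ℝ)
    (hk : ∀ b, ∀ g ∈ O, ∀ z, g (p b z) = g z - k b z * (g (x b) - g (y b)))
    (hgram : ∀ b j, r j * (k b (x j) - k b (y j)) = M.gram b j * r b)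
    (g₀ : X → ℝ) (hg₀ : g₀ ∈ O) (hpos : ∀ b, g₀ (y b) < g₀ (x b))
    (hH : ∀ q ∈ Subgroup.closure (Set.range p), ∃ σ ∈ Subgroup.closure (Set.range p),
      σ * σ = 1 ∧ σ * q * (σ * q) = 1) : StronglyReal M.Group := by
  let cs := M.toCoxeterSystem
  let L : (X → ℝ) → B → ℝ := fun g b => r b * (g (x b) - g (y b))
  let R : M.Group → Equiv.Perm X → Prop := fun w q =>
    (∀ g, g ∘ q ∈ O ↔ g ∈ O) ∧ ∀ g ∈ O, cs.dualRep w (L g) = L (g ∘ q)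
  have hRs : ∀ b, R (cs.simple b) (p b) := fun b => ⟨hO b, fun g hg => by
    ext j
    simp only [cs.dualRep_simple, M.refl_apply, L, Function.comp_apply, hk b g hg (x j),
      hk b g hg (y j)]
    linear_combination (g (x b) - g (y b)) * hgram b j⟩
  have hR1 : R 1 1 := ⟨fun g => Iff.rfl, fun g _ => by simp⟩
  have hRm : ∀ w w' q q', R w q → R w' q' → R (w * w') (q' * q) := by
    rintro w w' q q' ⟨h1, h2⟩ ⟨h3, h4⟩
    refine ⟨fun g => ?_, fun g hg => ?_⟩
    · rw [Equiv.Perm.coe_mul, ← Function.comp_assoc, h1, h3]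
    · rw [map_mul, Module.End.mul_apply, h4 g hg, h2 _ ((h3 g).2 hg)]
      rfl
  have hcomp : ∀ (q : Equiv.Perm X) (g : X → ℝ), (g ∘ ⇑q⁻¹) ∘ q = g := fun q g => by
    ext z; simp
  have hRi : ∀ w q, R w q → R w⁻¹ q⁻¹ := by
    rintro w q ⟨h1, h2⟩
    have h3 : ∀ g, g ∘ ⇑q⁻¹ ∈ O ↔ g ∈ O := fun g => by rw [← h1, hcomp]
    refine ⟨h3, fun g hg => ?_⟩
    have h4 := h2 _ ((h3 g).2 hg)
    rw [hcomp] at h4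
    rw [← h4, ← Module.End.mul_apply, ← map_mul]
    simp
  have hone : ∀ w, R w 1 → w = 1 := fun w hw =>
    cs.eq_one_of_dualRep_eq_self (c := L g₀) (fun b => mul_pos (hr b) (sub_pos.2 (hpos b)))
      (hw.2 g₀ hg₀)
  have hex : ∀ w, ∃ q ∈ Subgroup.closure (Set.range p), R w q := fun w => by
    induction w using cs.simple_induction with
    | simple i => exact ⟨p i, Subgroup.subset_closure ⟨i, rfl⟩, hRs i⟩
    | one => exact ⟨1, one_mem _, hR1⟩
    | mul w w' h h' =>
      obtain ⟨q, hq, hw⟩ := h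
      obtain ⟨q', hq', hw'⟩ := h'
      exact ⟨q' * q, mul_mem hq' hq, hRm _ _ _ _ hw hw'⟩
  have hex' : ∀ q ∈ Subgroup.closure (Set.range p), ∃ w, R w q := fun q hq => by
    induction hq using Subgroup.closure_induction with
    | mem q hq =>
      obtain ⟨b, rfl⟩ := hq
      exact ⟨_, hRs b⟩
    | one => exact ⟨1, hR1⟩
    | mul q q' _ _ h h' =>
      obtain ⟨w, hw⟩ := h
      obtain ⟨w', hw'⟩ := h'
      exact ⟨w' * w, hRm _ _ _ _ hw' hw⟩
    | inv q _ h =>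
      obtain ⟨w, hw⟩ := h
      exact ⟨w⁻¹, hRi _ _ hw⟩
  intro w
  obtain ⟨q, hq, hw⟩ := hex w
  obtain ⟨σ, hσ, h1, h2⟩ := hH q hq
  obtain ⟨s, hs⟩ := hex' σ hσ
  refine ⟨s, hone _ (by simpa [h1] using hRm _ _ _ _ hs hs), hone _ ?_⟩
  have h3 := hRm _ _ _ _ (hRm _ _ _ _ hs hw) (hRm _ _ _ _ hs hw)
  rwa [show q * σ * (q * σ) = 1 by
    rw [← mul_right_inj σ, ← mul_left_inj σ]
    simpa [mul_assoc, h1] using congrArg (· * (σ * σ)) h2] at h3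

theorem CoxeterMatrix.gram_of_label {n : ℕ} (M : CoxeterMatrix (Fin n)) (f : ℕ → ℕ → ℕ)
    (hf : ∀ i j : Fin n, i < j → M i j = f i j) (i j : Fin n) :
    M.gram i j = if i = j then 2 else
      -2 * Real.cos (Real.pi / if (i : ℕ) < j then f i j else f j i) := by
  split_ifs with h1 h2
  · rw [h1, M.gram_self]
  · rw [CoxeterMatrix.gram, hf i j h2]
  · rw [M.gram_comm, CoxeterMatrix.gram, hf j i (lt_of_le_of_ne (not_lt.1 h2) (Ne.symm h1))]

theorem CoxeterMatrix.stronglyReal_of_pathLabel_three {n p : ℕ} (M : CoxeterMatrix (Fin n))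
    (hM : ∀ i j : Fin n, i < j → M i j = pathLabel p 3 i j) : StronglyReal M.Group := by
  refine M.stronglyReal_of_perm (X := Fin (n + 1)) Set.univ Fin.succ Fin.castSucc (fun _ => 1)
    (fun _ => one_pos) (fun b => Equiv.swap b.castSucc b.succ) (by simp)
    (fun b z => (if z = b.succ then 1 else 0) - if z = b.castSucc then 1 else 0) ?_ ?_
    (fun i => (i : ℝ)) trivial (by simp) ?_
  · intro b g _ z
    simp only [Equiv.swap_apply_def]
    have : b.succ ≠ b.castSucc := fun h => by simp [Fin.ext_iff] at h
    split_ifs <;> simp_all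
  · intro b j
    have e2 : Real.cos (Real.pi / (2 : ℕ)) = 0 := by norm_num
    have e3 : Real.cos (Real.pi / (3 : ℕ)) = 1 / 2 := by norm_num
    rw [M.gram_of_label _ hM]
    simp only [pathLabel, Fin.ext_iff, Fin.val_succ, Fin.val_castSucc]
    split_ifs <;> first | omega | norm_num [e2, e3]
  · intro q _
    have htop : Subgroup.closure (Set.range fun b : Fin n => Equiv.swap b.castSucc b.succ) = ⊤ := by
      rw [← top_le_iff]
      intro w _
      have : w ∈ Submonoid.closure (Set.range fun b : Fin n => Equiv.swap b.castSucc b.succ) := by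
        rw [Equiv.Perm.mclosure_swap_castSucc_succ]; trivial
      exact (Submonoid.closure_le (S := (Subgroup.closure _).toSubmonoid)).2
        Subgroup.subset_closure this
    obtain ⟨σ, h⟩ := q.exists_inverting
    exact ⟨σ, by rw [htop]; trivial, h⟩

end DihedralAndSigned

section Signed

theorem doubleSwap_comm {X : Type*} [DecidableEq X] (ν : Equiv.Perm X) (x y : X) :
    doubleSwap ν x y = doubleSwap ν y x := by
  rw [doubleSwap, doubleSwap, Equiv.swap_comm x, Equiv.swap_comm (ν x)]

theorem conj_doubleSwap {X : Type*} [DecidableEq X] {ν q : Equiv.Perm X}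
    (h : ∀ x, q (ν x) = ν (q x)) (x y : X) :
    q * doubleSwap ν x y * q⁻¹ = doubleSwap ν (q x) (q y) := by
  rw [doubleSwap, doubleSwap, ← h, ← h, Equiv.swap_apply_apply q x, Equiv.swap_apply_apply q (ν x)]
  group

theorem doubleSwap_apply {X : Type*} [DecidableEq X] {ν : Equiv.Perm X} (hν : ∀ x, ν (ν x) = x)
    (hνx : ∀ x, ν x ≠ x) {x y : X} (hxy : x ≠ y) (hνy : ν x ≠ y) (z : X) :
    doubleSwap ν x y z = if z = x then y else if z = y then x else if z = ν x then ν y else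
      if z = ν y then ν x else z := by
  have hνi : ∀ a b, ν a = ν b ↔ a = b := fun a b => ν.injective.eq_iff
  have hνj : ∀ a b, ν a = b ↔ a = ν b := fun a b =>
    ⟨fun h => by rw [← h, hν], fun h => by rw [h, hν]⟩
  have e1 := hνx x
  have e2 := hνx y
  simp only [doubleSwap, Equiv.Perm.mul_apply, Equiv.swap_apply_def]
  grind

theorem doubleSwap_apply_map {X : Type*} [DecidableEq X] {ν : Equiv.Perm X} (hν : ∀ x, ν (ν x) = x)
    (hνx : ∀ x, ν x ≠ x) {x y : X} (hxy : x ≠ y) (hνy : ν x ≠ y) (z : X) :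
    doubleSwap ν x y (ν z) = ν (doubleSwap ν x y z) := by
  have hνi : ∀ a b, ν a = ν b ↔ a = b := fun a b => ν.injective.eq_iff
  have hνj : ∀ a b, ν a = b ↔ a = ν b := fun a b =>
    ⟨fun h => by rw [← h, hν], fun h => by rw [h, hν]⟩
  have e1 := hνx x
  have e2 := hνx y
  simp only [doubleSwap_apply hν hνx hxy hνy]
  grind

theorem doubleSwap_map_map {X : Type*} [DecidableEq X] {ν : Equiv.Perm X} (hν : ∀ x, ν (ν x) = x)
    (hνx : ∀ x, ν x ≠ x) {x y : X} (hxy : x ≠ y) (hνy : ν x ≠ y) :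
    doubleSwap ν (ν x) (ν y) = doubleSwap ν x y := by
  have hνi : ∀ a b, ν a = ν b ↔ a = b := fun a b => ν.injective.eq_iff
  have hνj : ∀ a b, ν a = b ↔ a = ν b := fun a b =>
    ⟨fun h => by rw [← h, hν], fun h => by rw [h, hν]⟩
  have e1 := hνx x
  have e2 := hνx y
  ext z
  rw [doubleSwap_apply hν hνx hxy hνy, doubleSwap_apply hν hνx (by grind) (by grind)]
  grind

theorem doubleSwap_mem_trans {X : Type*} [DecidableEq X] {ν : Equiv.Perm X} (hν : ∀ x, ν (ν x) = x)
    (hνx : ∀ x, ν x ≠ x) {H : Subgroup (Equiv.Perm X)} {x y z : X} (hxy : x ≠ y) (hνxy : ν x ≠ y)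
    (hyz : y ≠ z) (hνyz : ν y ≠ z) (hxz : x ≠ z) (hνxz : ν x ≠ z) (h : doubleSwap ν x y ∈ H)
    (h' : doubleSwap ν y z ∈ H) : doubleSwap ν x z ∈ H := by
  have h1 := H.mul_mem (H.mul_mem h h') (H.inv_mem h)
  rw [conj_doubleSwap (doubleSwap_apply_map hν hνx hxy hνxy), doubleSwap_apply hν hνx hxy hνxy,
    doubleSwap_apply hν hνx hxy hνxy] at h1
  have hνj : ∀ a b, ν a = b ↔ a = ν b := fun a b =>
    ⟨fun h => by rw [← h, hν], fun h => by rw [h, hν]⟩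
  rwa [if_neg hxy.symm, if_pos rfl, if_neg hxz.symm, if_neg hyz.symm, if_neg hνxz.symm,
    if_neg hνyz.symm] at h1

/-- The sign change on `Fin n × Bool`. -/
def signFlip (n : ℕ) : Equiv.Perm (Fin n × Bool) :=
  (Equiv.refl _).prodCongr Equiv.boolNot

theorem signFlip_apply {n : ℕ} (z : Fin n × Bool) : signFlip n z = (z.1, !z.2) := rfl

theorem signFlip_signFlip {n : ℕ} (z : Fin n × Bool) : signFlip n (signFlip n z) = z := by
  simp [signFlip_apply]

theorem signFlip_ne {n : ℕ} (z : Fin n × Bool) : signFlip n z ≠ z := fun h => by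
  have := congrArg Prod.snd h
  simp [signFlip_apply] at this

theorem doubleSwap_mem_of_adjacent {n : ℕ} {H : Subgroup (Equiv.Perm (Fin n × Bool))}
    (h1 : ∀ i j : Fin n, (j : ℕ) = i + 1 → doubleSwap (signFlip n) (i, true) (j, true) ∈ H)
    (h2 : ∀ i j : Fin n, (i : ℕ) = 0 → (j : ℕ) = 1 →
      doubleSwap (signFlip n) (i, true) (j, false) ∈ H)
    (x y : Fin n × Bool) (hxy : x.1 ≠ y.1) : doubleSwap (signFlip n) x y ∈ H := by
  have hneg : ∀ (i j : Fin n) (s t : Bool), i ≠ j →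
      doubleSwap (signFlip n) (i, !s) (j, !t) = doubleSwap (signFlip n) (i, s) (j, t) :=
    fun i j s t h => doubleSwap_map_map (x := (i, s)) (y := (j, t)) signFlip_signFlip signFlip_ne
      (fun h' => h (congrArg Prod.fst h')) (fun h' => h (congrArg Prod.fst h'))
  have htr : ∀ (i j k : Fin n) (s t u : Bool), i ≠ j → j ≠ k → i ≠ k →
      doubleSwap (signFlip n) (i, s) (j, t) ∈ H → doubleSwap (signFlip n) (j, t) (k, u) ∈ H →
      doubleSwap (signFlip n) (i, s) (k, u) ∈ H := fun i j k s t u h h' h'' =>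
    doubleSwap_mem_trans signFlip_signFlip signFlip_ne
      (fun e => h (congrArg Prod.fst e)) (fun e => h (congrArg Prod.fst e))
      (fun e => h' (congrArg Prod.fst e)) (fun e => h' (congrArg Prod.fst e))
      (fun e => h'' (congrArg Prod.fst e)) (fun e => h'' (congrArg Prod.fst e))
  have hpos : ∀ (d : ℕ) (i j : Fin n), (j : ℕ) = i + 1 + d →
      doubleSwap (signFlip n) (i, true) (j, true) ∈ H := fun d => by
    induction d with
    | zero => exact fun i j h => h1 i j h
    | succ d ih =>
      intro i j h
      have hk : (i : ℕ) + 1 + d < n := by omega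
      exact htr i ⟨_, hk⟩ j _ _ _ (by rw [Ne, Fin.ext_iff]; simp only; omega)
        (by rw [Ne, Fin.ext_iff]; simp only; omega) (by rw [Ne, Fin.ext_iff]; omega)
        (ih i ⟨_, hk⟩ rfl) (h1 _ _ (by simp only; omega))
  have hpos' : ∀ i j : Fin n, i ≠ j → doubleSwap (signFlip n) (i, true) (j, true) ∈ H :=
    fun i j h => by
      rw [Ne, Fin.ext_iff] at h
      rcases Nat.lt_or_gt_of_ne h with h | h
      · exact hpos (j - i - 1) i j (by omega)
      · rw [doubleSwap_comm]
        exact hpos (i - j - 1) j i (by omega)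
  have hmix0 : ∀ i j : Fin n, (i : ℕ) = 0 → i ≠ j →
      doubleSwap (signFlip n) (i, true) (j, false) ∈ H := fun i j h0 h => by
    by_cases hj : (j : ℕ) = 1
    · exact h2 i j h0 hj
    · rw [Ne, Fin.ext_iff] at h
      have hn : 1 < n := by omega
      refine htr i ⟨1, hn⟩ j true false false ?_ ?_ ?_ (h2 i _ h0 rfl) ?_
      · rw [Ne, Fin.ext_iff]; simp only; omega
      · rw [Ne, Fin.ext_iff]; simp only; omega
      · rw [Ne, Fin.ext_iff]; exact h
      · rw [show false = !true from rfl, hneg]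
        · exact hpos' _ _ (by rw [Ne, Fin.ext_iff]; simp only; omega)
        · rw [Ne, Fin.ext_iff]; simp only; omega
  have hmix : ∀ i j : Fin n, i ≠ j → doubleSwap (signFlip n) (i, true) (j, false) ∈ H :=
    fun i j h => by
      by_cases hi : (i : ℕ) = 0
      · exact hmix0 i j hi h
      by_cases hj : (j : ℕ) = 0
      · rw [doubleSwap_comm, ← hneg _ _ _ _ h.symm]
        exact hmix0 j i hj h.symm
      · have hn : 0 < n := by omega
        refine htr i ⟨0, hn⟩ j true true false ?_ ?_ h (hpos' _ _ ?_) (hmix0 _ _ rfl ?_)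
        all_goals rw [Ne, Fin.ext_iff]; simp only; omega
  obtain ⟨i, s⟩ := x
  obtain ⟨j, t⟩ := y
  cases s <;> cases t
  · rw [← hneg _ _ _ _ hxy]; exact hpos' i j hxy
  · rw [← hneg _ _ _ _ hxy]; exact hmix i j hxy
  · exact hmix i j hxy
  · exact hpos' i j hxy

theorem CoxeterMatrix.stronglyReal_of_signed {B : Type*} [Finite B] (M : CoxeterMatrix B) {n : ℕ}
    (x y : B → Fin n × Bool) (r : B → ℝ) (hr : ∀ b, 0 < r b)
    (p : B → Equiv.Perm (Fin n × Bool)) (hp : ∀ b z, p b (signFlip n z) = signFlip n (p b z))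
    (k : B → Fin n × Bool → ℝ)
    (hk : ∀ b, ∀ g : Fin n × Bool → ℝ, (∀ z, g (signFlip n z) = -g z) → ∀ z,
      g (p b z) = g z - k b z * (g (x b) - g (y b)))
    (hgram : ∀ b j, r j * (k b (x j) - k b (y j)) = M.gram b j * r b)
    (hpos : ∀ b, (if (y b).2 then ((y b).1 : ℝ) + 1 else -((y b).1 + 1)) <
      if (x b).2 then ((x b).1 : ℝ) + 1 else -((x b).1 + 1))
    (h1 : ∀ i j : Fin n, (j : ℕ) = i + 1 → doubleSwap (signFlip n) (i, true) (j, true) ∈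
      Subgroup.closure (Set.range p))
    (h2 : ∀ i j : Fin n, (i : ℕ) = 0 → (j : ℕ) = 1 →
      doubleSwap (signFlip n) (i, true) (j, false) ∈ Subgroup.closure (Set.range p)) :
    StronglyReal M.Group := by
  refine M.stronglyReal_of_perm {g | ∀ z, g (signFlip n z) = -g z} x y r hr p (fun b g => ?_) k hk
    hgram (fun z => if z.2 then (z.1 : ℝ) + 1 else -(z.1 + 1)) ?_ hpos ?_
  · simp only [Set.mem_ofPred_eq, Function.comp_apply, hp]
    exact ⟨fun h z => by simpa using h ((p b).symm z), fun h z => h _⟩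
  · rintro ⟨i, s⟩
    cases s <;> simp [signFlip_apply]
  · intro q hq
    have hν : signFlip n * signFlip n = 1 := Equiv.ext signFlip_signFlip
    have hc : Commute q (signFlip n) := by
      induction hq using Subgroup.closure_induction with
      | mem q hq => obtain ⟨b, rfl⟩ := hq; exact Equiv.ext (hp b)
      | one => exact Commute.one_left _
      | mul q q' _ _ h h' => exact h.mul_left h'
      | inv q _ h => exact h.inv_left
    obtain ⟨σ, h3, h4, h5, h6⟩ := q.exists_inverting_of_commute _ hν signFlip_ne hc
    refine ⟨σ, ?_, h3, h4⟩
    refine mem_of_doubleSwap_mem signFlip_signFlip _ (fun z w hzw hzw' => ?_)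
      (fun z => by rw [← Equiv.Perm.mul_apply, h3]; rfl)
      (fun z => by rw [← Equiv.Perm.mul_apply, h5.eq]; rfl) signFlip_ne h6
    refine doubleSwap_mem_of_adjacent h1 h2 z w fun h => ?_
    obtain ⟨i, s⟩ := z
    obtain ⟨j, t⟩ := w
    obtain rfl : i = j := h
    cases s <;> cases t <;> simp [signFlip_apply] at hzw hzw'

end Signed

section ClassicalTypes

/-- The coefficient of `g x - g y` in `g z - g (doubleSwap (signFlip n) x y z)`, for odd `g`. -/
def signedCoeff {n : ℕ} (x y z : Fin n × Bool) : ℝ :=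
  (if z = x then 1 else 0) + (if z = signFlip n y then 1 else 0) - (if z = y then 1 else 0) -
    (if z = signFlip n x then 1 else 0)

theorem odd_doubleSwap {n : ℕ} {x y : Fin n × Bool} (hxy : x.1 ≠ y.1) {g : Fin n × Bool → ℝ}
    (hg : ∀ z, g (signFlip n z) = -g z) (z : Fin n × Bool) :
    g (doubleSwap (signFlip n) x y z) = g z - signedCoeff x y z * (g x - g y) := by
  have h1 : x ≠ y := fun h => hxy (congrArg Prod.fst h)
  have h2 : signFlip n x ≠ y := fun h => hxy (congrArg Prod.fst h :)
  have h3 := signFlip_ne x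
  have h4 := signFlip_ne y
  have h5 : signFlip n x ≠ signFlip n y := fun h => h1 ((signFlip n).injective h)
  have h6 : signFlip n y ≠ x := fun h => hxy (congrArg Prod.fst h :).symm
  rw [doubleSwap_apply signFlip_signFlip signFlip_ne h1 h2, signedCoeff]
  by_cases e1 : z = x
  · subst e1; simp [h1, h3.symm, h6.symm]
  by_cases e2 : z = y
  · subst e2; simp [e1, h4.symm, h2.symm]
  by_cases e3 : z = signFlip n x
  · subst e3; simp [h2, h3, h5, hg]; ring
  by_cases e4 : z = signFlip n y
  · subst e4; simp [h4, h6, h5.symm, hg]; ring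
  simp [e1, e2, e3, e4]

theorem CoxeterMatrix.stronglyReal_of_pathLabel_four {n : ℕ} (M : CoxeterMatrix (Fin n))
    (hM : ∀ i j : Fin n, i < j → M i j = pathLabel 0 4 i j) :
    StronglyReal M.Group := by
  let pr : Fin n → Fin n := fun b => ⟨b - 1, by omega⟩
  let x : Fin n → Fin n × Bool := fun b => (b, true)
  let y : Fin n → Fin n × Bool := fun b => if (b : ℕ) = 0 then (b, false) else (pr b, true)
  let p : Fin n → Equiv.Perm (Fin n × Bool) := fun b =>
    if (b : ℕ) = 0 then Equiv.swap (x b) (y b) else doubleSwap (signFlip n) (x b) (y b)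
  have hp0 : ∀ b : Fin n, (b : ℕ) = 0 → p b = Equiv.swap (b, true) (b, false) := fun b h => by
    simp only [p, x, y, if_pos h]
  have hps : ∀ b : Fin n, (b : ℕ) ≠ 0 → p b = doubleSwap (signFlip n) (b, true) (pr b, true) :=
    fun b h => by simp only [p, x, y, if_neg h]
  have hprb : ∀ b : Fin n, (b : ℕ) ≠ 0 → b ≠ pr b := fun b h => by
    rw [Ne, Fin.ext_iff]; simp only [pr]; omega
  have hpν : ∀ b z, p b (signFlip n z) = signFlip n (p b z) := by
    intro b z
    by_cases hb : (b : ℕ) = 0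
    · rw [hp0 b hb]
      obtain ⟨i, s⟩ := z
      by_cases hi : i = b
      · subst hi; cases s <;> simp [signFlip_apply]
      · rw [Equiv.swap_apply_of_ne_of_ne, Equiv.swap_apply_of_ne_of_ne] <;>
          simp [signFlip_apply, hi]
    · rw [hps b hb]
      exact doubleSwap_apply_map (x := (b, true)) (y := (pr b, true)) signFlip_signFlip signFlip_ne
        (fun h => hprb b hb (congrArg Prod.fst h)) (fun h => hprb b hb (congrArg Prod.fst h)) z
  have hadj : ∀ i j : Fin n, (j : ℕ) = i + 1 → doubleSwap (signFlip n) (i, true) (j, true) ∈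
      Subgroup.closure (Set.range p) := fun i j h => by
    have h1 : p j ∈ Subgroup.closure (Set.range p) := Subgroup.subset_closure ⟨j, rfl⟩
    have h2 : pr j = i := by rw [Fin.ext_iff]; simp only [pr]; omega
    rwa [hps j (by omega), h2, doubleSwap_comm] at h1
  have h2 : (√2 : ℝ) * √2 = 2 := Real.mul_self_sqrt (by norm_num)
  have h20 : (0 : ℝ) < √2 := Real.sqrt_pos.2 (by norm_num)
  refine M.stronglyReal_of_signed x y (fun b => if (b : ℕ) = 0 then √2 / 2 else 1) (fun b => ?_) p
    hpν (fun b z => (if (b : ℕ) = 0 then 1 / 2 else 1) * signedCoeff (x b) (y b) z) ?_ ?_ ?_ hadj ?_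
  · split_ifs <;> positivity
  · intro b g hg z
    by_cases hb : (b : ℕ) = 0
    · have h3 : g (b, false) = -g (b, true) := hg (b, true)
      simp only [hp0 b hb, x, y, if_pos hb, signedCoeff, signFlip_apply, Bool.not_true,
        Bool.not_false, Equiv.swap_apply_def]
      by_cases e1 : z = (b, true)
      · subst e1; simp [h3]; ring
      by_cases e2 : z = (b, false)
      · subst e2; simp [h3]; ring
      simp [e1, e2]
    · simp only [hps b hb, x, y, if_neg hb, one_mul]
      exact odd_doubleSwap (hprb b hb) hg z
  · intro b j
    have e2 : Real.cos (Real.pi / (2 : ℕ)) = 0 := by norm_num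
    have e3 : Real.cos (Real.pi / (3 : ℕ)) = 1 / 2 := by norm_num
    have e4 : Real.cos (Real.pi / (4 : ℕ)) = √2 / 2 := by norm_num
    rw [M.gram_of_label _ hM]
    by_cases hb : (b : ℕ) = 0 <;> by_cases hj : (j : ℕ) = 0
    all_goals
      simp only [x, y, pr, hb, hj, if_true, if_false, signedCoeff, signFlip_apply, Prod.mk.injEq,
        Fin.ext_iff, Bool.not_true, Bool.not_false, pathLabel, Bool.true_eq_false, and_false,
        Bool.false_eq_true, and_true]
    all_goals
      (try split_ifs) <;> first | omega | (norm_num [e2, e3, e4] <;> linarith)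
  · intro b
    by_cases hb : (b : ℕ) = 0
    · simp [x, y, hb]
    · simp only [x, y, hb, if_false, if_true, pr]
      have : ((b - 1 : ℕ) : ℝ) < b := by exact_mod_cast (by omega)
      linarith
  · intro i j hi hj
    have h0 : p i ∈ Subgroup.closure (Set.range p) := Subgroup.subset_closure ⟨i, rfl⟩
    have h1 := mul_mem (mul_mem h0 (hadj i j (by omega))) (inv_mem h0)
    rw [conj_doubleSwap (hpν i), hp0 i hi, Equiv.swap_apply_left,
      Equiv.swap_apply_of_ne_of_ne (by simp [Fin.ext_iff]; omega) (by simp)] at h1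
    have h3 : i ≠ j := by rw [Ne, Fin.ext_iff]; omega
    have h4 := doubleSwap_map_map (x := (i, true)) (y := (j, false)) signFlip_signFlip signFlip_ne
      (fun h' => h3 (congrArg Prod.fst h')) (fun h' => h3 (congrArg Prod.fst h'))
    rw [← h4]
    exact h1

end ClassicalTypes

section TypeD

theorem CoxeterMatrix.stronglyReal_of_forkLabel_one {n : ℕ} (hn : 4 ≤ n) (M : CoxeterMatrix (Fin n))
    (hM : ∀ i j : Fin n, i < j → M i j = forkLabel n 1 i j) : StronglyReal M.Group := by
  let x : Fin n → Fin n × Bool := fun b =>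
    if h : (b : ℕ) + 1 = n then (⟨1, by omega⟩, true) else (⟨b + 1, by omega⟩, true)
  let y : Fin n → Fin n × Bool := fun b =>
    if (b : ℕ) + 1 = n then (⟨0, by omega⟩, false) else (b, true)
  let p : Fin n → Equiv.Perm (Fin n × Bool) := fun b => doubleSwap (signFlip n) (x b) (y b)
  have hxy : ∀ b, (x b).1 ≠ (y b).1 := fun b => by
    simp only [x, y]
    split_ifs <;> simp [Fin.ext_iff]
  refine M.stronglyReal_of_signed x y (fun _ => 1) (fun _ => one_pos) p (fun b z =>
    doubleSwap_apply_map (x := x b) (y := y b) signFlip_signFlip signFlip_ne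
      (fun h => hxy b (congrArg Prod.fst h)) (fun h => hxy b (congrArg Prod.fst h :)) z)
    (fun b => signedCoeff (x b) (y b)) (fun b g hg => odd_doubleSwap (hxy b) hg) (fun b j => ?_)
    (fun b => ?_) (fun i j h => ?_) (fun i j hi hj => ?_)
  · have e2 : Real.cos (Real.pi / (2 : ℕ)) = 0 := by norm_num
    have e3 : Real.cos (Real.pi / (3 : ℕ)) = 1 / 2 := by norm_num
    rw [M.gram_of_label _ hM]
    by_cases hb : (b : ℕ) + 1 = n <;> by_cases hj : (j : ℕ) + 1 = n
    all_goals
      simp only [x, y, hb, hj, dif_pos, dif_neg, not_false_eq_true, if_true, if_false, signedCoeff,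
        signFlip_apply, Prod.mk.injEq, Fin.ext_iff, Bool.not_true, Bool.not_false, forkLabel,
        Bool.true_eq_false, and_false, Bool.false_eq_true, and_true]
    all_goals
      (try split_ifs) <;> first | contradiction | omega | norm_num [e2, e3]
  · by_cases hb : (b : ℕ) + 1 = n
    · simp only [x, y, dif_pos hb, if_pos hb]; norm_num
    · simp only [x, y, dif_neg hb, if_neg hb]; norm_num
  · have h1 : p i ∈ Subgroup.closure (Set.range p) := Subgroup.subset_closure ⟨i, rfl⟩
    have h2 : (i : ℕ) + 1 ≠ n := by omega
    have h3 : (⟨(i : ℕ) + 1, by omega⟩ : Fin n) = j := Fin.ext h.symm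
    simp only [p, x, y, dif_neg h2, if_neg h2, h3] at h1
    rwa [doubleSwap_comm] at h1
  · have hl : n - 1 + 1 = n := by omega
    have h1 : p ⟨n - 1, by omega⟩ ∈ Subgroup.closure (Set.range p) :=
      Subgroup.subset_closure ⟨_, rfl⟩
    have h2 : (⟨0, by omega⟩ : Fin n) = i := Fin.ext hi.symm
    have h3 : (⟨1, by omega⟩ : Fin n) = j := Fin.ext hj.symm
    have h4 : i ≠ j := by rw [Ne, Fin.ext_iff]; omega
    have h5 : p ⟨n - 1, by omega⟩ = doubleSwap (signFlip n) (j, true) (i, false) := by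
      simp only [p, x, y, dif_pos hl, if_pos hl, h2, h3]
    rw [h5, doubleSwap_comm, ← doubleSwap_map_map (x := (i, false)) (y := (j, true)) signFlip_signFlip
      signFlip_ne (fun h => h4 (congrArg Prod.fst h)) (fun h => h4 (congrArg Prod.fst h))] at h1
    exact h1

end TypeD

section Certificate

/-- Read the first `n` base-`8` digits of `w`, least significant first, and apply the step `st` for
each of them. -/
noncomputable def runWord (st : ℕ → ℕ → ℕ) (n : ℕ) : ℕ → ℕ → ℕ :=
  Nat.rec (fun _ U => U) (fun _ ih w U => ih (Nat.div w 8) (st (Nat.mod w 8) U)) n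

/-- Apply the steps `st` for the first `n` base-`8` digits of `w`, least significant last. -/
noncomputable def runWordInv (st : ℕ → ℕ → ℕ) (n : ℕ) : ℕ → ℕ → ℕ :=
  Nat.rec (fun _ U => U) (fun _ ih w U => st (Nat.mod w 8) (ih (Nat.div w 8) U)) n

/-- The length of a word, stored in base `8` with leading digit `1`. -/
def wordLen (w : ℕ) : ℕ := Nat.div (Nat.log2 w) 3

/-- The element spelled by the first `n` base-`8` digits of `w`. -/
def wordProd {G : Type*} [Group G] (s : ℕ → G) : ℕ → ℕ → G
  | 0, _ => 1
  | n + 1, w => wordProd s n (w / 8) * s (w % 8)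

/-- The element spelled by a word. -/
def wordVal {G : Type*} [Group G] (s : ℕ → G) (w : ℕ) : G := wordProd s (wordLen w) w

/-- The states `U` and `V` agree up to `neg`. -/
def sameState (neg : ℕ → ℕ) (U V : ℕ) : Bool := (Nat.beq U V).or (Nat.beq U (neg V))

/-- Conjugating the product of the words `w` and `t` by the word `e / 128` gives, up to `neg`, the
word number `e % 128` in the list `ws`. -/
noncomputable def checkProduct (st : ℕ → ℕ → ℕ) (neg : ℕ → ℕ) (U₀ L : ℕ) (ws : List ℕ)
    (w t e : ℕ) : Bool :=
  let y := Nat.div e 128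
  let v := ws.getD (Nat.mod e 128) 0
  (Nat.ble (wordLen y + wordLen t + wordLen w + wordLen y) L).and <|
    (Nat.ble (wordLen v) L).and <| (Nat.blt (Nat.mod e 128) ws.length).and <|
    sameState neg (runWord st (wordLen y) y (runWord st (wordLen w) w
      (runWord st (wordLen t) t (runWordInv st (wordLen y) y U₀)))) (runWord st (wordLen v) v U₀)

/-- The word `σ` is an involution inverting the word `w`. -/
noncomputable def checkInverting (st : ℕ → ℕ → ℕ) (U₀ L w σ : ℕ) : Bool :=
  (Nat.ble (wordLen w + wordLen σ + wordLen w + wordLen σ) L).and <|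
    (Nat.beq (runWord st (wordLen σ) σ (runWord st (wordLen σ) σ U₀)) U₀).and <|
    Nat.beq (runWord st (wordLen σ) σ (runWord st (wordLen w) w (runWord st (wordLen σ) σ
      (runWord st (wordLen w) w U₀)))) U₀

/-- Evaluate `n` before passing it to `f`. -/
noncomputable def forceNat {α : Type*} (n : ℕ) (f : ℕ → α) : α :=
  Nat.rec (f 0) (fun m _ => f (m + 1)) n

/-- The entry number `k` of the table `p` of numbers below `128`, packed into one number. -/
def lookup (p k : ℕ) : ℕ := Nat.mod (Nat.shiftRight p (Nat.mul 7 k)) 128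

/-- The image of the index `k` under the letter `i`, according to a list of packed tables. -/
def permStep (tab : List ℕ) (i k : ℕ) : ℕ := lookup (tab.getD i 0) k

/-- The set of all `f k` with `k < n`, as a bit mask, where `k` runs through the bit mask `m`,
together with `m` itself. -/
noncomputable def addImage (f : ℕ → ℕ) (m n : ℕ) : ℕ :=
  Nat.rec m (fun k ih =>
    bif Nat.beq (Nat.mod (Nat.shiftRight m k) 2) 1 then Nat.lor ih (Nat.pow 2 (f k)) else ih) n

/-- The packed table of the values of `f` below `n`. -/
noncomputable def packTable (f : ℕ → ℕ) (n : ℕ) : ℕ :=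
  Nat.rec 0 (fun k ih => Nat.add ih (Nat.mul (Nat.pow 128 k) (f k))) n

/-- Add to the bit mask `m` the images of its members under the tables `ps`, one after the other. -/
noncomputable def addImages (n : ℕ) : List ℕ → ℕ → ℕ
  | [], m => m
  | p :: ps, m => forceNat (addImage (lookup p) m n) (addImages n ps)

/-- Repeat `addImages` for `d` rounds. -/
noncomputable def closeMask (n : ℕ) (ps : List ℕ) (d : ℕ) : ℕ → ℕ :=
  Nat.rec (fun m => m) (fun _ ih m => forceNat (addImages n ps m) ih) d

/-- Pass the packed tables of the permutations given by the words in `gs` to `f`. -/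
noncomputable def withTables {α : Type*} (tab : List ℕ) (n : ℕ) :
    List ℕ → (List ℕ → α) → α
  | [], f => f []
  | g :: gs, f => forceNat (packTable (runWord (permStep tab) (wordLen g) g) n) fun p =>
    withTables tab n gs fun ps => f (p :: ps)

/-- The bit mask of the last base-`128` digits of the members of a list. -/
def digitMask : List ℕ → ℕ
  | [] => 0
  | d :: ds => Nat.lor (Nat.pow 2 (Nat.mod d 128)) (digitMask ds)

/-- The words `g` and `w` commute. -/
noncomputable def checkCommute (st : ℕ → ℕ → ℕ) (U₀ L w g : ℕ) : Bool :=
  (Nat.ble (wordLen w + wordLen g) L).and <|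
    Nat.beq (runWord st (wordLen g) g (runWord st (wordLen w) w U₀))
      (runWord st (wordLen w) w (runWord st (wordLen g) g U₀))

/-- A certificate that the products of the word `w` with the words `t` of `ts` are conjugate, up to
`neg`, to words of `ws`. It is given for some of the `t` by the entries `d` of `ds`, and follows for
all others by conjugation with `w` and the words of `gs`, which commute with `w`. -/
noncomputable def checkProducts (st : ℕ → ℕ → ℕ) (neg : ℕ → ℕ) (U₀ L : ℕ) (tab ts ws : List ℕ)
    (w d : ℕ) (gs ds : List ℕ) : Bool :=
  (ds.all fun e => (Nat.blt (Nat.mod e 128) ts.length).and <|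
    checkProduct st neg U₀ L ws w (ts.getD (Nat.mod e 128) 0) (Nat.div e 128)).and <|
  (gs.all (checkCommute st U₀ L w)).and <|
  withTables tab ts.length (w :: gs) fun ps =>
    Nat.beq (closeMask ts.length ps d (digitMask ds) + 1) (Nat.pow 2 ts.length)

/-- Certificates, consisting of an inverting involution and the data for `checkProducts`, for all
words of the second list. -/
noncomputable def checkClasses (st : ℕ → ℕ → ℕ) (neg : ℕ → ℕ) (U₀ L : ℕ) (tab ts ws : List ℕ) :
    List ℕ → List (ℕ × ℕ × List ℕ × List ℕ) → Bool
  | [], _ => true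
  | _ :: _, [] => false
  | w :: vs, (σ, d, gs, ds) :: cs => (checkInverting st U₀ L w σ).and <|
    (checkProducts st neg U₀ L tab ts ws w d gs ds).and (checkClasses st neg U₀ L tab ts ws vs cs)

/-- The tables `tab` describe the action of the letters on the words of `ts` by conjugation. -/
noncomputable def checkReflections (st : ℕ → ℕ → ℕ) (U₀ L : ℕ) (tab ts : List ℕ) : Bool :=
  (List.range ts.length).all fun k => (Nat.ble (wordLen (ts.getD k 0) + 2) L).and <|
    (List.range 8).all fun i => (Nat.blt (permStep tab i k) ts.length).and <|
      Nat.beq (st i (runWord st (wordLen (ts.getD k 0)) (ts.getD k 0) (st i U₀)))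
        (runWord st (wordLen (ts.getD (permStep tab i k) 0)) (ts.getD (permStep tab i k) 0) U₀)

theorem forceNat_eq {α : Type*} (n : ℕ) (f : ℕ → α) : forceNat n f = f n := by
  cases n <;> rfl

theorem withTables_eq {α : Type*} (tab : List ℕ) (n : ℕ) (gs : List ℕ) (f : List ℕ → α) :
    withTables tab n gs f =
      f (gs.map fun g => packTable (runWord (permStep tab) (wordLen g) g) n) := by
  induction gs generalizing f with
  | nil => rfl
  | cons g gs ih => rw [withTables, forceNat_eq, ih]; rfl

theorem lookup_eq (p k : ℕ) : lookup p k = p / 128 ^ k % 128 := by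
  have h : (128 : ℕ) ^ k = 2 ^ (7 * k) := by rw [pow_mul]; norm_num
  rw [h, ← Nat.shiftRight_eq_div_pow]
  rfl

theorem lookup_packTable {f : ℕ → ℕ} {n k : ℕ} (hf : ∀ j < n, f j < 128) (hk : k < n) :
    lookup (packTable f n) k = f k := by
  have hlt : ∀ n, (∀ j < n, f j < 128) → packTable f n < 128 ^ n := fun n => by
    induction n with
    | zero => intro _; exact Nat.one_pos
    | succ n ih =>
      intro hf
      have h1 := ih fun j hj => hf j (by omega)
      have h2 : 128 ^ n * f n ≤ 128 ^ n * 127 := Nat.mul_le_mul_left _ (by have := hf n; omega)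
      change packTable f n + 128 ^ n * f n < 128 ^ (n + 1)
      omega
  rw [lookup_eq]
  induction n with
  | zero => omega
  | succ n ih =>
    have h1 := hlt n fun j hj => hf j (by omega)
    change (packTable f n + 128 ^ n * f n) / 128 ^ k % 128 = f k
    rcases (Nat.lt_succ_iff.1 hk).eq_or_lt with rfl | hk
    · rw [Nat.add_mul_div_left _ _ (by positivity), Nat.div_eq_of_lt h1, zero_add,
        Nat.mod_eq_of_lt (hf k (by omega))]
    · obtain ⟨d, rfl⟩ := Nat.exists_eq_add_of_lt hk
      have h2 : 128 ^ (k + d + 1) * f (k + d + 1) = 128 ^ k * (128 * (128 ^ d * f (k + d + 1))) := by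
        rw [pow_succ, pow_add]; ring
      rw [h2, Nat.add_mul_div_left _ _ (by positivity), Nat.add_mul_mod_self_left]
      exact ih (fun j hj => hf j (by omega)) hk

theorem testBit_addImage {P : ℕ → Prop} {f : ℕ → ℕ} {m : ℕ} (hm : ∀ k, m.testBit k → P k) {n : ℕ}
    (hf : ∀ k < n, P k → P (f k)) : ∀ k, (addImage f m n).testBit k → P k := by
  induction n with
  | zero => exact hm
  | succ n ih =>
    intro k hk
    have ih := ih fun j hj => hf j (by omega)
    change (bif Nat.beq (m >>> n % 2) 1 then addImage f m n ||| 2 ^ f n else addImage f m n).testBit k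
      at hk
    cases hb : Nat.beq (m >>> n % 2) 1 with
    | false => rw [hb, cond_false] at hk; exact ih k hk
    | true =>
      rw [hb, cond_true, Nat.testBit_or, Bool.or_eq_true, Nat.testBit_two_pow,
        decide_eq_true_eq] at hk
      rcases hk with hk | rfl
      · exact ih k hk
      · refine hf n (by omega) (hm n ?_)
        rw [Nat.beq_eq, Nat.shiftRight_eq_div_pow] at hb
        rw [Nat.testBit_eq_decide_div_mod_eq, hb]
        rfl

theorem testBit_addImages {P : ℕ → Prop} {n : ℕ} {ps : List ℕ}
    (hps : ∀ p ∈ ps, ∀ k < n, P k → P (lookup p k)) {m : ℕ} (hm : ∀ k, m.testBit k → P k) :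
    ∀ k, (addImages n ps m).testBit k → P k := by
  induction ps generalizing m with
  | nil => exact hm
  | cons p ps ih =>
    rw [addImages, forceNat_eq]
    exact ih (fun q hq => hps q (.tail _ hq)) (testBit_addImage hm (hps p (.head _)))

theorem testBit_closeMask {P : ℕ → Prop} {n : ℕ} {ps : List ℕ}
    (hps : ∀ p ∈ ps, ∀ k < n, P k → P (lookup p k)) (d : ℕ) {m : ℕ}
    (hm : ∀ k, m.testBit k → P k) : ∀ k, (closeMask n ps d m).testBit k → P k := by
  induction d generalizing m with
  | zero => exact hm
  | succ d ih =>
    have h : closeMask n ps (d + 1) m = closeMask n ps d (addImages n ps m) := forceNat_eq _ _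
    rw [h]
    exact ih (testBit_addImages hps hm)

theorem testBit_digitMask {P : ℕ → Prop} {ds : List ℕ} (h : ∀ d ∈ ds, P (d % 128)) :
    ∀ k, (digitMask ds).testBit k → P k := by
  induction ds with
  | nil => intro k hk; simp [digitMask] at hk
  | cons d ds ih =>
    intro k hk
    change (2 ^ (d % 128) ||| digitMask ds).testBit k at hk
    rw [Nat.testBit_or, Bool.or_eq_true, Nat.testBit_two_pow, decide_eq_true_eq] at hk
    rcases hk with rfl | hk
    · exact h d (.head _)
    · exact ih (fun e he => h e (.tail _ he)) k hk

/-- The word `z` is central, and acts as `neg`. -/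
noncomputable def checkCentral (st : ℕ → ℕ → ℕ) (neg : ℕ → ℕ) (U₀ L r z : ℕ) : Bool :=
  (Nat.ble (wordLen z + 1) L).and <| (Nat.beq (runWord st (wordLen z) z U₀) (neg U₀)).and <|
    (Nat.beq (neg (neg U₀)) U₀).and <| (List.range r).all fun i =>
      Nat.beq (runWord st (wordLen z) z (st i U₀)) (st i (runWord st (wordLen z) z U₀))

/-- `Rep t U g` expresses that the state `U` represents `g`, after `t` steps, faithfully as long as
`t ≤ L`. -/
structure IsWordModel {G : Type*} [Group G] (s : ℕ → G) (st : ℕ → ℕ → ℕ) (neg : ℕ → ℕ) (U₀ L : ℕ)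
    (Rep : ℕ → ℕ → G → Prop) : Prop where
  init : Rep 0 U₀ 1
  step : ∀ t U g, ∀ i < 8, Rep t U g → Rep (t + 1) (st i U) (s i * g)
  inj : ∀ t t' U g g', t ≤ L → t' ≤ L → Rep t U g → Rep t' U g' → g = g'
  neg : ∀ t₀ z, t₀ ≤ L → Rep t₀ (neg U₀) z → ∀ t U g, Rep t U g → Rep t (neg U) (g * z)

namespace IsWordModel

variable {G : Type*} [Group G] {s : ℕ → G} {st : ℕ → ℕ → ℕ} {neg : ℕ → ℕ} {U₀ L : ℕ}
  {Rep : ℕ → ℕ → G → Prop}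

theorem runWord (h : IsWordModel s st neg U₀ L Rep) {t U : ℕ} {g : G} (n w : ℕ) (hU : Rep t U g) :
    Rep (t + n) (runWord st n w U) (wordProd s n w * g) := by
  induction n generalizing t U g w with
  | zero => simpa [wordProd, _root_.runWord] using hU
  | succ n ih =>
    have := ih (w / 8) (h.step _ _ _ (w % 8) (Nat.mod_lt _ (by norm_num)) hU)
    rw [wordProd, mul_assoc, ← add_assoc, add_right_comm]
    exact this

theorem runWordInv (h : IsWordModel s st neg U₀ L Rep) (hs : ∀ i, s i * s i = 1) {t U : ℕ} {g : G}
    (n w : ℕ) (hU : Rep t U g) :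
    Rep (t + n) (runWordInv st n w U) ((wordProd s n w)⁻¹ * g) := by
  induction n generalizing w with
  | zero => simpa [wordProd, _root_.runWordInv] using hU
  | succ n ih =>
    have := h.step _ _ _ (w % 8) (Nat.mod_lt _ (by norm_num)) (ih (w / 8))
    rw [wordProd, mul_inv_rev, inv_eq_of_mul_eq_one_left (hs _), mul_assoc, ← add_assoc]
    exact this

theorem runVal (h : IsWordModel s st neg U₀ L Rep) {t U : ℕ} {g : G} (w : ℕ) (hU : Rep t U g) :
    Rep (t + wordLen w) (_root_.runWord st (wordLen w) w U) (wordVal s w * g) :=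
  h.runWord _ _ hU

theorem runVal₀ (h : IsWordModel s st neg U₀ L Rep) (w : ℕ) :
    Rep (wordLen w) (_root_.runWord st (wordLen w) w U₀) (wordVal s w) := by
  simpa using h.runVal w h.init

theorem of_checkProduct (h : IsWordModel s st neg U₀ L Rep) (hs : ∀ i, s i * s i = 1) {t₀ : ℕ}
    {z : G} (ht₀ : t₀ ≤ L) (hz : Rep t₀ (neg U₀) z) {ws : List ℕ} {w t e : ℕ}
    (hc : checkProduct st neg U₀ L ws w t e = true) :
    ∃ y : G, ∃ v ∈ ws, y * (wordVal s w * wordVal s t) * y⁻¹ = wordVal s v ∨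
      y * (wordVal s w * wordVal s t) * y⁻¹ = wordVal s v * z := by
  simp only [checkProduct, Bool.and_eq_true, Nat.ble_eq, sameState, Bool.or_eq_true, Nat.beq_eq,
    Nat.blt_eq] at hc
  obtain ⟨h1, h2, h3, h4⟩ := hc
  have hv : ws.getD (e % 128) 0 ∈ ws := by
    have h3' : e % 128 < ws.length := h3
    rw [List.getD_eq_getElem _ _ h3']
    exact List.getElem_mem h3'
  have h5 := h.runVal (e / 128) (h.runVal w (h.runVal t
    (h.runWordInv hs (wordLen (e / 128)) (e / 128) h.init)))
  rw [zero_add] at h5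
  have h6 : wordVal s (e / 128) * (wordVal s w * (wordVal s t *
      ((wordProd s (wordLen (e / 128)) (e / 128))⁻¹ * 1))) = wordVal s (e / 128) *
        (wordVal s w * wordVal s t) * (wordVal s (e / 128))⁻¹ := by
    rw [mul_one]; simp only [mul_assoc]; rfl
  rw [h6] at h5
  refine ⟨wordVal s (e / 128), _, hv, h4.imp (fun h4 => ?_) fun h4 => ?_⟩
  · exact h.inj _ _ _ _ _ h1 h2 h5 (h4 ▸ h.runVal₀ _)
  · exact h.inj _ _ _ _ _ h1 h2 h5 (h4 ▸ h.neg _ _ ht₀ hz _ _ _ (h.runVal₀ _))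

theorem of_checkInverting (h : IsWordModel s st neg U₀ L Rep) {w σ : ℕ}
    (hc : checkInverting st U₀ L w σ = true) :
    wordVal s σ * wordVal s σ = 1 ∧
      wordVal s σ * wordVal s w * (wordVal s σ * wordVal s w) = 1 := by
  simp only [checkInverting, Bool.and_eq_true, Nat.ble_eq, Nat.beq_eq] at hc
  obtain ⟨h1, h2, h3⟩ := hc
  have h4 := h.runVal σ (h.runVal₀ σ)
  have h5 := h.runVal σ (h.runVal w (h.runVal σ (h.runVal₀ w)))
  rw [h2] at h4
  rw [h3] at h5
  exact ⟨h.inj _ _ _ _ _ (by omega) (Nat.zero_le _) h4 h.init,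
    (mul_assoc _ _ _).trans (h.inj _ _ _ _ _ h1 (Nat.zero_le _) h5 h.init)⟩

theorem of_checkReflections (h : IsWordModel s st neg U₀ L Rep) {tab ts : List ℕ}
    (hc : checkReflections st U₀ L tab ts = true) {i k : ℕ} (hi : i < 8) (hk : k < ts.length) :
    permStep tab i k < ts.length ∧ s i * wordVal s (ts.getD k 0) * s i =
      wordVal s (ts.getD (permStep tab i k) 0) := by
  simp only [checkReflections, List.all_eq_true, List.mem_range, Bool.and_eq_true, Nat.ble_eq,
    Nat.blt_eq, Nat.beq_eq] at hc
  obtain ⟨h1, h2⟩ := hc k hk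
  obtain ⟨h3, h4⟩ := h2 i hi
  refine ⟨h3, ?_⟩
  have h5 := h.step _ _ _ i hi (h.runVal (ts.getD k 0) (h.step _ _ _ i hi h.init))
  rw [h4, mul_one, ← mul_assoc] at h5
  have h6 := (hc _ h3).1
  exact h.inj _ _ _ _ _ (by omega) (by omega) h5 (h.runVal₀ _)

theorem conj_wordVal (h : IsWordModel s st neg U₀ L Rep) (hs : ∀ i, s i * s i = 1)
    {tab ts : List ℕ} (hT : checkReflections st U₀ L tab ts = true) (g : ℕ) {k : ℕ}
    (hk : k < ts.length) :
    _root_.runWord (permStep tab) (wordLen g) g k < ts.length ∧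
      wordVal s g * wordVal s (ts.getD k 0) * (wordVal s g)⁻¹ =
        wordVal s (ts.getD (_root_.runWord (permStep tab) (wordLen g) g k) 0) := by
  suffices H : ∀ n g k, k < ts.length → _root_.runWord (permStep tab) n g k < ts.length ∧
      wordProd s n g * wordVal s (ts.getD k 0) * (wordProd s n g)⁻¹ =
        wordVal s (ts.getD (_root_.runWord (permStep tab) n g k) 0) from H _ _ _ hk
  intro n
  induction n with
  | zero => intro g k hk; exact ⟨hk, by simp [wordProd, _root_.runWord]⟩
  | succ n ih =>
    intro g k hk
    obtain ⟨h1, h2⟩ := h.of_checkReflections hT (Nat.mod_lt g (by norm_num : 0 < 8)) hk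
    obtain ⟨h3, h4⟩ := ih (g / 8) _ h1
    refine ⟨h3, Eq.trans ?_ h4⟩
    rw [← h2, wordProd, mul_inv_rev, inv_eq_of_mul_eq_one_left (hs _)]
    simp only [mul_assoc]

theorem of_checkCommute (h : IsWordModel s st neg U₀ L Rep) {w g : ℕ}
    (hc : checkCommute st U₀ L w g = true) : wordVal s g * wordVal s w = wordVal s w * wordVal s g := by
  simp only [checkCommute, Bool.and_eq_true, Nat.ble_eq, Nat.beq_eq] at hc
  have h1 := h.runVal g (h.runVal₀ w)
  rw [hc.2] at h1
  exact h.inj _ _ _ _ _ hc.1 (by omega) h1 (h.runVal w (h.runVal₀ g))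

theorem of_checkProducts (h : IsWordModel s st neg U₀ L Rep) (hs : ∀ i, s i * s i = 1) {t₀ : ℕ}
    {z : G} (ht₀ : t₀ ≤ L) (hz : Rep t₀ (neg U₀) z) {tab ts ws : List ℕ}
    (hT : checkReflections st U₀ L tab ts = true) (hts : ts.length ≤ 128) {w d : ℕ} {gs ds : List ℕ}
    (hc : checkProducts st neg U₀ L tab ts ws w d gs ds = true) {k : ℕ} (hk : k < ts.length) :
    ∃ y : G, ∃ v ∈ ws, y * (wordVal s w * wordVal s (ts.getD k 0)) * y⁻¹ = wordVal s v ∨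
      y * (wordVal s w * wordVal s (ts.getD k 0)) * y⁻¹ = wordVal s v * z := by
  rw [checkProducts, withTables_eq] at hc
  simp only [Bool.and_eq_true, List.all_eq_true, Nat.blt_eq, Nat.beq_eq] at hc
  obtain ⟨h1, h2, h3⟩ := hc
  have h4 : (closeMask ts.length ((w :: gs).map fun g =>
      packTable (_root_.runWord (permStep tab) (wordLen g) g) ts.length) d
        (digitMask ds)).testBit k := by
    rw [Nat.eq_sub_of_add_eq h3]
    exact (Nat.testBit_two_pow_sub_one _ _).trans (decide_eq_true hk)
  refine testBit_closeMask (P := fun k => ∃ y : G, ∃ v ∈ ws,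
    y * (wordVal s w * wordVal s (ts.getD k 0)) * y⁻¹ = wordVal s v ∨
      y * (wordVal s w * wordVal s (ts.getD k 0)) * y⁻¹ = wordVal s v * z) (fun p hp j hj => ?_) d
    (testBit_digitMask fun e he => h.of_checkProduct hs ht₀ hz (h1 e he).2) k h4
  obtain ⟨g, hg, rfl⟩ := List.mem_map.1 hp
  rw [lookup_packTable (fun i hi => (h.conj_wordVal hs hT g hi).1.trans_le hts) hj,
    ← (h.conj_wordVal hs hT g hj).2]
  have hgw : wordVal s g * wordVal s w = wordVal s w * wordVal s g := by
    obtain rfl | hg := List.mem_cons.1 hg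
    · rfl
    · exact h.of_checkCommute (h2 g hg)
  rintro ⟨y, v, hv, hy⟩
  refine ⟨y * (wordVal s g)⁻¹, v, hv, ?_⟩
  have key : y * (wordVal s g)⁻¹ * (wordVal s w * (wordVal s g * wordVal s (ts.getD j 0) *
      (wordVal s g)⁻¹)) * (y * (wordVal s g)⁻¹)⁻¹ =
      y * (wordVal s w * wordVal s (ts.getD j 0)) * y⁻¹ := by
    have : wordVal s w * (wordVal s g * wordVal s (ts.getD j 0) * (wordVal s g)⁻¹) =
        wordVal s g * (wordVal s w * wordVal s (ts.getD j 0)) * (wordVal s g)⁻¹ := by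
      simp only [← mul_assoc]; rw [hgw]
    rw [this]; group
  rwa [key]

theorem of_checkClasses (h : IsWordModel s st neg U₀ L Rep) (hs : ∀ i, s i * s i = 1) {t₀ : ℕ}
    {z : G} (ht₀ : t₀ ≤ L) (hz : Rep t₀ (neg U₀) z)
    {tab ts ws vs : List ℕ} {cs : List (ℕ × ℕ × List ℕ × List ℕ)}
    (hT : checkReflections st U₀ L tab ts = true) (hts : ts.length ≤ 128)
    (hc : checkClasses st neg U₀ L tab ts ws vs cs = true) : ∀ w ∈ vs,
    (∃ σ : G, σ * σ = 1 ∧ σ * wordVal s w * (σ * wordVal s w) = 1) ∧ ∀ k < ts.length,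
      ∃ y : G, ∃ v ∈ ws, y * (wordVal s w * wordVal s (ts.getD k 0)) * y⁻¹ = wordVal s v ∨
        y * (wordVal s w * wordVal s (ts.getD k 0)) * y⁻¹ = wordVal s v * z := by
  induction vs generalizing cs with
  | nil => simp
  | cons w vs ih =>
    cases cs with
    | nil => simp [checkClasses] at hc
    | cons c cs =>
      obtain ⟨σ, d, gs, ds⟩ := c
      simp only [checkClasses, Bool.and_eq_true] at hc
      rintro u (_ | ⟨_, hu⟩)
      · exact ⟨⟨_, h.of_checkInverting hc.1⟩, fun k hk =>
          h.of_checkProducts hs ht₀ hz hT hts hc.2.1 hk⟩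
      · exact ih hc.2.2 u hu

theorem of_checkCentral (h : IsWordModel s st neg U₀ L Rep) {r z : ℕ} (hr : r ≤ 8)
    (hc : checkCentral st neg U₀ L r z = true) :
    wordLen z ≤ L ∧ Rep (wordLen z) (neg U₀) (wordVal s z) ∧ wordVal s z * wordVal s z = 1 ∧
      ∀ i < r, s i * wordVal s z = wordVal s z * s i := by
  simp only [checkCentral, Bool.and_eq_true, Nat.ble_eq, Nat.beq_eq, List.all_eq_true,
    List.mem_range] at hc
  obtain ⟨h1, h2, h3, h4⟩ := hc
  have h0 : wordLen z ≤ L := by omega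
  have h5 := h.runVal₀ z
  rw [h2] at h5
  refine ⟨h0, h5, ?_, fun i hi => ?_⟩
  · have h6 := h.neg _ _ h0 h5 _ _ _ h5
    rw [h3] at h6
    exact h.inj _ _ _ _ _ h0 (Nat.zero_le _) h6 h.init
  · have h6 := h.runVal z (h.step _ _ _ i (by omega) h.init)
    rw [h4 i hi, mul_one] at h6
    exact h.inj _ _ _ _ _ h1 (by omega) (h.step _ _ _ i (by omega) (h.runVal₀ z)) h6

theorem stronglyReal (h : IsWordModel s st neg U₀ L Rep) (hs : ∀ i, s i * s i = 1) {r : ℕ}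
    (hr : r ≤ 8) (hgen : Subgroup.closure (s '' Set.Iio r) = ⊤) {z : ℕ} {tab ts ws : List ℕ}
    {cs : List (ℕ × ℕ × List ℕ × List ℕ)} (hz : checkCentral st neg U₀ L r z = true)
    (hT : checkReflections st U₀ L tab ts = true) (hts : ts.length ≤ 128)
    (hTs : ∀ i < r, ∃ k < ts.length, wordVal s (ts.getD k 0) = s i)
    (h1 : ∃ w ∈ ws, wordVal s w = 1)
    (hW : checkClasses st neg U₀ L tab ts ws ws cs = true) : StronglyReal G := by
  obtain ⟨hz0, hzr, hzz, hzc⟩ := h.of_checkCentral hr hz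
  have hW := h.of_checkClasses hs hz0 hzr hT hts hW
  have hs' : ∀ i, (s i)⁻¹ = s i := fun i => inv_eq_of_mul_eq_one_left (hs i)
  have hind : ∀ P : G → Prop, P 1 → (∀ g, P g → ∀ i < r, P (g * s i)) → ∀ g, P g :=
    fun P hP1 hP g => by
      have hg : g ∈ Subgroup.closure (s '' Set.Iio r) := by rw [hgen]; trivial
      induction hg using Subgroup.closure_induction_right with
      | one => exact hP1
      | mul_right x _ y hy ih =>
        obtain ⟨i, hi, rfl⟩ := hy
        exact hP x ih i hi
      | mul_inv_cancel x _ y hy ih =>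
        obtain ⟨i, hi, rfl⟩ := hy
        rw [hs']
        exact hP x ih i hi
  have hzg : ∀ g, g * wordVal s z = wordVal s z * g := hind _ (by simp) fun g hg i hi => by
    rw [mul_assoc, hzc i hi, ← mul_assoc, hg, mul_assoc]
  have href : ∀ g, ∀ k < ts.length, ∃ j < ts.length,
      g * wordVal s (ts.getD k 0) * g⁻¹ = wordVal s (ts.getD j 0) :=
    hind _ (fun k hk => ⟨k, hk, by simp⟩) fun g hg i hi k hk => by
      obtain ⟨hv, e⟩ := h.of_checkReflections hT (hi.trans_le hr) hk
      obtain ⟨u, hu, e'⟩ := hg _ hv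
      refine ⟨u, hu, ?_⟩
      rw [← e', ← e, mul_inv_rev, hs']
      simp only [mul_assoc]
  have hcls : ∀ x, ∃ g, ∃ w ∈ ws, x = g⁻¹ * wordVal s w * g ∨
      x = g⁻¹ * (wordVal s w * wordVal s z) * g := by
    refine hind _ ?_ ?_
    · obtain ⟨w, hw, e⟩ := h1
      exact ⟨1, w, hw, .inl (by simp [e])⟩
    · rintro x ⟨g, w, hw, hx⟩ i hi
      obtain ⟨t₀, ht₀, e₀⟩ := hTs i hi
      obtain ⟨t, ht, e⟩ := href g t₀ ht₀
      rw [e₀] at e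
      obtain ⟨y, v, hv, hy⟩ := (hW w hw).2 t ht
      have key : g⁻¹ * wordVal s w * g * s i =
          (y * g)⁻¹ * (y * (wordVal s w * wordVal s (ts.getD t 0)) * y⁻¹) * (y * g) := by
        rw [← e]; group
      have key' : x * s i = (y * g)⁻¹ * (y * (wordVal s w * wordVal s (ts.getD t 0)) * y⁻¹) * (y * g) ∨
          x * s i = (y * g)⁻¹ * (y * (wordVal s w * wordVal s (ts.getD t 0)) * y⁻¹ * wordVal s z) * (y * g) := by
        refine hx.imp (fun hx => by rw [hx, key]) fun hx => ?_
        have e1 : x * s i = wordVal s z * (g⁻¹ * wordVal s w * g * s i) := by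
          rw [hx, hzg]; simp only [← mul_assoc]; rw [hzg]
        rw [e1, key, hzg]; simp only [← mul_assoc]; rw [hzg]
      refine ⟨y * g, v, hv, ?_⟩
      rcases key' with e1 | e1 <;> rcases hy with hy | hy <;> rw [hy] at e1
      · exact .inl e1
      · exact .inr e1
      · exact .inr e1
      · rw [mul_assoc _ _ (wordVal s z), hzz, mul_one] at e1
        exact .inl e1
  intro x
  obtain ⟨g, w, hw, hx⟩ := hcls x
  obtain ⟨σ, h2, h3⟩ := (hW w hw).1
  refine ⟨g⁻¹ * σ * g, ?_, ?_⟩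
  · calc g⁻¹ * σ * g * (g⁻¹ * σ * g) = g⁻¹ * (σ * σ) * g := by group
      _ = 1 := by rw [h2]; group
  · rcases hx with rfl | rfl
    · calc _ = g⁻¹ * (σ * wordVal s w * (σ * wordVal s w)) * g := by group
        _ = 1 := by rw [h3]; group
    · have e1 : σ * (wordVal s w * wordVal s z) * (σ * (wordVal s w * wordVal s z)) =
          σ * wordVal s w * (σ * wordVal s w) * (wordVal s z * wordVal s z) := by
        have := hzg (σ * wordVal s w)
        simp only [mul_assoc] at this ⊢
        rw [← mul_assoc (wordVal s z) σ, ← mul_assoc (wordVal s z * σ), mul_assoc (wordVal s z) σ,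
          ← this]
        simp only [mul_assoc]
      calc _ = g⁻¹ * (σ * (wordVal s w * wordVal s z) * (σ * (wordVal s w * wordVal s z))) * g := by
            group
        _ = 1 := by rw [e1, h3, hzz]; group

end IsWordModel

end Certificate

section Packing

/-- The offset of the coordinates of a packed vector. -/
@[irreducible] def slotHalf : ℕ := Nat.pow 2 1299

/-- The base in which the coordinates of a vector are packed into a natural number. -/
@[irreducible] def slotBase : ℕ := Nat.mul 2 slotHalf

/-- The digit number `i` of `U`. -/
def slotDigit (U i : ℕ) : ℕ := Nat.mod (Nat.div U (Nat.pow slotBase i)) slotBase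

/-- The packed neighbours of a node. -/
def packNbr (l : List ℕ) : ℕ := l.foldr (fun j a => Nat.add (Nat.pow slotBase j) a) 0

/-- The packed vector obtained by adding `(N - 2 * P) * (d - slotHalf)`. -/
def slotUpdate (U N P d : ℕ) : ℕ :=
  Nat.sub (Nat.add (Nat.add U (Nat.mul N d)) (Nat.mul slotBase P))
    (Nat.add (Nat.mul N slotHalf) (Nat.mul (Nat.mul 2 P) d))

/-- The simple reflection number `i` on packed vectors. -/
def slotStep (adj : List (List ℕ)) (i U : ℕ) : ℕ :=
  slotUpdate U (packNbr (adj.getD i [])) (Nat.pow slotBase i) (slotDigit U i)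

/-- The packed vector with all digits `a`. -/
def slotConst (m a : ℕ) : ℕ :=
  Nat.mul a (Nat.div (Nat.sub (Nat.pow slotBase m) 1) (Nat.sub slotBase 1))

/-- Negation of packed vectors. -/
def slotNeg (m U : ℕ) : ℕ := Nat.sub (slotConst m slotBase) U

/-- The simple reflection number `i` on vectors. -/
def adjAct (adj : List (List ℕ)) (i : ℕ) (c : ℕ → ℤ) (j : ℕ) : ℤ :=
  c j + (((adj.getD i []).count j : ℤ) - if j = i then 2 else 0) * c i

/-- `U` is the packed form of the first `m` coordinates of `c`. -/
def Encodes (m U : ℕ) (c : ℕ → ℤ) : Prop :=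
  (U : ℤ) = ∑ j ∈ Finset.range m, (c j + slotHalf) * (slotBase : ℤ) ^ j

/-- A list of neighbours of `m` nodes, without loops and with multiplicities at most two. -/
def IsAdj (m : ℕ) (adj : List (List ℕ)) : Prop :=
  ∀ i < m, (∀ j ∈ adj.getD i [], j < m) ∧ ∀ j < m, (adj.getD i []).count j ≤ 2 ∧
    (adj.getD i []).count i = 0

theorem slotBase_eq : slotBase = 2 * slotHalf := by
  unfold slotBase
  exact Nat.mul_eq

theorem slotHalf_eq : slotHalf = 2 ^ 1299 := by
  unfold slotHalf
  exact Nat.pow_eq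

theorem slotHalf_pos : 0 < slotHalf := by
  rw [slotHalf_eq]
  exact pow_pos two_pos _

theorem sum_digits_lt {b : ℕ} (a : ℕ → ℕ) (m : ℕ) (ha : ∀ j < m, a j < b) :
    ∑ j ∈ Finset.range m, a j * b ^ j < b ^ m := by
  induction m with
  | zero => simp
  | succ m ih =>
    rw [Finset.sum_range_succ, pow_succ]
    have h1 := ih fun j hj => ha j (by omega)
    have h2 : (a m + 1) * b ^ m ≤ b * b ^ m := Nat.mul_le_mul_right _ (ha m (by omega))
    nlinarith

theorem sum_digits_div_mod {b : ℕ} (hb : 0 < b) (a : ℕ → ℕ) (m i : ℕ) (hi : i < m)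
    (ha : ∀ j < m, a j < b) : (∑ j ∈ Finset.range m, a j * b ^ j) / b ^ i % b = a i := by
  induction m with
  | zero => omega
  | succ m ih =>
    rw [Finset.sum_range_succ]
    rcases Nat.lt_succ_iff_lt_or_eq.1 hi with h | rfl
    · obtain ⟨k, rfl⟩ := Nat.exists_eq_add_of_lt h
      rw [show a (i + k + 1) * b ^ (i + k + 1) = b ^ i * (b * (a (i + k + 1) * b ^ k)) by ring,
        Nat.add_mul_div_left _ _ (by positivity), Nat.add_mul_mod_self_left]
      exact ih h fun j hj => ha j (by omega)
    · rw [Nat.add_mul_div_right _ _ (by positivity),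
        Nat.div_eq_of_lt (sum_digits_lt a i fun j hj => ha j (by omega)), zero_add,
        Nat.mod_eq_of_lt (ha i (by omega))]

theorem Encodes.slotDigit_eq {m U : ℕ} {c : ℕ → ℤ} (h : Encodes m U c)
    (hc : ∀ j < m, |c j| < slotHalf) {i : ℕ} (hi : i < m) : (slotDigit U i : ℤ) = c i + slotHalf := by
  have hb := slotBase_eq
  have hp := slotHalf_pos
  have h0 : ∀ j < m, (((c j + slotHalf).toNat : ℕ) : ℤ) = c j + slotHalf := fun j hj => by
    have := abs_lt.1 (hc j hj)
    exact Int.toNat_of_nonneg (by omega)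
  have h1 : U = ∑ j ∈ Finset.range m, (c j + slotHalf).toNat * slotBase ^ j := by
    rw [← Nat.cast_inj (R := ℤ), h, Nat.cast_sum]
    exact Finset.sum_congr rfl fun j hj => by
      rw [Nat.cast_mul, Nat.cast_pow, h0 _ (Finset.mem_range.1 hj)]
  have h2 := sum_digits_div_mod (b := slotBase) (by omega) (fun j => (c j + slotHalf).toNat) m i hi
    fun j hj => by
      have := abs_lt.1 (hc j hj)
      have := h0 j hj
      omega
  rw [← h1] at h2
  rw [← h0 i hi, ← h2]
  rfl

theorem Encodes.ext {m U : ℕ} {c c' : ℕ → ℤ} (h : Encodes m U c) (h' : Encodes m U c')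
    (hc : ∀ j < m, |c j| < slotHalf) (hc' : ∀ j < m, |c' j| < slotHalf) :
    ∀ j < m, c j = c' j := fun j hj => by
  have h1 := h.slotDigit_eq hc hj
  have h2 := h'.slotDigit_eq hc' hj
  omega

theorem encodes_slotConst (m : ℕ) (a : ℤ) (b : ℕ) (hb : (b : ℤ) = a + slotHalf) :
    Encodes m (slotConst m b) fun _ => a := by
  have h2 : 2 ≤ slotBase := by rw [slotBase_eq]; have := slotHalf_pos; omega
  have h1 : slotConst m b = b * ∑ j ∈ Finset.range m, slotBase ^ j := by
    rw [Nat.geomSum_eq h2]; rfl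
  rw [Encodes, h1, Finset.mul_sum]
  push_cast
  rw [hb]

theorem Encodes.neg {m U : ℕ} {c : ℕ → ℤ} (h : Encodes m U c)
    (hc : ∀ j < m, |c j| < slotHalf) : Encodes m (slotNeg m U) fun j => -c j := by
  have h1 := encodes_slotConst m slotHalf slotBase (by rw [slotBase_eq]; push_cast; ring)
  have h2 : (slotConst m slotBase : ℤ) - U =
      ∑ j ∈ Finset.range m, (-c j + slotHalf) * (slotBase : ℤ) ^ j := by
    rw [h, h1, ← Finset.sum_sub_distrib]
    exact Finset.sum_congr rfl fun j _ => by ring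
  have h3 : (0 : ℤ) ≤ ∑ j ∈ Finset.range m, (-c j + slotHalf) * (slotBase : ℤ) ^ j :=
    Finset.sum_nonneg fun j hj => mul_nonneg (by
      have := abs_lt.1 (hc j (Finset.mem_range.1 hj)); omega) (by positivity)
  rw [Encodes, ← h2, slotNeg, Nat.sub_eq, Int.ofNat_sub (by omega)]

theorem packNbr_eq (m : ℕ) (l : List ℕ) (hl : ∀ j ∈ l, j < m) :
    (packNbr l : ℤ) = ∑ j ∈ Finset.range m, (l.count j : ℤ) * (slotBase : ℤ) ^ j := by
  induction l with
  | nil => simp [packNbr]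
  | cons i l ih =>
    rw [packNbr, List.foldr_cons, Nat.add_eq, Nat.pow_eq, ← packNbr]
    push_cast
    rw [ih fun j hj => hl j (.tail _ hj)]
    simp only [List.count_cons, beq_iff_eq, Nat.cast_add, add_mul, Finset.sum_add_distrib]
    rw [add_comm]
    congr 1
    simp only [Nat.cast_ite, Nat.cast_one, Nat.cast_zero, ite_mul, one_mul, zero_mul]
    rw [Finset.sum_ite_eq, if_pos (Finset.mem_range.2 (hl i (.head _)))]

theorem abs_adjAct_le {m : ℕ} {adj : List (List ℕ)} (hadj : IsAdj m adj) {i : ℕ} (hi : i < m)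
    {c : ℕ → ℤ} {b : ℤ} (hc : ∀ j < m, |c j| ≤ b) : ∀ j < m, |adjAct adj i c j| ≤ 4 * b := by
  intro j hj
  obtain ⟨h1, h2⟩ := (hadj i hi).2 j hj
  have h3 := hc j hj
  have h4 := hc i hi
  have hb : 0 ≤ b := (abs_nonneg _).trans h3
  rw [adjAct]
  split_ifs with hji
  · subst hji
    rw [h2]
    rw [show c j + (((0 : ℕ) : ℤ) - 2) * c j = -c j by push_cast; ring, abs_neg]
    linarith
  · rw [sub_zero]
    refine (abs_add_le _ _).trans ?_
    rw [abs_mul, Nat.abs_cast]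
    have h5 : (((adj.getD i []).count j : ℕ) : ℤ) ≤ 2 := by exact_mod_cast h1
    nlinarith [abs_nonneg (c i)]

theorem Encodes.slotStep {m U : ℕ} {c : ℕ → ℤ} (h : Encodes m U c) {adj : List (List ℕ)}
    (hadj : IsAdj m adj) {i : ℕ} (hi : i < m) (hc : ∀ j < m, |c j| < slotHalf)
    (hc' : ∀ j < m, |adjAct adj i c j| < slotHalf) :
    Encodes m (slotStep adj i U) (adjAct adj i c) := by
  have h1 := h.slotDigit_eq hc hi
  have h2 := packNbr_eq m (adj.getD i []) (hadj i hi).1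
  set N := packNbr (adj.getD i [])
  set d := slotDigit U i
  have h3 : ∑ j ∈ Finset.range m, (adjAct adj i c j + slotHalf) * (slotBase : ℤ) ^ j =
      U + (N - 2 * (slotBase : ℤ) ^ i) * (d - slotHalf) := by
    rw [h, h2, h1, add_sub_cancel_right, sub_mul, Finset.sum_mul, ← sub_eq_zero]
    have h4 : (2 * (slotBase : ℤ) ^ i) * c i =
        ∑ j ∈ Finset.range m, (if j = i then 2 * c i * (slotBase : ℤ) ^ j else 0) := by
      rw [Finset.sum_ite_eq' , if_pos (Finset.mem_range.2 hi)]; ring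
    rw [h4, ← Finset.sum_sub_distrib, ← Finset.sum_add_distrib, ← Finset.sum_sub_distrib]
    refine Finset.sum_eq_zero fun j _ => ?_
    rw [adjAct]
    split_ifs <;> ring
  have h5 : (0 : ℤ) ≤ ∑ j ∈ Finset.range m, (adjAct adj i c j + slotHalf) * (slotBase : ℤ) ^ j :=
    Finset.sum_nonneg fun j hj => mul_nonneg (by
      have := abs_lt.1 (hc' j (Finset.mem_range.1 hj)); omega) (by positivity)
  have h6 : (slotBase : ℤ) = 2 * slotHalf := by rw [slotBase_eq]; push_cast; ring
  have h7 : ((U + N * d + slotBase * slotBase ^ i : ℕ) : ℤ) -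
      ((N * slotHalf + 2 * slotBase ^ i * d : ℕ) : ℤ) =
        U + (N - 2 * (slotBase : ℤ) ^ i) * (d - slotHalf) := by
    push_cast
    linear_combination (slotBase : ℤ) ^ i * h6
  rw [← h7] at h3
  rw [h3] at h5
  rw [Encodes, h3, _root_.slotStep, slotUpdate]
  simp only [Nat.sub_eq, Nat.add_eq, Nat.mul_eq, Nat.pow_eq]
  exact Int.ofNat_sub (Nat.cast_le.1 (sub_nonneg.1 h5))

end Packing

section SlotModel

theorem wordVal_one {G : Type*} [Group G] (s : ℕ → G) : wordVal s 1 = 1 := by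
  have h : wordLen 1 = 0 := by decide
  rw [wordVal, h, wordProd]

theorem wordVal_letter {G : Type*} [Group G] (s : ℕ → G) {i : ℕ} (hi : i < 8) :
    wordVal s (8 + i) = s i := by
  have h : ∀ i < 8, wordLen (8 + i) = 1 := by decide
  rw [wordVal, h i hi, wordProd, wordProd, one_mul, Nat.add_mod_left, Nat.mod_eq_of_lt hi]

theorem pow_lt_slotHalf {t : ℕ} (ht : t ≤ 300) : (16 : ℤ) ^ t < slotHalf := by
  have h : (16 : ℕ) ^ t < slotHalf := by
    rw [slotHalf_eq, show 16 = 2 ^ 4 by norm_num, ← pow_mul]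
    exact Nat.pow_lt_pow_right (by norm_num) (by omega)
  exact_mod_cast h

/-- The initial state, with coordinates one at the nodes in `l` and zero elsewhere. -/
def slotInit (m : ℕ) (l : List ℕ) : ℕ := Nat.add (slotConst m slotHalf) (packNbr l)

theorem encodes_slotInit {m : ℕ} {l : List ℕ} (hl : ∀ j ∈ l, j < m) :
    Encodes m (slotInit m l) fun j => l.count j := by
  have h := encodes_slotConst m 0 slotHalf (by simp)
  rw [Encodes] at h ⊢
  rw [slotInit, Nat.add_eq, Nat.cast_add, h, packNbr_eq m l hl, ← Finset.sum_add_distrib]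
  exact Finset.sum_congr rfl fun j _ => by ring

theorem abs_count_le {l : List ℕ} (hl : l.Nodup) (j : ℕ) : |(l.count j : ℤ)| ≤ 1 := by
  rw [Nat.abs_cast]
  exact_mod_cast List.nodup_iff_count_le_one.1 hl j

variable {B W : Type*} {M : CoxeterMatrix B} [Group W]

/-- The packed vector `U`, reached after at most `t` steps, gives the coordinates of the image under
`g` of the vector with coordinates one at the nodes in `l`. -/
def SlotRep (cs : CoxeterSystem M W) (m : ℕ) (l : List ℕ) (Lin : (ℕ → ℤ) → B → ℝ)
    (t U : ℕ) (g : W) : Prop :=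
  t ≤ 300 → ∃ c : ℕ → ℤ, Encodes m U c ∧ (∀ j < m, |c j| ≤ 16 ^ t) ∧
    cs.dualRep g (Lin fun j => l.count j) = Lin c

variable {cs : CoxeterSystem M W} {m : ℕ} {l : List ℕ} {s : ℕ → W} {st : ℕ → ℕ → ℕ}
  {A : ℕ → (ℕ → ℤ) → ℕ → ℤ} {Lin : (ℕ → ℤ) → B → ℝ}

theorem isWordModel_id_of_slots (hl : ∀ j ∈ l, j < m) (hl' : l.Nodup)
    (hst : ∀ i < 8, ∀ U c, ∀ b : ℤ, 16 * b < slotHalf → Encodes m U c → (∀ j < m, |c j| ≤ b) →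
      Encodes m (st i U) (A i c) ∧ ∀ j < m, |A i c j| ≤ 16 * b)
    (hcongr : ∀ c c', (∀ j < m, c j = c' j) → Lin c = Lin c')
    (hpos : ∀ b, 0 < Lin (fun j => l.count j) b)
    (hLin : ∀ i < 8, ∀ c, cs.dualRep (s i) (Lin c) = Lin (A i c)) :
    IsWordModel s st id (slotInit m l) 300 (SlotRep cs m l Lin) := by
  have init : SlotRep cs m l Lin 0 (slotInit m l) 1 := fun _ =>
    ⟨_, encodes_slotInit hl, fun j _ => abs_count_le hl' j, by rw [map_one]; rfl⟩
  have inj : ∀ t t' U g g', t ≤ 300 → t' ≤ 300 → SlotRep cs m l Lin t U g →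
      SlotRep cs m l Lin t' U g' → g = g' := by
    intro t t' U g g' ht ht' h h'
    obtain ⟨c, h1, h2, h3⟩ := h ht
    obtain ⟨c', h1', h2', h3'⟩ := h' ht'
    refine cs.eq_of_dualRep_eq hpos ?_
    rw [h3, h3']
    exact hcongr _ _ (h1.ext h1' (fun j hj => (h2 j hj).trans_lt (pow_lt_slotHalf ht))
      fun j hj => (h2' j hj).trans_lt (pow_lt_slotHalf ht'))
  refine ⟨init, fun t U g i hi h ht => ?_, inj, fun t₀ z ht₀ hz t U g h => ?_⟩
  · obtain ⟨c, h1, h2, h3⟩ := h (by omega)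
    obtain ⟨h4, h5⟩ := hst i hi U c (16 ^ t) (by
      rw [← pow_succ']; exact pow_lt_slotHalf ht) h1 h2
    refine ⟨A i c, h4, by rwa [pow_succ'], ?_⟩
    rw [map_mul, Module.End.mul_apply, h3, hLin i hi]
  · rw [inj _ _ _ _ _ ht₀ (Nat.zero_le _) hz init, mul_one]
    exact h

theorem isWordModel_slotNeg_of_slots (hl : ∀ j ∈ l, j < m) (hl' : l.Nodup)
    (h : IsWordModel s st id (slotInit m l) 300 (SlotRep cs m l Lin))
    (hcongr : ∀ c c', (∀ j < m, c j = c' j) → Lin c = Lin c')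
    (hneg : ∀ c, Lin (fun j => -c j) = -Lin c) :
    IsWordModel s st (slotNeg m) (slotInit m l) 300 (SlotRep cs m l Lin) := by
  refine ⟨h.init, h.step, h.inj, fun t₀ z ht₀ hz t U g hU ht => ?_⟩
  obtain ⟨c, h1, h2, h3⟩ := hU ht
  obtain ⟨c', h1', h2', h3'⟩ := hz ht₀
  have h4 : cs.dualRep z (Lin fun j => l.count j) = -Lin fun j => l.count j := by
    rw [h3', ← hneg]
    have h0 : ∀ j, |(l.count j : ℤ)| < slotHalf := fun j =>
      (abs_count_le hl' j).trans_lt (pow_lt_slotHalf (Nat.zero_le 300))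
    have h5 := (encodes_slotInit hl).neg fun j _ => h0 j
    exact hcongr _ _ (h1'.ext h5 (fun j hj => (h2' j hj).trans_lt (pow_lt_slotHalf ht₀))
      fun j _ => by rw [abs_neg]; exact h0 j)
  refine ⟨_, h1.neg fun j hj => (h2 j hj).trans_lt (pow_lt_slotHalf ht), by simpa using h2, ?_⟩
  rw [map_mul, Module.End.mul_apply, h4, map_neg, h3, hneg]

end SlotModel

namespace CoxeterMatrix

variable {n : ℕ} (M : CoxeterMatrix (Fin n))

/-- The simple reflection number `i` of a Coxeter group with generators numbered by `Fin n`. -/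
def letter (i : ℕ) : M.Group := if h : i < n then M.simple ⟨i, h⟩ else 1

theorem letter_mul_self (i : ℕ) : M.letter i * M.letter i = 1 := by
  unfold letter
  split_ifs
  · exact M.toCoxeterSystem.simple_mul_simple_self _
  · exact one_mul 1

theorem closure_letter : Subgroup.closure (M.letter '' Set.Iio n) = ⊤ := by
  rw [← M.toCoxeterSystem.subgroup_closure_range_simple]
  congr 1
  ext g
  constructor
  · rintro ⟨i, hi, rfl⟩
    have hi : i < n := hi
    exact ⟨⟨i, hi⟩, by rw [letter, dif_pos hi]; rfl⟩
  · rintro ⟨i, rfl⟩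
    exact ⟨i, i.2, by rw [letter, dif_pos i.2]; rfl⟩

theorem dualRep_letter (i : ℕ) (c : Fin n → ℝ) :
    M.toCoxeterSystem.dualRep (M.letter i) c =
      if h : i < n then fun j => c j - M.gram ⟨i, h⟩ j * c ⟨i, h⟩ else c := by
  unfold letter
  split_ifs with h
  · have := M.toCoxeterSystem.dualRep_simple ⟨i, h⟩
    change M.toCoxeterSystem.dualRep (M.toCoxeterSystem.simple ⟨i, h⟩) c = _
    rw [this]
    ext j
    exact M.refl_apply _ _ _
  · rw [map_one]; rfl

theorem isWordModel_of_adj (hn : n ≤ 8) {adj : List (List ℕ)} (hadj : IsAdj 8 adj)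
    (hnil : ∀ i < 8, n ≤ i → adj.getD i [] = []) {κ : Fin n → ℝ} (hκ : ∀ i, 0 < κ i)
    {l : List ℕ} (hl : ∀ j ∈ l, j < 8) (hl' : l.Nodup)
    (hb : ∀ b < n, l.count b = 1)
    (h : ∀ i j : Fin n, M.gram i j * κ i =
      ((if (j : ℕ) = i then 2 else 0) - ((adj.getD i []).count (j : ℕ) : ℝ)) * κ j) :
    ∃ Rep, IsWordModel M.letter (slotStep adj) id (slotInit 8 l) 300 Rep ∧
      IsWordModel M.letter (slotStep adj) (slotNeg 8) (slotInit 8 l) 300 Rep := by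
  set Lin : (ℕ → ℤ) → Fin n → ℝ := fun c j => κ j * c j with hLin
  have hcongr : ∀ c c' : ℕ → ℤ, (∀ j < 8, c j = c' j) → Lin c = Lin c' := fun c c' h => by
    ext j
    rw [hLin]
    simp only [h j (j.2.trans_le hn)]
  refine ⟨SlotRep M.toCoxeterSystem 8 l Lin, ?_⟩
  suffices h' : _ from ⟨h', isWordModel_slotNeg_of_slots hl hl' h' hcongr fun c => by
    ext j; simp [hLin]⟩
  refine isWordModel_id_of_slots hl hl' (A := adjAct adj) (fun i hi U c b hb₀ hU hc => ?_) hcongr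
    (fun b => by simpa [hLin, hb b b.2] using hκ b) fun i hi c => ?_
  · have h1 := abs_adjAct_le hadj hi hc
    have h0 := (abs_nonneg _).trans (hc i hi)
    exact ⟨hU.slotStep hadj hi (fun j hj => (hc j hj).trans_lt (by linarith))
      fun j hj => (h1 j hj).trans_lt (by linarith), fun j hj => (h1 j hj).trans (by linarith)⟩
  · rw [dualRep_letter]
    split_ifs with hin
    · ext j
      have h1 := h ⟨i, hin⟩ j
      simp only [hLin, adjAct] at h1 ⊢
      push_cast
      linear_combination -(c i : ℝ) * h1
    · ext j
      have : (j : ℕ) ≠ i := fun e => hin (e ▸ j.2)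
      simp only [hLin, adjAct, hnil i hi (by omega), this]
      simp

theorem isWordModel_of_adj_double (hn : n ≤ 8) {adj : List (List ℕ)} (hadj : IsAdj 16 adj)
    (hnil : ∀ i < 8, n ≤ i → adj.getD i [] = [] ∧ adj.getD (8 + i) [] = []) {φ : ℝ} (hφ : 0 < φ)
    {l : List ℕ} (hl : ∀ j ∈ l, j < 16) (hl' : l.Nodup)
    (hb : ∀ b < n, l.count b = 1 ∧ l.count (8 + b) = 1)
    (h : ∀ i j : Fin n, ∀ a b : ℝ, M.gram i j * (a + φ * b) =
      (if (j : ℕ) = i then 2 else 0) * (a + φ * b) -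
      (((adj.getD i []).count (j : ℕ) + φ * (adj.getD i []).count (8 + j : ℕ)) * a +
      ((adj.getD (8 + i) []).count (j : ℕ) + φ * (adj.getD (8 + i) []).count (8 + j : ℕ)) * b))
    (h0 : ∀ i < 8, (adj.getD i []).count (8 + i) = 0) :
    ∃ Rep, IsWordModel M.letter (fun i U => slotStep adj (Nat.add 8 i) (slotStep adj i U))
      (slotNeg 16) (slotInit 16 l) 300 Rep := by
  set Lin : (ℕ → ℤ) → Fin n → ℝ := fun c j => c j + φ * c (8 + j) with hLin
  have hcongr : ∀ c c' : ℕ → ℤ, (∀ j < 16, c j = c' j) → Lin c = Lin c' := fun c c' h => by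
    ext j
    rw [hLin]
    simp only [h j (by omega), h (8 + j) (by omega)]
  refine ⟨SlotRep M.toCoxeterSystem 16 l Lin, isWordModel_slotNeg_of_slots hl hl'
    (isWordModel_id_of_slots hl hl' (A := fun i c => adjAct adj (8 + i) (adjAct adj i c))
      (fun i hi U c b hb₀ hU hc => ?_) hcongr (fun b => ?_) fun i hi c => ?_) hcongr fun c => ?_⟩
  · have h1 := abs_adjAct_le hadj (by omega) hc (i := i)
    have h2 := abs_adjAct_le hadj (by omega) h1 (i := 8 + i)
    have h3 := (abs_nonneg _).trans (hc i (by omega))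
    change Encodes 16 (slotStep adj (8 + i) _) _ ∧ _
    refine ⟨(hU.slotStep hadj (by omega) (fun j hj => (hc j hj).trans_lt (by linarith))
      fun j hj => (h1 j hj).trans_lt (by linarith)).slotStep hadj (by omega)
      (fun j hj => (h1 j hj).trans_lt (by linarith))
      fun j hj => (h2 j hj).trans_lt (by linarith), fun j hj => (h2 j hj).trans (by linarith)⟩
  · obtain ⟨h1, h2⟩ := hb b b.2
    simp only [hLin, h1, h2, Nat.cast_one, Int.cast_one, mul_one]
    linarith
  · rw [dualRep_letter]
    split_ifs with hin
    · ext j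
      have h1 := h ⟨i, hin⟩ j (c i) (c (8 + i))
      have h2 := h0 i hi
      have h3 : (8 + (j : ℕ) = 8 + i) = ((j : ℕ) = i) := by simp
      have h4 : (8 + (j : ℕ) = i) = False := by simp; omega
      have h5 : ((j : ℕ) = 8 + i) = False := by simp; omega
      have h6 : (8 + i = i) = False := by simp
      simp only [hLin, adjAct, h2, h3, h4, h5, h6, if_false] at h1 ⊢
      push_cast
      split_ifs at h1 ⊢ <;> linear_combination -h1
    · ext j
      have : (j : ℕ) ≠ i := fun e => hin (e ▸ j.2)
      have h4 : 8 + (j : ℕ) ≠ i := by omega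
      have h5 : (j : ℕ) ≠ 8 + i := by omega
      obtain ⟨h1, h2⟩ := hnil i hi (by omega)
      simp only [hLin, adjAct, h1, h2, this, h4, h5]
      simp [this]
  · ext j
    simp [hLin]
    ring

theorem stronglyReal_of_certificate {st : ℕ → ℕ → ℕ} {neg : ℕ → ℕ} {U₀ L : ℕ}
    {Rep : ℕ → ℕ → M.Group → Prop} (h : IsWordModel M.letter st neg U₀ L Rep) (hn : n ≤ 8) {z : ℕ}
    {tab ts ws : List ℕ} {cs : List (ℕ × ℕ × List ℕ × List ℕ)}
    (hz : checkCentral st neg U₀ L n z = true) (hT : checkReflections st U₀ L tab ts = true)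
    (hts : ts.length ≤ 128) (hTs : ∀ i < n, i < ts.length ∧ ts.getD i 0 = 8 + i) (h1 : 1 ∈ ws)
    (hW : checkClasses st neg U₀ L tab ts ws ws cs = true) : StronglyReal M.Group :=
  h.stronglyReal M.letter_mul_self hn M.closure_letter hz hT hts
    (fun i hi => ⟨i, (hTs i hi).1, by rw [(hTs i hi).2]; exact wordVal_letter _ (hi.trans_le hn)⟩)
    ⟨1, h1, wordVal_one _⟩ hW

end CoxeterMatrix

/-- The neighbours of the nodes in type `F4`. -/
def f4Adj : List (List ℕ) :=
  [[1], [0, 2], [1, 1, 3], [2]]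

/-- Words for the reflections of type `F4`. -/
def f4Reflections : List ℕ := [
  8, 9, 10, 11, 577, 650, 593, 723, 41482, 46163, 33416, 45707, 2429009, 2953299, 2888771, 2724954,
  187204235, 174105114, 11161310298, 9982775505, 639046296273, 698337494666, 35898695947912,
  49567165068371]

/-- The action of the letters on the reflections of type `F4`, as packed tables. -/
def f4Conjugates : List ℕ := [
  67689571976038445242506166557133999538229173322240,
  67735238305413448825504000393303367465724322873476,
  67734884324295985480999755818980037833547373904512,
  61889591377212759336887064260337064836588789416064,
  67735241114613215290198926539281783300465167990912,
  67735241114613215290198926539281783300465167990912,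
  67735241114613215290198926539281783300465167990912,
  67735241114613215290198926539281783300465167990912]

/-- Words for the conjugacy classes of type `F4`, up to sign. -/
def f4Classes : List ℕ := [
  1, 8, 10, 65, 66, 74, 4746, 83, 522, 33418, 531, 38538, 4179, 267354, 17110225, 71006228619]

/-- Certificates for the classes of type `F4`. -/
def f4Certificates : List (ℕ × ℕ × List ℕ × List ℕ) := [
  (1, 5, [4186, 8], [16512, 16642]),
  (1, 2, [151553114, 66], [16384, 16769, 16898, 1065606, 1065740]),
  (1, 2, [275539, 593], [16896, 17029, 16386, 17283, 17158]),
  (8, 2, [19432531], [16513, 17410, 9470999, 17541]),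
  (1, 1, [17048081], [16640, 17413, 16514, 17667, 17542, 288905937942, 2483048170767, 38874169612,
  68470160, 9715863]),
  (9, 2, [33416, 46163], [17416, 16645, 1179778, 75810067, 10667401, 1180810]),
  (1, 1, [2131010, 341075], [17548, 1179781, 16646, 17807, 75808918, 1179927]),
  (10, 2, [19441288], [17664, 38797591826, 16643, 165254]),
  (66, 5, [], [17032, 16770, 17923, 16901, 181897, 18187, 8667543]),
  (8, 3, [10], [17164, 16773, 1065602, 18055, 16902, 1360278, 18320, 8520343]),
  (10, 5, [], [17280, 17929, 16899, 1099409, 38797591442, 70533781, 1083156]),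
  (11, 3, [9], [1214100, 9863809, 1229698, 17167, 94503429, 9487255, 18321, 1475222]),
  (4250, 5, [], [318391878912, 17411, 17673, 70534165]),
  (4250, 3, [], [8816000, 181253, 310380774673, 1360918, 17543, 165135]),
  (67, 3, [83, 266378], [165142, 17419]),
  (75, 4, [4235, 4177], [17552, 17809])]

theorem f4_checkCentral :
    checkCentral (slotStep f4Adj) (slotNeg 8) (slotInit 8 [0, 1, 2, 3]) 300 4
      4798608287169813972051 = true := by
  decide +kernel

theorem f4_checkReflections :
    checkReflections (slotStep f4Adj) (slotInit 8 [0, 1, 2, 3]) 300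
      f4Conjugates f4Reflections = true := by
  decide +kernel

theorem f4_checkClasses :
    checkClasses (slotStep f4Adj) (slotNeg 8) (slotInit 8 [0, 1, 2, 3]) 300
      f4Conjugates f4Reflections f4Classes f4Classes f4Certificates = true := by
  decide +kernel

/-- The neighbours of the nodes in type `H3`. -/
def h3Adj : List (List ℕ) :=
  [[9], [8, 2], [1], [], [], [], [], [], [1, 9], [0, 8, 10], [9]]

/-- Words for the reflections of type `H3`. -/
def h3Reflections : List ℕ := [
  8, 9, 10, 577, 520, 650, 33288, 41482, 41026, 2625602, 2425361, 155222545, 136843400, 8757973128,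
  619819598913]

/-- The action of the letters on the reflections of type `H3`, as packed tables. -/
def h3Conjugates : List ℕ := [
  4464207188530704906582591832576, 4154760255187563870218088431747,
  4466740642511544411948452971136, 4469197329740097754771438469248,
  4469197329740097754771438469248, 4469197329740097754771438469248,
  4469197329740097754771438469248, 4469197329740097754771438469248]

/-- Words for the conjugacy classes of type `H3`, up to sign. -/
def h3Classes : List ℕ := [
  1, 8, 65, 4161, 74]

/-- Certificates for the classes of type `H3`. -/
def h3Certificates : List (ℕ × ℕ × List ℕ × List ℕ) := [
  (1, 4, [65, 66], [16512]),
  (1, 1, [66], [16384, 16641, 4849680514, 16771, 68174346, 4840505486]),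
  (8, 4, [], [16513, 164236, 147981]),
  (8, 4, [], [16515, 8552968, 164109]),
  (10, 2, [], [10617219, 75628674, 8520202, 547488262, 164108])]

theorem h3_checkCentral :
    checkCentral (fun i U => slotStep h3Adj (Nat.add 8 i) (slotStep h3Adj i U)) (slotNeg 16) (slotInit 16 [0, 1, 2, 8, 9, 10]) 300 3
      35743003320842 = true := by
  decide +kernel

theorem h3_checkReflections :
    checkReflections (fun i U => slotStep h3Adj (Nat.add 8 i) (slotStep h3Adj i U)) (slotInit 16 [0, 1, 2, 8, 9, 10]) 300
      h3Conjugates h3Reflections = true := by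
  decide +kernel

theorem h3_checkClasses :
    checkClasses (fun i U => slotStep h3Adj (Nat.add 8 i) (slotStep h3Adj i U)) (slotNeg 16) (slotInit 16 [0, 1, 2, 8, 9, 10]) 300
      h3Conjugates h3Reflections h3Classes h3Classes h3Certificates = true := by
  decide +kernel

/-- The neighbours of the nodes in type `H4`. -/
def h4Adj : List (List ℕ) :=
  [[9], [8, 2], [1, 3], [2], [], [], [], [], [1, 9], [0, 8, 10], [9, 11], [10]]

/-- Words for the reflections of type `H4`. -/
def h4Reflections : List ℕ := [
  8, 9, 10, 11, 577, 520, 650, 723, 33288, 41482, 41026, 46163, 2625602, 2953299, 2425361, 2949651,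
  155222545, 188776979, 136843400, 187175051, 8757973128, 11979198603, 11832165443, 11161076826,
  619819598913, 757258552387, 714308879450, 713132614170, 48939021902347, 45640487019034,
  40889433002193, 2924786965614682, 2616923709837521, 2297440300992136, 167513483800773329,
  147036179245074056, 162494710483792961, 9410558402654115464, 10399661470815368257,
  11676251225331966474, 665580277579938575425, 747280078420066804234, 831279772751037796435,
  38381207600727025099272, 47825940566466315526666, 53201905456056986570835,
  3027132754938731843883074, 3404922073568303460978771, 178959566950182389113455121,
  217645193177850522704052755, 10097256810599121037201510536, 13811076928455261861898883211,
  873059679627436344233051587651, 823542078056021133237086618714, 52619899045235749207745728094746,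
  3017107621629299807927213989368017, 169521173012009572062271609133106824,
  11989993350375403559728629355307611201, 861555272375114771270421901563939365386,
  61337620886351072324303312401594428756051]

/-- The action of the letters on the reflections of type `H4`, as packed tables. -/
def h4Conjugates : List ℕ := [
  1257733133971136823821187811992229315268410476818884962530320462509849626831160813457115095542042561447030285357401099470930560,
  1257731862863643467714352191163822408077693801541352397745456147542646375833248161710365804526670473561835966569204298759110788,
  1257569171111357906245729501849127578267435881263759880350655099146401349919300967215002179339408924660091783806357917713597184,
  1236744616970766812478474959104453616075058069851657952001007323797486702603278307403408339708650235480048430881466609295278208,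
  1257733143979857281524730727382547492224905120962945346235407751200086439197238086277500945170832969189913582030695120695754880,
  1257733143979857281524730727382547492224905120962945346235407751200086439197238086277500945170832969189913582030695120695754880,
  1257733143979857281524730727382547492224905120962945346235407751200086439197238086277500945170832969189913582030695120695754880,
  1257733143979857281524730727382547492224905120962945346235407751200086439197238086277500945170832969189913582030695120695754880]

/-- Words for the conjugacy classes of type `H4`, up to sign. -/
def h4Classes : List ℕ := [
  1, 8, 65, 66, 4161, 74, 522, 523, 33297, 602, 4179, 266379, 70078772289, 21247041, 1210126426,
  340757631370889565900866, 4826275860128347726346, 22805666595091521, 1171226751995547738,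
  1263105606512456763978392074]

/-- Certificates for the classes of type `H4`. -/
def h4Certificates : List (ℕ × ℕ × List ℕ × List ℕ) := [
  (1, 11, [4186, 8], [16512]),
  (1, 2, [83, 66], [16384, 16641, 16770, 16900, 68174478, 4849680792, 729731058862407966,
  10472028058599844, 9190302855217835, 729731058862408240, 5030704257548549647345140407,
  4840505787]),
  (8, 3, [9949159946, 11], [16513, 17154, 17283, 164873]),
  (1, 1, [8], [4840505472, 17158, 16514, 50146736523032330822072157187, 1065988, 1360779,
  5583312960397749481585689361, 6268320562816466907351237522, 6494336087108141846, 4363437205,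
  1365065555790593927725208, 22279137575839, 729731058862408606, 43387824234527245349,
  6268773900119364926111499300, 12243445892253798847759273, 2398806460641104118952,
  87536184429765955838821162, 12582783613538244539630641, 698043723335032986598032178,
  6268325864968361977275663285, 10164931974308986190218295, 11373857794044317832332089,
  4849680571]),
  (8, 3, [8875418122, 11], [16516, 17414, 605061947, 46702787767194518456]),
  (10, 2, [2953299], [17161, 75628674, 17543, 132101, 164880, 97942844771547521136854029,
  5837828448760923050, 22214566003992808260382, 9150720436618401, 3325100072514227405865,
  154440827524342874244133, 585767376345138356, 4437705787, 2783837291449]),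
  (66, 9, [], [17033, 16642, 17667, 16774, 1361293, 17939, 545572501, 547538745, 18355, 554713659]),
  (8, 9, [], [11813256, 17671, 16643, 1083020, 9864986, 46702787767194518059, 18471, 2242518616233,
  2243726312120, 196605993963421047359418]),
  (8, 5, [], [1180032, 131713, 164100, 17795, 148110, 16902, 9488019, 1230605, 9750293,
  17881091065771, 18719, 4842505528, 182454, 4363158203]),
  (10, 3, [], [1099008, 17031, 6048317826, 1099141, 165271, 10913425, 132891, 547489567,
  47999510244975839134, 332771121882867041583, 310990997667, 68176037, 585613984810533555, 18864,
  2243726280626, 554714811]),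
  (4250, 14, [], [1098880, 17155, 5051008058, 17287]),
  (67, 9, [], [333924043387473921078, 1098881, 1475332, 17411, 165011, 10592730524058427]),
  (66, 4, [17043610, 4235], [17171]),
  (4625, 14, [], [564265742, 1213576, 1082244, 9716755]),
  (4625, 5, [], [147919228420870, 547488922, 6494336079129379891, 631374649, 11813898,
  304959456598941811627, 598152201728295994, 1229833, 10666892, 132247]),
  (66, 4, [266321], [2233938117793, 20389351965751, 191294618694436731011986, 17203]),
  (67, 7, [19505674, 65], [17319]),
  (331866, 9, [], [24773926110238, 2272132203411, 279242261656, 178169270272949, 75629736, 181302]),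
  (4625, 5, [295633, 267331], [17439]),
  (75, 5, [1359225370, 266376], [17584])]

theorem h4_checkCentral :
    checkCentral (fun i U => slotStep h4Adj (Nat.add 8 i) (slotStep h4Adj i U)) (slotNeg 16) (slotInit 16 [0, 1, 2, 3, 8, 9, 10, 11]) 300 4
      1556827362672539948171506431330233574182756909857181779 = true := by
  decide +kernel

theorem h4_checkReflections :
    checkReflections (fun i U => slotStep h4Adj (Nat.add 8 i) (slotStep h4Adj i U)) (slotInit 16 [0, 1, 2, 3, 8, 9, 10, 11]) 300
      h4Conjugates h4Reflections = true := by
  decide +kernel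

theorem h4_checkClasses :
    checkClasses (fun i U => slotStep h4Adj (Nat.add 8 i) (slotStep h4Adj i U)) (slotNeg 16) (slotInit 16 [0, 1, 2, 3, 8, 9, 10, 11]) 300
      h4Conjugates h4Reflections h4Classes h4Classes h4Certificates = true := by
  decide +kernel

/-- The neighbours of the nodes in type `E6`. -/
def e6Adj : List (List ℕ) :=
  [[1], [0, 2], [1, 3, 5], [2, 4], [3], [2]]

/-- Words for the reflections of type `E6`. -/
def e6Reflections : List ℕ := [
  8, 9, 10, 11, 12, 13, 577, 650, 723, 853, 796, 41482, 46163, 54357, 50844, 54941, 2953299,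
  3477589, 3252892, 3515037, 3552485, 208175772, 224952989, 227349733, 179115242, 14550308069,
  11463300330, 11482474282, 734877755178, 641462216529, 779054561619, 41063394130257,
  49859487152467, 3143256920148619, 187275641946526810, 15333263190854378197]

/-- The action of the letters on the reflections of type `E6`, as packed tables. -/
def e6Conjugates : List ℕ := [
  1994001606797922547493566612694064194772306075087646776476942478442126934784,
  1993998236169386229005162808056795415969969419939355827260540482799458697350,
  1993563399821503467077234441052862536793797284384084403274237016893219177344,
  1993994651544704570265891561084449865993813506315895793487341421908598063232,
  1994001660293301313466976948027542066981771784806010922910819320926641881216,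
  1937904266407811269877087558097248131200659978715110915527800618438268960896,
  1994001660714524972341548830439770996729229229393122119285717896844061737088,
  1994001660714524972341548830439770996729229229393122119285717896844061737088]

/-- Words for the conjugacy classes of type `E6`. -/
def e6Classes : List ℕ := [
  1, 8, 65, 66, 522, 523, 532, 4179, 4180, 4765, 304810, 4188, 4189, 79646073557, 33436, 33437,
  2139818, 51848, 637168427733, 33509, 267493, 17118506, 70085880459, 5099485993299,
  4829194233033154208538]

/-- Certificates for the classes of type `E6`. -/
def e6Certificates : List (ℕ × ℕ × List ℕ × List ℕ) := [
  (1, 7, [17118493, 8], [16512]),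
  (1, 4, [342355, 66], [16384, 16641, 16770, 652204825289965986]),
  (8, 5, [741], [16513, 16898, 17027, 4765269449242215045, 6499163240122450465,
  38123431889175478947]),
  (1, 5, [2730652, 4625], [16514, 16903, 1360524, 17156]),
  (66, 3, [292067072910163, 12], [16642, 17283, 17412, 16775, 68469903, 68470035]),
  (8, 5, [93], [11813248, 17288, 16643, 17796, 17925, 1508366, 415667919555660252189,
  13979776708936607, 38123431889175479843]),
  (1, 2, [18945699, 33297], [16772, 17415, 104154637, 4399121563, 4399122083]),
  (4163, 4, [], [16899, 18180, 18309, 17032, 18441, 586088373613315988, 74929815906764823,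
  24776201816227]),
  (66, 3, [12], [1622658, 18186, 16900, 1083533, 17159, 94070114347435933, 101951413695334426,
  2777129688802660092064, 4399122723]),
  (605, 2, [17119880, 79650691740], [18326, 94503429, 7122387727, 10618897]),
  (77, 2, [93, 5210], [18458, 81524540662284824, 890290690, 389264871377040705556, 94503433,
  1168893420177429]),
  (67, 3, [525, 169976602], [17028, 18190, 18821]),
  (8, 5, [11], [111608577, 18319, 4765269449242215043, 18820, 17029, 8849554,
  301170643748258253085, 51958489944457644191, 750504935835503010]),
  (1, 2, [618, 851, 177019548], [280492116256, 7122387736, 18708]),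
  (266467, 5, [], [17284, 18949, 17418, 19081, 17806, 12143247, 19219, 2274404420515]),
  (33309, 7, [], [17558, 17285, 18948, 9466946624357395, 17935, 1510030]),
  (4163, 11, [], [17690, 17289, 8553605, 19076, 81524540662285336, 10947346]),
  (4266, 9, [], [1082385, 69896724, 29173176648580, 8963595, 8735374, 6666111902]),
  (77, 3, [305803, 10], [10963857, 385311188367133771294, 7122387992, 18068]),
  (67, 5, [65], [616167765391869441, 18964, 17924, 17797, 1477535, 19490]),
  (2131741, 11, [], [18308, 18181, 68241546, 18836]),
  (33317, 8, [], [18436, 1623938, 8521876, 18185]),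
  (541, 3, [17048349, 342229], [11175959, 18195]),
  (41706, 5, [371339], [4389947532, 2256002156307, 10668448, 1739024]),
  (605, 5, [17474260, 65], [18850])]

theorem e6_checkCentral :
    checkCentral (slotStep e6Adj) id (slotInit 8 [0, 1, 2, 3, 4, 5]) 300 6
      1 = true := by
  decide +kernel

theorem e6_checkReflections :
    checkReflections (slotStep e6Adj) (slotInit 8 [0, 1, 2, 3, 4, 5]) 300
      e6Conjugates e6Reflections = true := by
  decide +kernel

theorem e6_checkClasses :
    checkClasses (slotStep e6Adj) id (slotInit 8 [0, 1, 2, 3, 4, 5]) 300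
      e6Conjugates e6Reflections e6Classes e6Classes e6Certificates = true := by
  decide +kernel

/-- The neighbours of the nodes in type `E7`. -/
def e7Adj : List (List ℕ) :=
  [[1], [0, 2], [1, 3, 6], [2, 4], [3, 5], [4], [2]]

/-- Words for the reflections of type `E7`. -/
def e7Reflections : List ℕ := [
  8, 9, 10, 11, 12, 13, 14, 577, 650, 723, 918, 796, 869, 41482, 46163, 58454, 50844, 59038, 55525,
  2953299, 3739734, 3252892, 3777182, 3552485, 3814630, 208175772, 241730206, 227349733, 244126950,
  181212402, 246523694, 14550308069, 15624049894, 11597518066, 15777441582, 11616692018,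
  1009755662126, 743467689778, 642535958417, 744694823282, 780128303507, 47660463896946,
  41132113607057, 49928206629267, 49938023697299, 2633083524860817, 3196033478282131,
  3143806675963019, 3495728933395612, 201208653293706379, 223726651430558876, 187280039993042010,
  11985962767811273818, 14291805777024967772, 16486219879833346774, 907544441385710461652,
  1055118393975386874582, 54484020359782135830179, 68651119808391071471270,
  4364881076625801904436510, 209004366637513016393181426, 11575555247383146330338445201,
  647201579578915533797515213960]

/-- The action of the letters on the reflections of type `E7`, as packed tables. -/
def e7Conjugates : List ℕ := [
  2727777530439385489463224896500870828639599081190923423603430357074753887479832586364623668954982186973952691042085274626297339872128,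
  2771449785807036488345416792731118573842345336292106130542139520091427974826471275837407594530185245955716408020379721608011672846471,
  2771790975302096104190207026256666207411822140450818341727194696086167746292916108326531907024255747711400326690218345432874003497984,
  2771793640842444323998577086454132120977690017960778899961483170845898623315666606697959934665744320288560041187300979833930114023552,
  2771793661503045378359916762494390690557599697388182569713288546085274530909128711052804100174430802442712580708344285846974723293312,
  2771793661833533252763135082775495062860297941057017977424136250190941953801240648425277346112574172141356905836954050103791029616768,
  2771793619032721582979396570106936039831610482518016237755467633678997321151274251320847043814862837953170875012263990514906558529664,
  2771793661833553425359032226260859563405888865112556908652588281467568662868891946545770691703153361016978023187142345925195842224256]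

/-- Words for the conjugacy classes of type `E7`, up to sign. -/
def e7Classes : List ℕ := [
  1, 8, 65, 66, 522, 523, 532, 750, 4179, 4180, 4766, 304818, 5934, 4188, 4189, 33436, 33437,
  33438, 2139826, 42798, 33445, 2438514, 33510, 267493, 267494, 17118514, 70085880971, 19507570,
  445576, 4829338348221364282138]

/-- Certificates for the classes of type `E7`. -/
def e7Certificates : List (ℕ × ℕ × List ℕ × List ℕ) := [
  (1, 14, [296294, 11], [16512]),
  (1, 7, [2971862, 67], [16384, 16641, 16770, 652204829584933299, 197372166882237235872061]),
  (9, 4, [5990, 11], [16513, 16898, 17027, 4765269724120253062, 6499165439145706031,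
  38123432164053516982, 14011890431452164192109116]),
  (1, 6, [2131045, 46483], [16514, 16904, 10945173, 17156, 1425867089167289]),
  (66, 3, [101], [16642, 17411, 17540, 10445946339247124, 16776, 68470033, 68470166,
  38364067943258833963, 4785229121584415926, 1425867089167929, 15381057882446979560473659]),
  (8, 5, [750, 93], [11813248, 17417, 16643, 18052, 18181, 19518544789995734370054, 1508496,
  415667921754683507878, 13981975732192298, 750522528029935152, 2990260019361665681204,
  48184483590087018167, 14011890431452164192109756]),
  (1, 2, [620811798152, 4625], [16772, 17544, 87639835, 1163395931391750, 4399138083,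
  21373886856617944859449, 3725233570983, 373785718061075612598, 24029456593314874214202]),
  (1, 5, [21947459, 6380], [333924679211751375678, 17932, 1585647278915971]),
  (4163, 4, [13], [16899, 18308, 18437, 18566, 17033, 18698, 586088377908299928, 74929820201748764,
  19866005998000, 269485137264114876647480, 2082873866686158595262394]),
  (66, 3, [12], [1622658, 18315, 16900, 18949, 85324413967878159, 17160, 94070118642403494,
  1656850, 101951417990301985, 12250806786037381995874078, 4382608034, 82700647834999495968737320,
  62499003796016383924, 373785718061075613238, 306254663781403150906, 2779568830318716830905,
  15381057882446979751315515]),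
  (593, 5, [13], [18586, 9466946632745494, 119669251, 352371523967118346392,
  50179206965187276423617120005, 94503430, 7659258641, 156153571970517991295248, 10619156,
  21003347888299, 9307478556084517, 2619734454801884890772550354736, 57228988213525940411,
  23927315819593685731642, 2619734454798622997799840286526]),
  (78, 3, [136948872, 41685], [18721, 81524540670673437, 94503434, 1168893487286553, 19077,
  165628017576624, 57228988213525940540]),
  (93, 5, [526], [5823500681780260921467536519, 18846, 616168040269906565, 1585647278522886, 17292,
  2990944977249007617845, 24890782288556, 10921458393105690767182259, 333955078509236126910]),
  (75, 3, [10878502536, 526], [17028, 18320, 12143127, 19206, 2483451152816]),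
  (8, 2, [51043, 94], [113672961, 18441, 17029, 11718746440108548, 40961492114617834570652124422,
  10943041083671931325318322, 22551771091776493619374, 48184483590087019319,
  3072002433188610475582]),
  (266467, 5, [], [17412, 19333, 19462, 17547, 19594, 18064, 12160145, 19734,
  22554756977821124577325, 4382608802, 1531026341455265114901294, 347107680595177064886,
  269485137264214833204152]),
  (4163, 9, [], [1770627, 19340, 17413, 102423716894700380140996774, 18185,
  5602836597099874752761629194, 4805800613577460772, 600725076697255074, 22231660456045473974199,
  24776738704950, 81371159051667902]),
  (33310, 7, [13], [17690, 17414, 19460, 2981621231253473028261643831429, 9466946632746134,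
  19518544789995734370065, 1510544, 81664383580295142821103678, 9830360765891248939732410]),
  (4163, 11, [13], [17825, 17418, 8553734, 19588, 5602836597099874752761629189, 81524540670674077,
  10947861, 2399333766330862472626, 752888973969754939]),
  (5420, 5, [8], [46631258538144087052237686656, 24069621364637835642930, 17950, 27286299755526,
  3724884067986, 11816334, 97984841910036605688974105, 94077728720095292, 2408135022969092328881,
  98427224942671994648972087, 347151429887968364478]),
  (533, 11, [], [113673857, 19346, 17541, 8719887, 1425867089168136, 6309718628927820158286710829,
  548179362, 16062565878123443, 588340177746315962, 5757570928497631732613433657,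
  872303010377122907721928251]),
  (78, 2, [41685, 750], [22230459363210916465190, 22966652306973, 58402587778, 19852, 17797,
  7275152522, 2244004072863, 376087833922473429680, 677942178513095229, 2900296665790]),
  (67, 5, [65], [46722812778225682177, 19480, 304977262343683344139, 89997294638209154025949458,
  18054, 633818655, 87536309271652654674381227, 1401166709088856620304302, 20147,
  417624178966648147512, 667716246010890558]),
  (136384812, 6, [], [18309, 2746494435535129693363, 18444, 177853283648363529915306, 18962,
  11546712388774985087601569, 1405533790040165549509664, 11209166578333547483123237,
  143638038089150]),
  (2131012, 11, [], [18564, 83464531944459454, 18310, 4688003233140525067, 19224,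
  1270633790888911272168375, 9884234012777520704015406]),
  (33318, 8, [], [18692, 1624194, 2751898714218665626545, 589727572233373720, 18314,
  93750049952402491, 158829189048651628072504]),
  (542, 3, [17048350, 342230], [11307292, 18255982661182, 18326, 1164573552168622]),
  (39270, 7, [304017], [183746360183741, 1214854, 9832931311256716541560962,
  2455300348370007230725, 7275153290, 19084, 723651102, 2776851163189530627637, 2900296666558]),
  (33318, 14, [], [8718868, 170717965467454829628583, 31372200953860, 567855885,
  11249665091720215811869602, 2441629040756323044792, 18265185504573]),
  (542, 5, [17359962, 92], [19251, 1148277646511419])]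

theorem e7_checkCentral :
    checkCentral (slotStep e7Adj) (slotNeg 8) (slotInit 8 [0, 1, 2, 3, 4, 5, 6]) 300 7
      797305972596351246080839856260354052868092200310342361814 = true := by
  decide +kernel

theorem e7_checkReflections :
    checkReflections (slotStep e7Adj) (slotInit 8 [0, 1, 2, 3, 4, 5, 6]) 300
      e7Conjugates e7Reflections = true := by
  decide +kernel

theorem e7_checkClasses :
    checkClasses (slotStep e7Adj) (slotNeg 8) (slotInit 8 [0, 1, 2, 3, 4, 5, 6]) 300
      e7Conjugates e7Reflections e7Classes e7Classes e7Certificates = true := by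
  decide +kernel

/-- The neighbours of the nodes in type `E8`. -/
def e8Adj : List (List ℕ) :=
  [[1], [0, 2], [1, 3, 7], [2, 4], [3, 5], [4, 6], [5], [2]]

/-- Words for the reflections of type `E8`. -/
def e8Reflections : List ℕ := [
  8, 9, 10, 11, 12, 13, 14, 15, 577, 650, 723, 983, 796, 869, 942, 41482, 46163, 62551, 50844,
  63135, 55525, 60206, 2953299, 4001879, 3252892, 4039327, 3552485, 4076775, 3852078, 208175772,
  258507423, 227349733, 260904167, 183309562, 246523694, 263300911, 14550308069, 16697791719,
  11731735802, 15777441582, 16851183407, 11750909754, 17004575095, 1009755662126, 1078475138863,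
  752057624378, 643609700305, 1088292206967, 753284757882, 781202045395, 69650696452471,
  48210219710842, 41200833083857, 49996926106067, 48288756255674, 50006743174099, 3090480362015674,
  2637481571371985, 3200431524793299, 3144356431777419, 3201059817151955, 3496278689210012,
  168839030971981265, 204867827990945235, 201243837665795723, 223761835802648220,
  187284438039557210, 223766862141517468, 12879927293844319883, 14321079174602878620,
  11986244242787988570, 14292087252001682524, 17639176568812315351, 15625192952414303461,
  767122205004298417242, 914696157593974830172, 1000012348934881506533, 907546693185524179668,
  1128907622070038799063, 58083008951600484688596, 72250108400209420329687,
  63985967055187541205733, 54484038374180645574307, 73373504305659226429095,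
  3486978620649376814274211, 4091441530456691401627301, 4695904440264005988980391,
  4667112675644647276066079, 260009586331203816057779485, 298695212558871949648377119,
  303530915837330466347201839, 211422219429663779366217978, 15697417122788813552352602348,
  19411237240644954377049975023, 13531022054039398071279134970, 11594898069720352434122737617,
  1234773612182011234728436123495, 868343360553538673358295353210, 742073476546429885318584682449,
  647356322157613182627789553288, 55513610505672348331708804381498,
  47511566091731650234760865397713, 41430804618761862324456367210120,
  3040257313312792600918918599662033, 3689294420629646054485230640814547,
  2651722404342840289360179067215496, 169706370545477514406205246015458952,
  232013932847895445948571201966100107, 14649930922212978844287712570927117379,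
  13819163424847406423722833158251902042, 882834772949815373546894567288895414810,
  1301541591622063873511593791277203956439, 50618821149478646311687106289577494384849,
  83285928373888738804171068603027242684631, 5283238581374402982704435222458449034512015,
  242972615437770832135456946233502845829919866, 16216257850561765467666515264362974130466825171,
  1134512438469489880006365444607348369057188224668,
  79228178099639259113827795527240371895942267860197,
  5497702873834358984692485487497712864582481645905710]

/-- The action of the letters on the reflections of type `E8`, as packed tables. -/
def e8Conjugates : List ℕ := [
  6869274331954488500663846172532687619356287348808577226307293815169392341401904503611873072223118924471849321094244232206746692869220325722590772849687430567579663299120328279141766659493969638501681223115614553958801504809740560155841602629431805903872,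
  6869274331952860362389846011981175875500330213567563941961073170246411966072233044558238716953310701080159230414193479413836792911445781331195635353102014646633487609557286316119153024950052751097133648704241524733873388392222543458931546395751559086216,
  6869274331742805087755156228934659749571596846521945920883275175269724691307019703314628569926690259373459058925150230030020741256674742251700485171811945713521405383593958490031111607601816275898798921946932211573606193794662817305348642316959961089152,
  6869274304855703890787879475543505796012625244148074495645515155121847981283262750124209219861109002530304845570474605310273741767774598062591167203717497969025201876398036007669949727180381565020894080101254446248047881309543801774476644393048804065408,
  6869270863306750677374453473098791905588071346227408180263375560017173611575526879575479473639161194592845593402551841088677338960790691749912423794746491899150070562851652063821636598645328044263791155220231068231185360533480997296209895697858514944128,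
  6868830345040739360455826620545838005870110741485541240261845232268637610694951757333597163616581013645885506932896774224699723331045754738302682629284622756159951971106372929248208849565146731713986377331221894644757484149307811384921270322214306087040,
  6812444006991290794871589490899622224089693959704717502353640546408307930037765550795897799991294878711845057432654609258806623070965993667526733990850673096953615521943475344472456843334251288895246757188309102486446411707030230198652011742067595182208,
  6869274331951141670318700549745804019236038182768678634025560210658688963899350307952515840465730564301357011916210823531577408717871828473949035199557730351370964726559661114578514010203602939409311344280447072655992776624816810466587862893672911782016]

/-- Words for the conjugacy classes of type `E8`, up to sign. -/
def e8Classes : List ℕ := [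
  1, 8, 65, 66, 522, 523, 532, 4179, 4180, 4767, 304826, 4188, 4189, 4262, 79646139095, 33436,
  33437, 33439, 2139834, 33445, 33446, 38127, 2438522, 637168493271, 33510, 267493, 267494, 267495,
  17118522, 70085881483, 304943, 19507578, 296823, 5101633477075, 267502, 267503, 268663, 267566,
  305015, 19508154, 331060045652695, 4837552913941822284570, 2139950, 2139951, 2178407, 2215377,
  2377647, 2439543, 2378682, 2168695, 2296555045626583, 560687050379, 9410889182935137233,
  136948666, 10743960715754055919, 17119607, 1095584698, 70121250259, 4485496368779,
  75253616073505289519, 1279177713568598295166242443, 1304411502929582458,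
  384471494340161234248220, 6006875100871278438190, 5556786773696600366830236287282400007843,
  1358499036934602652820893200336997841, 1731696633340911971228205976000864609808677164866052634]

/-- Certificates for the classes of type `E8`. -/
def e8Certificates : List (ℕ × ℕ × List ℕ × List ℕ) := [
  (1, 16, [34147, 38831], [16512]),
  (1, 6, [272183, 93], [16384, 16641, 16770, 652204833879900610, 197376778568259958227295,
  22947417295492627201680834052592]),
  (8, 4, [6382, 95], [16513, 16898, 17027, 4765269998998291079, 6499167638168961595,
  38123432438931555016, 14014251614695798037971547, 87326972046244471692699746955592301,
  85846337002107457156553881595839219]),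
  (1, 5, [4398, 46547, 33297], [16514, 16905, 8700566, 17156, 44843351822755000209722884956,
  108155190297470785972329699662676587]),
  (66, 3, [814, 12], [16642, 17283, 17412, 10448145363551127, 16777, 68469907, 68470041,
  38364070142283137973, 4785231320608719944, 55791384045185082028356584540,
  15399947348396050327389143, 1324552598216259248802086851757288,
  1324552598216259248802086851757419, 86440861950168584060271806911988721,
  698540263928602412977877636937548916]),
  (8, 5, [887], [11813248, 17290, 16643, 17796, 17925, 19518545915895649601031, 1508370,
  415667923953706763310, 13984174755447732, 8387804899609810748384412753, 2990260021560688936518,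
  48184485789110273485, 14014251614695798037972059, 639611098048373719722034784,
  2022169648351195347428458841441256, 3836429201180056981315453734443351704688,
  13563515449867698246088780443715059, 430964880403433187708749327388661515893]),
  (1, 4, [2131046, 5795], [16772, 17417, 87639583, 18054, 1163395998500359, 4399154345,
  3117562807978, 3725300679728, 4399155016, 94115323568539209, 24029456734052429678163,
  334111820014058817242, 56052513468971705827591799904, 51740705298872799136463570543,
  44843729487582473873172023030]),
  (4163, 4, [110], [16899, 18308, 18437, 18567, 17034, 18699, 586088382203283611,
  74929824496732448, 8387804899613087679268718552, 288374603213185643563086,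
  2101763332635129596463059, 5469501974112724828351622421722564700,
  251671694271303139937041875667168, 251671694271303139932411900922212,
  42530662641483424920587805686602373724450367304316122154991,
  680721040113184212182416069887395957]),
  (66, 3, [102, 12], [1622658, 18316, 16900, 18821, 18950, 85465151523342353, 17161,
  94070122937370798, 1656852, 101951422285269286, 4382608035, 4382608168,
  82700647836131783465027633, 62500129695923226566, 4399156168, 79294893995561121231833161,
  306254804518958614995, 871718810151537908383271508, 15399947348396150283946071,
  6973750523326747719652133336, 19600294853122926922330, 4311688399166455765803203119072,
  1324552598216259248846586516916968, 1324552598216259248802086851758955,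
  4977369743028404784391943055650818738287, 516793342865262195294191220404596005650997610996,
  44706627379812924516057237352733870710]),
  (607, 4, [110, 1281946716, 17120904], [18590, 94503431, 19077, 8196129555, 10619159]),
  (79, 5, [333486, 95], [18726, 81524540679062049, 1024508418, 389265152852034193691, 19205,
  94503435, 1168893554395421, 165628025965373, 57228988488403847515,
  24215155735806619528061809494383, 389265152852034194275, 65980531332327687633573121203844024689,
  2939122449267369359345008970613]),
  (67, 5, [4215, 14], [2784896647809, 18322, 17028, 1585647278524805, 19462,
  344400122861942488982684781575, 12143002, 33571222226862, 536812432496141744863238031297,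
  46224602013450778536674009869856181314, 13051788895095238,
  64599167846146696182676226476492272885286128081, 228669000416922746560777055504864,
  14014251614695810532542939, 549231133803460654413116143371615291365,
  4134346742153388555691953285195001279400166984173,
  4439221011968237115569403502568072869425551259391661083123, 2681630927954685455852931468406]),
  (8, 3, [378727, 15], [113672961, 18442, 17029, 11718746440108420, 12291100,
  792354161210037581022987034853532224007152898807073415, 26602747133037233539630, 97225250,
  22551771092051371657402, 67764434451546474558, 50190258061379942419738102854,
  22518817710646123150849818499581063891680, 100727370080793688180689359, 153557376981181571435483,
  493693761804491056401579411553, 59944206445595760815215674709187398256,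
  11190221190336606552190533361547471791351831867475088603518078067,
  40961492130680896519149882103]),
  (1, 3, [296006, 5795, 6965], [17158, 18953,
  3125031066592930757507203850961242252396371683496255120493195, 282766723753,
  93991441701091625353928198829359984, 3587364952110324404364944722530,
  14303185704956122981387571993346812772031794993187573]),
  (1, 3, [4853, 979, 9], [4705826492962507670, 8196129569, 19355,
  211649910812135755503777381009724164551568753623822, 280508894133,
  413378730739829165382313170035473524503349756745, 37647405967364000722,
  40423584380745892847601519592, 6459042664580886857764046756074724879854142313,
  678195206650000085390850986482994161, 1576914712913642290467814394946812670313335]),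
  (266467, 5, [14], [17284, 19589, 19718, 19847, 17420, 19979, 17810, 12176915, 20121, 4382609187,
  4382609320, 121954840489637459052884195788427395676016731198476342, 2274404454600,
  20480277971544865476460694046504186370723020, 288374603213285600120014,
  1814707799445116560357993688243632617892450720665440, 203433278769041966723686186085187939028957,
  4553514144543996593444281745506061853682037968993,
  188897223149759762106161253222443701002749542117862361595251953,
  10659441727243964919474124862131574]),
  (4163, 9, [], [1770499, 19597, 17285, 20742, 20871, 17930,
  15162426108545607575335903905687835908532993405506059, 1805589, 4805800647937215916,
  600725080992239144, 2400803153687352824234,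
  12379723336939718829287891243078963209405003521495615, 536812432496142040822838660434,
  277563126790405027728596, 18455974605643881188659534,
  3640458855392411382046333708984043487221592197947795459920, 458109941103113654483,
  1140339135208063192333520090, 894322560953201956877372164954877224779256963736555356,
  251671694271303159524841524498912, 122538636622984045123786905803301562997735533537071726,
  21861394567328415046964717844716818450046342462789065043725679,
  206858573657978493031916645994786944628239198745124631155062, 5120468443565306784566644599]),
  (33311, 7, [110], [17566, 17287, 19844, 20869, 9466946641134617, 19518545915895649601043,
  1510930, 19195890024193695289159, 9830360774898452489441235,
  23963781290339317498134426255147627317241021140448,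
  3979661755296635129730881809067019543665518333543, 21103947728420973124609903972855]),
  (4163, 11, [110], [17702, 17291, 8553607, 19972,
  1895303263568200946916987988210979488968603660997134, 81524540679062561, 10948248,
  2399333783923056906177, 569189261386757246442275806625237160752968126549,
  12222713414861360392246574815721134439349489558408808,
  11529683279211980923807809820215633547644647, 28564657972569517874004479988343]),
  (532, 11, [], [113673601, 19604, 17413, 21126, 683721212186824977, 1425867089167881, 68538147,
  548310952, 13340956, 35060945706, 35060945839, 17188465784966338, 11891883169844775171935441,
  4399158344, 2450038436151669002970, 6494811252883771986, 53456901644163273428,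
  11482957565810374117258360573797389349278039, 578155932665174588159607746773790723294,
  1324552598216259248846586516919144, 1324552598216259248808486935778283,
  346090175463808008856918874140920107375, 87153474360493912634815401645204962843820430068,
  25686137966044707219083945579127]),
  (66, 3, [55724], [123258370, 19724, 17414, 21134,
  7632302379264515550871792366708779700421001812124527744571035403, 18057, 1058805757965291937,
  406054765293321184075799663638006233255895537176255189551,
  960752198389168144931026081054839701686491938305356968762855249, 78950245567718037296303946,
  205088758381019326299240085420431565538394, 288374603213185643565776, 385498294970935202392,
  1052658300577747989698039129, 27750849077923977980763855082411650352748,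
  323940814135170472883069178987, 116121256222806264422418688765033880080880076894556018,
  2019263779297743223001871307526662711988853]),
  (593, 5, [13], [20894, 2565980872973392512025, 7308706819, 20237, 17541, 21254, 7275152391,
  524552996499, 3996216213164440258244909327595189024709918770304017764378,
  1486485396281786709971370, 36378117324568889865913567374763847394326765838640371765782,
  280508895012, 610323541299721402095092248227593048729142938262093050723849867823,
  88601461340737983, 426384224247519621484300065607815165989698763139296596027,
  610281762632054641516626138724256249478535842119307145330249110072,
  3020449493074024721896977676198834800444315928125, 57228988488403849687, 10753735991726915,
  1228547167921301601668945,
  1130220113995714527705947698410302396335836907158946964701443743366255187,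
  1193179641499731112913572130656245248824158352670199896, 193740388881483508339288743367144,
  180033120714786198491900702987253159724643,
  67366318195902179434804311886800953068346552013953881503976002155, 22551786541094612898665,
  39823372507729538575156624388034213843436,
  18624267635729040596298852792145565453550602454945429490963054,
  33912536208835990290876180121462106542965, 50179207260335181607264913015]),
  (75, 2, [303831, 751], [12371346999956113064601000869121296173460348643742216,
  21455446804451973366817, 58469696514, 20365, 17669, 21382, 7275152395,
  980308949639760331360871387072751604096542194924655151, 2243778711468,
  29917199841536331811137113725078918533901761122878, 43782968381,
  256982109813184156648384732845225468868599665469389610816095, 10600193662358473,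
  1228547167921301601685452, 239333240141332291248446976549188247675371637576299,
  4765428995978302563, 24912969782529435505641, 278432905991877880601080535830026086535795,
  65974503851665483755317480259940799478, 9863963871494977075221623]),
  (79, 3, [2453131, 10], [10997911, 191376641139876411557395, 8196129825,
  462821624047786628192312925774130282914457454147,
  69382894190071089828597462571516648290127258334009623558, 21552, 18203, 11497395150622911,
  429999631178989865982819140614027800399709340745, 103425090456810112335925466,
  10383462558955914225697154352694830766151006711483663462,
  3553926715421581622447032539955081643637, 84772466466359512127002310000907379,
  12615317704259544644070411868004626683004022]),
  (68, 5, [527], [178233538938369, 19730, 1918468, 894117470804545806, 17798, 36755558407,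
  6690787618, 33571222228270, 344400122861942905457744629187, 4929342736928510018,
  7184189770552480074, 167663032748491106434249899807313, 1249186938617321364214364,
  7713965028195172753873211742, 28742038287574245924076075487463,
  10730791765942613037231292052312685, 58430969814151305858345418364885831751262442099,
  2681630917032740447992231318774]),
  (136384812, 6, [], [18309, 21766, 21895, 18445,
  134942061242671153542387231186894449559022060656940555, 18836,
  2108380183338791785722186508215228739199866243847718,
  190793953640055538492080591132800807548527848887989,
  1215628306649134170327213570707866309926294887270684461, 35060946858,
  997555312333539990044944157021315048976147512216672335,
  1002045287415796000013125700603022510254476128972609733, 158932775606600,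
  27343748342835218856420986257215646204041977255898,
  3074617557568681841552331324560141283887981336686,
  3492188317796642679511290060407917719535530301662,
  49886333542766909364081732163066847190315759685432890735, 13616837589330708238417836320200311]),
  (266467, 5, [14], [1918980, 21774, 18310, 75962011, 18956,
  5764692065523368905658114629710678699860578675852919985547, 19474,
  7107111235550610414717362057066635084240587487211181481, 22937, 4336868385424333739453,
  4892521862059064609228600451028451818116967352319564076604,
  116696356683582232762104609048446421282533872037815742320498358,
  1522616683815944695128116046160315238182287985362888, 650969284718679625,
  288374603213285600122192, 2013659745992593189842704157296310034499696,
  6271035152800688340177656157,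
  45835145995618740437772427303094304346084348865713089162304550095969,
  1875729029832099424593201624785385038403183, 105004113389560949501349673435888412725107190]),
  (2131012, 11, [14], [18564, 21893, 606213766, 18311, 4688143970695989260,
  344400122861942488982684781595, 125593163899280584825221108994991246959784250360223266,
  199957701785804208787179906004918178109273618421439, 177185223789114002355006079805007503955404,
  60473460610216606097277096620314331161786242670, 143986183521358197071094654948071470746998508,
  34356001216919272007231574906614]),
  (33319, 8, [14], [18692, 1624194, 16867757655333894192798403898361806194928009310656014,
  5764692065523368905658114629710678699860578675852919985542, 589868309788837915, 18315,
  96026182196750037792822708891770358829700825,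
  6539279010524182935916135718990500185204508636508084028,
  34412501589522142902334056752752488633972, 2922195179584815227186215906133259982579,
  4849722686949292719062359862678991382351126517617, 6309823342899415373587961335]),
  (543, 5, [151565598, 342231], [11438368, 59902586964752842464787844041729988454, 22918, 18329,
  170544, 1644634438339406662230887844829043, 10597145092476840988081770162903655,
  12583377798464132403696661772245494]),
  (303916, 9, [], [21932, 2565980872973392512936, 19204944108035776841861, 22406, 7275153287,
  108964851268861836493818403, 19085, 128059796,
  28367191618311984731311629126345031235506227879079174772246,
  244998897783048596745398952156799151462192933268948474624163812153011,
  13618701809357272644634996220176801092180435318598782042283183076212348975, 88601461340739020,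
  1698792465939527082036138361356553273013579220131739410863917,
  47615890558865077331649831566763188068399181345551436503171637614149,
  163271941541282587191342676466983615576346120167363843724318399,
  25964235986183931185275073391466967728394470363924914247512,
  132789171586286963819843768091399679115692131, 320552963282193777365070885769063755290602,
  54755646053471297919216142789554269059970956762336836056777283698, 6309722130849051992428644471]),
  (39271, 7, [304081], [116960246069838126520656255739468468029888095, 21455446804451973367728,
  9832931383314310646253698, 2455300489107503974661,
  2982431435043594305917265626321380273763343538215, 7275153291, 19213, 732039587,
  25999851666538984355794099096836575917621343557807,
  198249176386726712560481948004005829209097503184697, 78332642290077516029436250655310354027,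
  8753723424953939180943604521334353753296607057, 2439923351399564450147,
  1828126846145671800515729851553909, 1688849349303225629162036527503602,
  357847373453356384354524338551]),
  (69, 5, [523], [982907437291800483734263687730349902517255861758567900776663681, 1087618,
  255972114799565534563331, 218892, 56801379282189142456886713383918131405815498277048715909,
  37344709639, 41639679634, 792310620160770146271290374510189568417945774503430446,
  255972114799565540071085, 422411906495318784121251677558737277597454585581229213639,
  38122157005443340104, 2170599868887095565278757456673467771853017,
  16598649039597454171214950752571396557539301, 220690547502164742375552472233114988714592,
  6733466959420805044733831751655692132, 1905531999886792532650399238864234507493143391410029,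
  53879528198770689056557578890328316532, 201810932118002657388414889302977008535926]),
  (41722, 5, [78, 46547], [303948399661450610704, 2264592091033, 22041607863164319294297223023675,
  720585720828465556217002092865138358940344101340124481638,
  11149142783085312392163977098719955357996094813880296916465616774, 2001814, 78551336,
  7456185935120848357149948766977246792878525514,
  175924248249137098857020203492129476273099883397908595, 1416457268813221330872786922166620,
  22520246373833863326410533400669295479913, 18887408366855950844236183443716074843015159]),
  (34005, 14, [], [123259266, 21781, 18438, 1185927, 7279938570, 23179, 37530242025430308266,
  519615028205369203885606682255361885486012726131007067706, 8800494481908110674, 1273822484748368,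
  2539628140328626657629, 304977161816903309148, 12397967271240080533259724854401248,
  251671694271303140237208550054628, 1514972366511005941455621728000499,
  1696557316782125387940353321928318455084448630642807]),
  (33311, 7, [13], [19102, 18439, 21901, 18565, 1185926, 605884585033304601,
  1547566721113354650435521552448305125013970505484943,
  52790951948131692775288007529914390739462613080744924864, 4863153820,
  10169645496198716295581119476328900183816006953232438712,
  83537576981459764503036290519098533166717503587, 1228538897374240026269649, 5207760445044889939,
  67086693814000294694712872055907919627762027956036458714,
  1776309441024425082399204579475071987928237700749024,
  50556715480698898995419822458507861629257640944279770605,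
  3542215048509400887124369816669796958492161415414, 21103947728420969557845723072759]),
  (550, 11, [15], [415667920184562059777, 137218, 1152771, 10510257655698928496970756,
  6494811252883769735, 123262378, 12380533768906837203484172419586451500477314536475277,
  310419297825, 37235022023252581858664542618312421934566688950343, 23015448844599,
  29319035594767405586626, 1271620280099845665888982,
  1975838429974466552178977700633319441852986969725396, 146727791129573963394453685386778203,
  357691187135789645345488085610069773160, 70876926210081422904628619208474635797597001839,
  23583015984543137019285321599347, 499523772373992656022612901908010900198983769554679289716]),
  (4262, 3, [522], [6494811252883769730, 21788, 18822, 1169415, 6494811252883769865, 18958,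
  68540330, 3838449233585747839817150396808466681445067998325526681638, 19274964226462010628034,
  30123812210212212636191799139654187344761611846983953045571,
  87160598610303719122530786316294144845557418451, 68541262, 38776613381875488852,
  2984902020860561352460247198292785328920711370081, 5195176518577558941991972107668603439596,
  19274964226449516059499, 68406168262465312071774759573645547631,
  19254624618542639328965859543508055372138362013276276]),
  (4847, 5, [110], [153728, 5588926210954804792943139061504608665, 63143283075, 22421, 19078,
  63109728647, 89772690430033485836162228032636082987341750882267171489,
  898552029636284945375116704886717174034473795332122749041776786, 10623639, 280508897195,
  51548745888309438854392407819195478506922139224627386541,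
  196252179279180933280782984418832472766051105796717231411956169,
  214208621399408433707007470256826508482508,
  6987709931304579277595461292280650165741883980752135719713249494,
  3932746715196138452124073220320, 2168928824672012760851780052204087297870313,
  10730792125847465946560533005621988, 82719561897771127888186418655597304044,
  180262203058245430114196324661083792087790, 5002727303376730404047683387961210309110]),
  (606, 5, [5210, 95], [23206, 50028321670778101835160340733158279585, 505146296706,
  207997999006098495460653695421924659644326599596063, 19206, 63109728651,
  6347595181898310860322296522102494374527244352, 358853696317,
  3323638326103056660051929246357031010186191706193, 193721245152420116348240037845743,
  596100836998912867, 23626171805595407342970262002416, 1232956562638923905833846]),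
  (5498, 3, [3384037, 41685], [1218894, 8196131233, 333088572649582915275623369257,
  2272881166937514341571098457179613207764092516343096165927302, 43782966041, 19376, 12163861,
  5889237781393938782, 5528845070417285716066882174635379555,
  69362828312003762623241625305176846490533026439407274473, 5425437853847008776128147831621032810,
  9827702440934321319709559]),
  (551, 6, [10927436892, 65], [2681630917032740447992231316546,
  6953015659382195185765307653473966553, 1440262550548758122993572085060421529819654,
  2632854149689628166645093161457, 74459825571453559]),
  (69829024172, 7, [], [19590, 23431, 19726, 23563, 20757, 777903139, 23699, 21148, 23833,
  53526387867, 106120849660534031452651952417895006617309680172145604,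
  46416085732926798754881477092507932595316985072, 19866029530574,
  36842250212560085805020951754390501381551569630568704659801, 29802384268887,
  5588300552793992461086639588805729652]),
  (136384812, 17, [], [20268, 19845, 23430, 19591, 2565980872973392514344, 20877, 97227299,
  37505151765568000276, 97229858, 4765268251293490358, 329550228604746640642885688662,
  5760161683074354821978033783]),
  (678, 13, [], [19073745209299833957534929776741504, 14506912,
  2005215069930722156865232719835312059603328227368374174705382631427868, 832821272121724167,
  348218741260, 87661608, 44731931823, 1522616644990032561903732102072531399803246484672074,
  202826848392843413662636629890491905037033773409389644626940468362497232,
  720616538703494993194779140433848289543955509226944122046,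
  108552117637630744197583619341520491739779475738396729143218514,
  70028998575987067623649355520798470366135602645,
  76117189320329689602418653876062710610765634673358593383,
  13124065898139873266500062502934418373496823]),
  (607, 11, [14], [4394307972, 10660902959430524850887661565301082575022481719208529709, 549968796,
  545541510, 68734225, 36755558409, 1153892846492826, 138931,
  5822046760807706697789156982142131398679105140,
  21990531165730291534912503201250680543599262787865836,
  99384693123744290102705263125318893209816553, 29647944519167373361284585709430]),
  (541, 29, [], [119254500932027715748732119496125952199110181625270745510973184, 8887203, 1151491,
  217108, 311524216979499421959, 1041953987670590632147859214749472405171219484453032085450657353,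
  96715394910628512680235962130984202179347099516006379445656390846, 35193184093,
  58875986704415789001103741778955549427673238259953769815,
  1853246454029533222616446040076672277526887485575147, 9006061486366985828078036405404999664,
  1324465049988681449088423693553397]),
  (155605420, 11, [], [23474, 63109729415, 20230,
  79815394837508858843480643070351572770881434081174884157, 1229790970689298811195790, 128062108,
  21269, 10624023, 94510238, 54687571108, 6443593854052847309524705549175189004224648926723660740,
  19905489870517, 177936717395182745891989479478078815341812,
  22306377573481844585419994992583886642674]),
  (4919, 19, [], [135819, 1085975, 1170332, 1159471132102933,
  250565279505263167483960776571537084551146512906139410419469, 138282,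
  343784990591224469348397885359976636078179794439373, 7912742339,
  34811088705855744529928741104329545593847161314666, 2491382117887290937627605667729394,
  1043130682485310457447471634776659874655933420, 1233604180165507653181429]),
  (533, 23, [], [1184512, 19519485083660761633281, 1085442, 1069319, 1072021, 1069446, 8641703,
  2971049252991931059238225827338662725441769721051, 1148279057931859, 9186848469884764,
  2970422770447610367317615876219295681676412476776, 823517708660723422779033139294965750]),
  (559, 7, [11], [8737792, 5237560384829576770784234759, 143735939861651, 2399488113871063781251,
  6189784208171327884694691147177339659815847813224519713780718013685,
  5764685750756455929225870833016693280919261116026268880112, 3464604865419339862327, 91508899,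
  1678741, 36200296745525908902804285698000789415140817469769893827105, 4929428211230855579,
  24890801295912, 17501976586361643741394180050403966451418719841964397,
  2971856996957991744101242270106721333491560370524, 22285438295614,
  322061787900567090939465584631]),
  (543, 4, [17048351, 342231], [37367681870313015476556421444110468380837034496565, 23822, 20102,
  19737, 423256026357476893225055930478196577046956777279, 1549923127695019521901387178070382,
  2681631802167601626573835244780, 1232969081007440772636790]),
  (4335, 5, [46383, 341292], [53867735430569246969344938875874873443,
  36428125297702257448409805715797118413668876308533, 678572985191665287,
  14029934307298063217352558, 167592,
  20026573916871021601606972778767245976414031223748826424381467,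
  1644637196063621636722530619367272, 24783, 78307524217214199]),
  (33310, 11, [110], [21414, 20747, 8557319, 23573,
  1895303263568200946916987988210979488968603660997125, 156159130123645837840929, 11443503,
  761994691, 5081764708729631363346228796781937900512259625301,
  13696301309069821067073224509431152, 4702948897334780007, 21093175863530439461383043306486]),
  (4919, 5, [10255556235, 1262902627], [9756125, 388919661465, 128062135, 13079557,
  1233838786177788429865975, 24942]),
  (69829024172, 14, [], [22450, 21894, 21767, 14505519, 606213774, 8886058, 1185941, 1169436]),
  (1091751271, 11, [], [6601803235205066297392409071858866818126842726600562766, 123262338,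
  8558471, 16867757655333894192798403898361806194928009310656005, 104175158, 21771,
  3702573091074854279048788316677750180219145573832, 68539682, 23189, 137258]),
  (17054639, 9, [], [1698730483477713017850736449328754394670018408896719,
  2108469706916736774099800487295225774365375917741570, 68474763,
  1570448133134037033224013782948866031242649540925099, 4691280253178779015, 45356471868,
  158916774925962, 27111477796747628840321968296305218064272260765092, 38800839970, 21779,
  35087046556, 1366186]),
  (277423, 8, [], [13265787253234218811762624487930723793721929475938374,
  31007247896861019038318326945184734055538401351242,
  3103166493011053002144382566498225719480700655838,
  2701234338195373363996964824882799257650499693221420,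
  28054986344848026182681132484766668401373141882982,
  199959802683630716558329198109481101900250733516607, 1144107417490695,
  62304865751658629513031657025093593741592385080, 22926, 2257262859580,
  322382324220585420542161720720, 6258717077674102054830339930389077845589006441, 21785, 11442863]),
  (18009447, 5, [21904154], [11819866, 301410308398871155982,
  824460182574539369639749152242070826498549655312291916,
  1713668971195267469656059762054043338594202, 1677573, 3347496255872302927108017678151803017107,
  17966992479523, 3378666691752860890548255057613434495871289648668758530076, 37489217030431036727,
  185640090540726, 708549296, 5056092233, 732371242, 290160810024]),
  (4855, 3, [77754882490], [1664264538601349254376146017405546176776477546731689, 18018951845179,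
  1753855334619289, 17876640504067, 4808373843490412807,
  115646920955716245564781173926402750533778693968976052,
  22239253080342422071820247633426951574801, 167026650168007561844000, 699037526846437464112911705,
  31461969063798482161493434570927]),
  (266487, 4, [77749185338], [824858421452642441335327443346645169846988951211382439,
  18568681019266, 136880, 104167849330997634840071922166888224773554237191100118,
  1504622845884005766552445420885893, 3705946014145601791919035422371, 37493249393265334170,
  73226612265736075, 914692162366854797, 6938543063485750090138463006495005469799495561510000323]),
  (272314, 11, [304922], [349653194525, 1689998119035630935756673329456717982078593,
  11879591100684475, 76063246919309477, 34356448868801784829438505703092,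
  1527019077674150398429474656648768813266438334274007, 43517581155, 11255038153737468808911479]),
  (326043075453868, 4, [305619], [2059995953557281583057353397095694040438589,
  62153135621010347765255871204281232702950286525234026265,
  11809665817455046199601108546439956651972459,
  422145851540483824011380485751934571589437099937334695939, 6763734081576712334338863826609510253,
  48249949835980954205725495404739565672, 2665007949713918260652004350069,
  153567074011635639261302]),
  (1248386699, 5, [17118276], [412575114406984852789023234772, 629307779869642703468927723,
  10558051696422791787563827556801239, 2013373597421897242437745449654965,
  374593355873365179339756862638419671836013517206, 2990260009309100923579,
  173571119363674161736690059876818, 7536553226228333680041051960178503405412456860,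
  1875100282354712601942722, 81383555577838266054089439, 5211189760464870065,
  2630745352831753637049382492657, 98762056606701276449151445, 156254060368674356451831]),
  (4335, 12, [1091489233, 341292], [23119]),
  (4919, 3, [79646092956, 1262902627, 5242], [1148802770721633, 1232848105570456776809263,
  78950253471537217811913527, 347048840576206357060454792524176956181, 23406])]

theorem e8_checkCentral :
    checkCentral (slotStep e8Adj) (slotNeg 8) (slotInit 8 [0, 1, 2, 3, 4, 5, 6, 7]) 300 8
      2386460640057907936080159426105938810115786372678820768644547743992339182404610305797027449391890530368201431 = true := by
  decide +kernel

theorem e8_checkReflections :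
    checkReflections (slotStep e8Adj) (slotInit 8 [0, 1, 2, 3, 4, 5, 6, 7]) 300
      e8Conjugates e8Reflections = true := by
  decide +kernel

theorem e8_checkClasses :
    checkClasses (slotStep e8Adj) (slotNeg 8) (slotInit 8 [0, 1, 2, 3, 4, 5, 6, 7]) 300
      e8Conjugates e8Reflections e8Classes e8Classes e8Certificates = true := by
  decide +kernel

namespace CoxeterMatrix

theorem isAdj_of_decide {m : ℕ} {adj : List (List ℕ)}
    (h : ((List.range m).all fun i => ((adj.getD i []).all fun j => decide (j < m)) &&
      (List.range m).all fun j => decide ((adj.getD i []).count j ≤ 2) &&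
        decide ((adj.getD i []).count i = 0)) = true) : IsAdj m adj := by
  simp only [List.all_eq_true, List.mem_range, Bool.and_eq_true, decide_eq_true_eq] at h
  exact h

theorem gram_of_forkLabel {n q : ℕ} (M : CoxeterMatrix (Fin n))
    (hM : ∀ i j, i < j → M i j = forkLabel n q i j) {adj : List (List ℕ)}
    (hadj : ∀ i j : Fin n, (adj.getD i []).count (j : ℕ) = if i = j then 0 else
      if (if (i : ℕ) < j then forkLabel n q i j else forkLabel n q j i) = 3 then 1 else 0)
    (i j : Fin n) : M.gram i j * 1 =
      ((if (j : ℕ) = i then 2 else 0) - ((adj.getD i []).count (j : ℕ) : ℝ)) * 1 := by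
  rw [M.gram_of_label (forkLabel n q) hM, hadj]
  have h3 : ∀ a b, forkLabel n q a b = 3 ∨ forkLabel n q a b = 2 := fun a b => by
    unfold forkLabel; split_ifs <;> simp
  simp only [← Fin.ext_iff, eq_comm (a := j)]
  have h4 : (if (i : ℕ) < j then forkLabel n q i j else forkLabel n q j i) = 3 ∨
      (if (i : ℕ) < j then forkLabel n q i j else forkLabel n q j i) = 2 := by
    split_ifs
    exacts [h3 _ _, h3 _ _]
  by_cases h1 : i = j
  · simp [h1]
  · rw [if_neg h1, if_neg h1, if_neg h1]
    obtain h4 | h4 := h4 <;> rw [h4] <;> simp [Real.cos_pi_div_three]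

theorem stronglyReal_of_forkLabel_six (M : CoxeterMatrix (Fin 6))
    (hM : ∀ i j, i < j → M i j = forkLabel 6 2 i j) : StronglyReal M.Group := by
  obtain ⟨Rep, h, -⟩ := M.isWordModel_of_adj (adj := e6Adj) (κ := fun _ => 1)
    (l := [0, 1, 2, 3, 4, 5]) (by norm_num) (isAdj_of_decide (by decide)) (by decide)
    (fun _ => one_pos) (by decide) (by decide) (by decide) (M.gram_of_forkLabel hM (by decide))
  exact M.stronglyReal_of_certificate h (by norm_num) e6_checkCentral e6_checkReflections
    (by decide) (by decide) (by decide) e6_checkClasses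

theorem stronglyReal_of_forkLabel_seven (M : CoxeterMatrix (Fin 7))
    (hM : ∀ i j, i < j → M i j = forkLabel 7 2 i j) : StronglyReal M.Group := by
  obtain ⟨Rep, -, h⟩ := M.isWordModel_of_adj (adj := e7Adj) (κ := fun _ => 1)
    (l := [0, 1, 2, 3, 4, 5, 6]) (by norm_num) (isAdj_of_decide (by decide)) (by decide)
    (fun _ => one_pos) (by decide) (by decide) (by decide) (M.gram_of_forkLabel hM (by decide))
  exact M.stronglyReal_of_certificate h (by norm_num) e7_checkCentral e7_checkReflections
    (by decide) (by decide) (by decide) e7_checkClasses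

theorem stronglyReal_of_pathLabel_one_four (M : CoxeterMatrix (Fin 4))
    (hM : ∀ i j, i < j → M i j = pathLabel 1 4 i j) : StronglyReal M.Group := by
  obtain ⟨Rep, -, h⟩ := M.isWordModel_of_adj (adj := f4Adj)
    (κ := fun i => if (i : ℕ) < 2 then 1 else √2)
    (l := [0, 1, 2, 3]) (by norm_num) (isAdj_of_decide (by decide)) (by decide)
    (fun i => by split_ifs <;> positivity) (by decide) (by decide) (by decide) (fun i j => by
      have h2 : √2 * √2 = 2 := Real.mul_self_sqrt (by norm_num)
      rw [M.gram_of_label (pathLabel 1 4) hM]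
      fin_cases i <;> fin_cases j <;>
        simp [pathLabel, f4Adj, Real.cos_pi_div_three, Real.cos_pi_div_four] <;>
        first | ring1 | linear_combination h2)
  exact M.stronglyReal_of_certificate h (by norm_num) f4_checkCentral f4_checkReflections
    (by decide) (by decide) (by decide) f4_checkClasses

theorem stronglyReal_of_pathLabel_five_three (M : CoxeterMatrix (Fin 3))
    (hM : ∀ i j, i < j → M i j = pathLabel 0 5 i j) : StronglyReal M.Group := by
  obtain ⟨Rep, h⟩ := M.isWordModel_of_adj_double (adj := h3Adj) (φ := Real.goldenRatio)
    (l := [0, 1, 2, 8, 9, 10]) (by norm_num) (isAdj_of_decide (by decide))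
    (by decide) Real.goldenRatio_pos (by decide) (by decide) (by decide) (fun i j a b => by
      have hφ := Real.goldenRatio_sq
      have hc : Real.cos (Real.pi / 5) = Real.goldenRatio / 2 := by
        rw [Real.cos_pi_div_five, Real.goldenRatio]; ring
      rw [M.gram_of_label (pathLabel 0 5) hM]
      fin_cases i <;> fin_cases j <;>
        simp [pathLabel, h3Adj, Real.cos_pi_div_three, hc] <;>
        linear_combination -b * hφ) (by decide)
  exact M.stronglyReal_of_certificate h (by norm_num) h3_checkCentral h3_checkReflections
    (by decide) (by decide) (by decide) h3_checkClasses

theorem stronglyReal_of_pathLabel_five_four (M : CoxeterMatrix (Fin 4))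
    (hM : ∀ i j, i < j → M i j = pathLabel 0 5 i j) : StronglyReal M.Group := by
  obtain ⟨Rep, h⟩ := M.isWordModel_of_adj_double (adj := h4Adj) (φ := Real.goldenRatio)
    (l := [0, 1, 2, 3, 8, 9, 10, 11]) (by norm_num) (isAdj_of_decide (by decide))
    (by decide) Real.goldenRatio_pos (by decide) (by decide) (by decide) (fun i j a b => by
      have hφ := Real.goldenRatio_sq
      have hc : Real.cos (Real.pi / 5) = Real.goldenRatio / 2 := by
        rw [Real.cos_pi_div_five, Real.goldenRatio]; ring
      rw [M.gram_of_label (pathLabel 0 5) hM]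
      fin_cases i <;> fin_cases j <;>
        simp [pathLabel, h4Adj, Real.cos_pi_div_three, hc] <;>
        linear_combination -b * hφ) (by decide)
  exact M.stronglyReal_of_certificate h (by norm_num) h4_checkCentral h4_checkReflections
    (by decide) (by decide) (by decide) h4_checkClasses

end CoxeterMatrix

namespace CoxeterMatrix

theorem stronglyReal_of_forkLabel_eight (M : CoxeterMatrix (Fin 8))
    (hM : ∀ i j, i < j → M i j = forkLabel 8 2 i j) : StronglyReal M.Group := by
  obtain ⟨Rep, -, h⟩ := M.isWordModel_of_adj (adj := e8Adj) (κ := fun _ => 1)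
    (l := [0, 1, 2, 3, 4, 5, 6, 7]) (by norm_num) (isAdj_of_decide (by decide)) (by decide)
    (fun _ => one_pos) (by decide) (by decide) (by decide) (M.gram_of_forkLabel hM (by decide))
  exact M.stronglyReal_of_certificate h (by norm_num) e8_checkCentral e8_checkReflections
    (by decide) (by decide) (by decide) e8_checkClasses

end CoxeterMatrix

namespace CoxeterMatrix

theorem stronglyReal_of_hasStandardLabelling {B : Type*} [Nonempty B] (M : CoxeterMatrix B)
    (hM : M.HasStandardLabelling) : StronglyReal M.Group := by
  obtain ⟨n, v, hinj, hsurj, h⟩ := hM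
  let e : B ≃ Fin n := (Equiv.ofBijective (fun i : Fin n => v i)
    ⟨fun i j hij => Fin.ext (hinj i i.2 j j.2 hij), fun b => by
      obtain ⟨i, hi, hb⟩ := hsurj b
      exact ⟨⟨i, hi⟩, hb⟩⟩).symm
  have hlabel {f : ℕ → ℕ → ℕ} (hf : ∀ i j, i < j → j < n → M (v i) (v j) = f i j) :
      ∀ i j : Fin n, i < j → M.reindex e i j = f i j := fun i j hij => hf i j hij j.2
  obtain hn | ⟨p, m, hf, h⟩ | ⟨q, hf, h⟩ := h
  · refine M.stronglyReal_of_pair (v 0) (v 1) fun b => ?_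
    obtain ⟨i, hi, rfl⟩ := hsurj b
    obtain rfl | rfl : i = 0 ∨ i = 1 := by omega
    exacts [.inl rfl, .inr rfl]
  · refine M.stronglyReal_of_reindex e ?_
    have hl := hlabel hf
    generalize M.reindex e = N at hl
    clear hlabel hf e hinj hsurj
    obtain rfl | ⟨rfl, rfl⟩ | ⟨rfl, rfl, rfl⟩ | ⟨rfl, rfl, rfl | rfl⟩ := h
    · exact N.stronglyReal_of_pathLabel_three hl
    · exact N.stronglyReal_of_pathLabel_four hl
    · exact N.stronglyReal_of_pathLabel_one_four hl
    · exact N.stronglyReal_of_pathLabel_five_three hl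
    · exact N.stronglyReal_of_pathLabel_five_four hl
  · refine M.stronglyReal_of_reindex e ?_
    have hl := hlabel hf
    generalize M.reindex e = N at hl
    clear hlabel hf e hinj hsurj
    obtain ⟨rfl, hn⟩ | ⟨rfl, rfl | rfl | rfl⟩ := h
    · exact stronglyReal_of_forkLabel_one hn N hl
    · exact N.stronglyReal_of_forkLabel_six hl
    · exact N.stronglyReal_of_forkLabel_seven hl
    · exact N.stronglyReal_of_forkLabel_eight hl

/-- Carter's theorem: every element of a finite Coxeter group is a product of two involutions. -/
theorem stronglyReal_of_finite {B : Type*} (M : CoxeterMatrix B) [Finite M.Group] :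
    StronglyReal M.Group :=
  M.stronglyReal_of_irred fun _ _ M _ hM =>
    M.stronglyReal_of_hasStandardLabelling hM.hasStandardLabelling

end CoxeterMatrix

theorem CoxeterSystem.stronglyReal {B W : Type*} [Group W] [Finite W] {M : CoxeterMatrix B}
    (cs : CoxeterSystem M W) : StronglyReal W :=
  have : Finite M.Group := .of_equiv W cs.mulEquiv.toEquiv
  M.stronglyReal_of_finite.of_surjective cs.mulEquiv.symm.toMonoidHom cs.mulEquiv.symm.surjective

/-- In a direct product of finite Coxeter groups, whose length function is the
sum of the component length functions, excess is additive:
`e(w₁, w₂) = e(w₁) + e(w₂)`. -/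
theorem stmt16 {B₁ B₂ W₁ W₂ : Type*} [Group W₁] [Group W₂] [Finite W₁] [Finite W₂]
    (M₁ : CoxeterMatrix B₁) (M₂ : CoxeterMatrix B₂)
    (cs₁ : CoxeterSystem M₁ W₁) (cs₂ : CoxeterSystem M₂ W₂)
    (w : W₁ × W₂) :
    excess (fun p : W₁ × W₂ => cs₁.length p.1 + cs₂.length p.2) w
      = excess cs₁.length w.1 + excess cs₂.length w.2 := by
  exact excess_prod cs₁.stronglyReal cs₂.stronglyReal cs₁.length_mul_le cs₂.length_mul_le w
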